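/- arXiv:2409.10299 — 2 statements merged into one kernel-verified Lean document; each statement's English description precedes it below -/
import Mathlib

section
/- Under the standing assumptions, suppose the exponent p from hypothesis (f3) satisfies 2 < p < 2 + 4/N. Then ∫_Ω u_λ² dx → +∞ as λ → +∞. -/
open MeasureTheory Set Filter Topology

noncomputable section

/-- `N`-dimensional Euclidean space. -/
abbrev Euc (N : ℕ) := EuclideanSpace ℝ (Fin N)

/-- The Laplacian of a real-valued function on Euclidean space, defined as the
sum of the pure second partial derivatives in the coordinate directions. -/
def lap {N : ℕ} (u : Euc N → ℝ) (x : Euc N) : ℝ :=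
  ∑ i : Fin N,
    fderiv ℝ (fun y => fderiv ℝ u y (EuclideanSpace.single i 1)) x (EuclideanSpace.single i 1)

/-- The first Dirichlet eigenvalue of `-Δ` on `Ω`, defined as the infimum of
Rayleigh quotients of nonzero smooth functions with compact support contained in `Ω`. -/
def firstEig {N : ℕ} (Ω : Set (Euc N)) : ℝ :=
  sInf { r : ℝ | ∃ φ : Euc N → ℝ, ContDiff ℝ (⊤ : ℕ∞) φ ∧ HasCompactSupport φ ∧
    tsupport φ ⊆ Ω ∧ φ ≠ 0 ∧
    r = (∫ x, ‖fderiv ℝ φ x‖ ^ 2) / (∫ x, (φ x) ^ 2) }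

/-- `u` is a (classical) positive solution of `-Δ u + lam • u = f(x, u)` in `Ω`,
vanishing on the boundary: `u ∈ C²(Ω) ∩ C(closure Ω)`, `u > 0` in `Ω`, `u = 0` on `∂Ω`. -/
def IsPosSolution {N : ℕ} (Ω : Set (Euc N)) (f : Euc N → ℝ → ℝ) (lam : ℝ)
    (u : Euc N → ℝ) : Prop :=
  ContDiffOn ℝ 2 u Ω ∧ ContinuousOn u (closure Ω) ∧ (∀ x ∈ Ω, 0 < u x) ∧
    (∀ x ∈ frontier Ω, u x = 0) ∧ ∀ x ∈ Ω, - lap u x + lam * u x = f x (u x)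

/-- The standing assumptions of the paper: `Ω ⊆ ℝ^N` is a bounded domain with `C¹`
boundary, convex in every coordinate direction and invariant under a blockwise
orthogonal group `G = O(m₁) × ⋯ × O(m_ℓ)` with every `m_i ≥ 2`; the nonlinearity
`f` satisfies (f1), (f2), (f3) with splitting `f(x,t) = d(x)|t|^{p-2} t + g(x,t)`;
and for every `λ > -λ₁(Ω)` the problem has exactly one positive solution `u λ`. -/
structure Standing (N : ℕ) (Ω : Set (Euc N)) (f : Euc N → ℝ → ℝ)
    (d : Euc N → ℝ) (g : Euc N → ℝ → ℝ) (p : ℝ) (u : ℝ → Euc N → ℝ) : Prop where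
  dim : 2 ≤ N
  isOpen : IsOpen Ω
  conn : IsConnected Ω
  bdd : Bornology.IsBounded Ω
  c1bdry : ∀ x ∈ frontier Ω, ∃ U : Set (Euc N), IsOpen U ∧ x ∈ U ∧
      ∃ F : Euc N → ℝ, ContDiff ℝ 1 F ∧ (∀ y ∈ U, fderiv ℝ F y ≠ 0) ∧
        Ω ∩ U = {y ∈ U | F y < 0}
  conv : ∀ i : Fin N, ∀ x ∈ Ω, ∀ y ∈ Ω, (∀ j, j ≠ i → x j = y j) → segment ℝ x y ⊆ Ω
  symm : ∃ ℓ : ℕ, 1 ≤ ℓ ∧ ∃ β : Fin N → Fin ℓ, Monotone β ∧ Function.Surjective β ∧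
      (∀ j, 2 ≤ (Finset.univ.filter (fun i => β i = j)).card) ∧
      ∀ e : Euc N ≃ₗᵢ[ℝ] Euc N,
        (∀ j : Fin ℓ, ∀ x : Euc N, (∀ i, β i ≠ j → x i = 0) → ∀ i, β i ≠ j → e x i = 0) →
          e '' Ω = Ω ∧ (∀ x t, f (e x) t = f x t) ∧ ∀ x, d (e x) = d x
  f_c1 : ContDiffOn ℝ 1 (Function.uncurry f) (Ω ×ˢ (univ : Set ℝ))
  f_zero : ∀ x ∈ Ω, f x 0 = 0 ∧ deriv (f x) 0 = 0
  f_ar : ∃ a b : ℝ, 2 < a ∧ a ≤ b ∧ (3 ≤ N → b < 2 * N / ((N : ℝ) - 2)) ∧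
      ∀ᵐ x ∂(volume : Measure (Euc N)).restrict Ω, ∀ t : ℝ, t ≠ 0 →
        0 < (a - 1) * f x t * t ∧ (a - 1) * f x t * t ≤ deriv (f x) t * t ^ 2 ∧
          deriv (f x) t * t ^ 2 ≤ (b - 1) * f x t * t
  f_bdd : ∃ M : ℝ, 0 < M ∧ ∀ x ∈ Ω, |f x 1| < M ∧ |f x (-1)| < M
  hp : 2 < p ∧ (3 ≤ N → p < 2 * N / ((N : ℝ) - 2))
  f_split : ∀ x t, f x t = d x * |t| ^ (p - 2) * t + g x t
  d_c1 : ContDiffOn ℝ 1 d (closure Ω)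
  d_bdd : ∃ C : ℝ, ∀ x ∈ Ω, |d x| ≤ C
  d_nonneg : ∀ x ∈ closure Ω, 0 ≤ d x
  d_zero : d 0 = 1
  g_top : ∀ x ∈ Ω, Tendsto (fun t : ℝ => g x t / t ^ (p - 1)) atTop (𝓝 0)
  g_zero : ∀ x ∈ Ω, Tendsto (fun t : ℝ => g x t / t) (𝓝[≠] (0 : ℝ)) (𝓝 0)
  mono : ∀ i : Fin N, ∀ x ∈ Ω, ∀ y ∈ Ω, (∀ j, j ≠ i → x j = y j) → |x i| ≤ |y i| →
      (∀ t, f y t ≤ f x t) ∧ d y ≤ d x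
  sol : ∀ lam : ℝ, - firstEig Ω < lam →
      IsPosSolution Ω f lam (u lam) ∧
        ∀ v, IsPosSolution Ω f lam v → EqOn v (u lam) (closure Ω)

theorem integrable_exp_neg_mul_sq_norm {N : ℕ} {b : ℝ} (hb : 0 < b) :
    Integrable (fun y : Euc N => Real.exp (-b * ‖y‖ ^ 2)) := by
  apply Integrable.of_integral_ne_zero
  rw [GaussianFourier.integral_rexp_neg_mul_sq_norm hb]
  positivity

theorem norm_mul_exp_le {N : ℕ} (y : Euc N) :
    ‖y‖ * Real.exp (-(1 / 2) * ‖y‖ ^ 2) ≤ Real.exp (-(1 / 4) * ‖y‖ ^ 2) := by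
  have h1 : ‖y‖ ≤ Real.exp ((1 / 4) * ‖y‖ ^ 2) := by
    nlinarith [Real.add_one_le_exp ((1 / 4) * ‖y‖ ^ 2), sq_nonneg (‖y‖ / 2 - 1)]
  calc _ ≤ Real.exp ((1 / 4) * ‖y‖ ^ 2) * Real.exp (-(1 / 2) * ‖y‖ ^ 2) := by gcongr
    _ = _ := by rw [← Real.exp_add]; ring_nf

theorem integrable_norm_mul_exp {N : ℕ} :
    Integrable (fun y : Euc N => ‖y‖ * Real.exp (-(1 / 2) * ‖y‖ ^ 2)) := by
  refine (integrable_exp_neg_mul_sq_norm (N := N) (b := 1 / 4) (by norm_num)).mono' ?_ ?_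
  · exact (by fun_prop : Continuous _).aestronglyMeasurable
  · refine Eventually.of_forall fun y => ?_
    rw [Real.norm_of_nonneg (by positivity)]
    exact norm_mul_exp_le y

theorem hasFDerivAt_gaussian {N : ℕ} (y : Euc N) :
    HasFDerivAt (fun y : Euc N => Real.exp (-(1 / 2) * ‖y‖ ^ 2))
      (-(Real.exp (-(1 / 2) * ‖y‖ ^ 2)) • innerSL ℝ y) y := by
  have := (((hasStrictFDerivAt_norm_sq y).hasFDerivAt).const_mul (-(1 / 2) : ℝ)).exp
  refine this.congr_fderiv ?_
  ext z
  simp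

theorem fderiv_gaussian_single {N : ℕ} (y : Euc N) (i : Fin N) :
    fderiv ℝ (fun y : Euc N => Real.exp (-(1 / 2) * ‖y‖ ^ 2)) y (EuclideanSpace.single i 1)
      = -(y i * Real.exp (-(1 / 2) * ‖y‖ ^ 2)) := by
  rw [(hasFDerivAt_gaussian y).fderiv]
  simp [EuclideanSpace.inner_single_right]
  ring

theorem integrable_mul_of_continuous_hasCompactSupport {N : ℕ} {w ψ : Euc N → ℝ}
    (hw : Continuous w) (hc : HasCompactSupport w) (hψ : Integrable ψ) (x₀ : Euc N) (s : ℝ) :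
    Integrable (fun y => w (x₀ + s • y) * ψ y) := by
  obtain ⟨C, hC⟩ := hc.exists_bound_of_continuous hw
  exact hψ.bdd_mul (c := C) ((by fun_prop : Continuous _).aestronglyMeasurable)
    (Eventually.of_forall fun y => hC _)

theorem integral_fderiv_mul_gaussian {N : ℕ} {v : Euc N → ℝ} (hv : ContDiff ℝ 2 v)
    (hc : HasCompactSupport v) (x₀ : Euc N) (s : ℝ) :
    ∫ y, fderiv ℝ v (x₀ + s • y) y * Real.exp (-(1 / 2) * ‖y‖ ^ 2)
      = s * ∫ y, lap v (x₀ + s • y) * Real.exp (-(1 / 2) * ‖y‖ ^ 2) := by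
  set Φ : Euc N → ℝ := fun y => Real.exp (-(1 / 2) * ‖y‖ ^ 2) with hΦ
  have hΦi : Integrable Φ := integrable_exp_neg_mul_sq_norm (by norm_num)
  have hΦd : ∀ y, DifferentiableAt ℝ Φ y := fun y => (hasFDerivAt_gaussian y).differentiableAt
  have hyΦ : ∀ i : Fin N, Integrable (fun y : Euc N => y i * Φ y) := fun i => by
    refine integrable_norm_mul_exp.mono' (by fun_prop : Continuous _).aestronglyMeasurable ?_
    refine Eventually.of_forall fun y => ?_
    rw [norm_mul, Real.norm_of_nonneg (Real.exp_pos _).le]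
    gcongr
    exact PiLp.norm_apply_le y i
  let e : Fin N → Euc N := fun i => EuclideanSpace.single i 1
  have hD : ∀ i, ContDiff ℝ 1 (fun z => fderiv ℝ v z (e i)) := fun i =>
    (hv.fderiv_right (m := 1) (by norm_num)).clm_apply contDiff_const
  have hDc : ∀ i, HasCompactSupport (fun z => fderiv ℝ v z (e i)) := fun i => hc.fderiv_apply ℝ _
  have hDD : ∀ i, Continuous (fun z => fderiv ℝ (fun z => fderiv ℝ v z (e i)) z (e i)) :=
    fun i => ((hD i).continuous_fderiv (by norm_num)).clm_apply continuous_const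
  have hDDc : ∀ i, HasCompactSupport (fun z => fderiv ℝ (fun z => fderiv ℝ v z (e i)) z (e i)) :=
    fun i => (hDc i).fderiv_apply ℝ _
  have hchain : ∀ i y, fderiv ℝ (fun y => fderiv ℝ v (x₀ + s • y) (e i)) y (e i)
      = s * fderiv ℝ (fun z => fderiv ℝ v z (e i)) (x₀ + s • y) (e i) := fun i y => by
    have h1 : HasFDerivAt (fun y : Euc N => x₀ + s • y) (s • ContinuousLinearMap.id ℝ (Euc N)) y :=
      ((hasFDerivAt_id y).const_smul s).const_add x₀
    have h2 := (((hD i).differentiable (by norm_num)) (x₀ + s • y)).hasFDerivAt.comp y h1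
    have h3 := h2.fderiv
    simp only [Function.comp_def] at h3
    rw [h3]
    simp
  have hibp : ∀ i, ∫ y, fderiv ℝ v (x₀ + s • y) (e i) * (y i * Φ y)
      = s * ∫ y, fderiv ℝ (fun z => fderiv ℝ v z (e i)) (x₀ + s • y) (e i) * Φ y := fun i => by
    have := integral_mul_fderiv_eq_neg_fderiv_mul_of_integrable (μ := volume) (𝕜 := ℝ)
      (f := fun y => fderiv ℝ v (x₀ + s • y) (e i)) (g := Φ) (v := e i)
      ?_ ?_ ?_ ?_ ?_
    · simp only [hchain, hΦ, e, fderiv_gaussian_single, mul_neg, integral_neg, neg_inj, mul_assoc,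
        integral_const_mul] at this
      exact this
    · simp only [hchain, mul_assoc]
      exact (integrable_mul_of_continuous_hasCompactSupport (hDD i) (hDDc i) hΦi x₀ s).const_mul s
    · simp only [hΦ, e, fderiv_gaussian_single]
      exact integrable_mul_of_continuous_hasCompactSupport (hD i).continuous (hDc i)
        (hyΦ i).neg x₀ s
    · exact integrable_mul_of_continuous_hasCompactSupport (hD i).continuous (hDc i) hΦi x₀ s
    · intro y _
      exact DifferentiableAt.comp (g := fun z => fderiv ℝ v z (e i)) (f := fun y => x₀ + s • y) y
        (((hD i).differentiable (by norm_num)) (x₀ + s • y)) (by fun_prop)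
    · intro y _
      exact hΦd y
  have hsum : ∀ y : Euc N, ∀ L : Euc N →L[ℝ] ℝ, L y = ∑ i, L (e i) * y i := fun y L => by
    conv_lhs => rw [← (EuclideanSpace.basisFun (Fin N) ℝ).sum_repr y]
    simp [e, mul_comm]
  calc _ = ∫ y, ∑ i, fderiv ℝ v (x₀ + s • y) (e i) * (y i * Φ y) := by
        congr 1; ext y
        rw [hsum y, Finset.sum_mul]
        simp only [mul_assoc, hΦ]
    _ = ∑ i, s * ∫ y, fderiv ℝ (fun z => fderiv ℝ v z (e i)) (x₀ + s • y) (e i) * Φ y := by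
        rw [integral_finsetSum]
        · simp only [hibp]
        · exact fun i _ => integrable_mul_of_continuous_hasCompactSupport (hD i).continuous (hDc i)
            (hyΦ i) x₀ s
    _ = _ := by
        rw [← Finset.mul_sum, ← integral_finsetSum]
        · simp only [lap, Finset.sum_mul, e, hΦ]
        · exact fun i _ => integrable_mul_of_continuous_hasCompactSupport (hDD i) (hDDc i) hΦi x₀ s

theorem hasDerivAt_integral_mul_gaussian {N : ℕ} {v : Euc N → ℝ} (hv : ContDiff ℝ 2 v)
    (hc : HasCompactSupport v) (x₀ : Euc N) (s : ℝ) :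
    HasDerivAt (fun s : ℝ => ∫ y, v (x₀ + s • y) * Real.exp (-(1 / 2) * ‖y‖ ^ 2))
      (s * ∫ y, lap v (x₀ + s • y) * Real.exp (-(1 / 2) * ‖y‖ ^ 2)) s := by
  rw [← integral_fderiv_mul_gaussian hv hc]
  have hΦi : Integrable (fun y : Euc N => Real.exp (-(1 / 2) * ‖y‖ ^ 2)) :=
    integrable_exp_neg_mul_sq_norm (by norm_num)
  have hcont : Continuous (fderiv ℝ v) := hv.continuous_fderiv (by norm_num)
  obtain ⟨C, hC⟩ := (hc.fderiv ℝ).exists_bound_of_continuous hcont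
  refine (hasDerivAt_integral_of_dominated_loc_of_deriv_le (s := univ)
    (F' := fun s y => fderiv ℝ v (x₀ + s • y) y * Real.exp (-(1 / 2) * ‖y‖ ^ 2))
    (bound := fun y => C * (‖y‖ * Real.exp (-(1 / 2) * ‖y‖ ^ 2)))
    univ_mem ?_ ?_ ?_ ?_ ?_ ?_).2
  · have := hv.continuous
    exact Eventually.of_forall fun s => (by fun_prop : Continuous _).aestronglyMeasurable
  · exact integrable_mul_of_continuous_hasCompactSupport hv.continuous hc hΦi x₀ s
  · exact (by fun_prop : Continuous _).aestronglyMeasurable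
  · refine Eventually.of_forall fun y s _ => ?_
    rw [norm_mul, Real.norm_of_nonneg (Real.exp_pos _).le, ← mul_assoc]
    gcongr
    exact (ContinuousLinearMap.le_opNorm _ _).trans (by gcongr; exact hC _)
  · exact integrable_norm_mul_exp.const_mul C
  · refine Eventually.of_forall fun y s _ => ?_
    have h1 : HasDerivAt (fun s : ℝ => x₀ + s • y) y s := by
      simpa using ((hasDerivAt_id s).smul_const y).const_add x₀
    exact (((hv.differentiable (by norm_num)) _).hasFDerivAt.comp_hasDerivAt s h1).mul_const _

/-- A `C²` compactly supported function with Laplacian bounded below has Gaussian means that are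
controlled from below by its value at the centre. -/
theorem le_integral_mul_gaussian {N : ℕ} {v : Euc N → ℝ} (hv : ContDiff ℝ 2 v)
    (hc : HasCompactSupport v) {B : ℝ} (hB : ∀ x, -B ≤ lap v x) (x₀ : Euc N) {r : ℝ}
    (hr : 0 ≤ r) :
    (v x₀ - B * r ^ 2 / 2) * ∫ y : Euc N, Real.exp (-(1 / 2) * ‖y‖ ^ 2)
      ≤ ∫ y, v (x₀ + r • y) * Real.exp (-(1 / 2) * ‖y‖ ^ 2) := by
  have hΦi : Integrable (fun y : Euc N => Real.exp (-(1 / 2) * ‖y‖ ^ 2)) :=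
    integrable_exp_neg_mul_sq_norm (by norm_num)
  set I := ∫ y : Euc N, Real.exp (-(1 / 2) * ‖y‖ ^ 2) with hI
  have hlap : Continuous (lap v) := by
    unfold lap
    refine continuous_finsetSum _ fun i _ => ?_
    exact ((((hv.fderiv_right (m := 1) (by norm_num)).clm_apply
      contDiff_const).continuous_fderiv (by norm_num))).clm_apply continuous_const
  have hlapc : HasCompactSupport (lap v) := by
    refine HasCompactSupport.intro hc (fun x hx => ?_)
    refine Finset.sum_eq_zero fun i _ => ?_
    have h1 : tsupport (fun x => fderiv ℝ (fun y => fderiv ℝ v y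
        (EuclideanSpace.single i 1)) x (EuclideanSpace.single i 1)) ⊆ tsupport v :=
      (tsupport_fderiv_apply_subset ℝ _).trans (tsupport_fderiv_apply_subset ℝ _)
    exact image_eq_zero_of_notMem_tsupport (f := fun x => fderiv ℝ (fun y => fderiv ℝ v y
        (EuclideanSpace.single i 1)) x (EuclideanSpace.single i 1)) fun h => hx (h1 h)
  let G : ℝ → ℝ := fun s => (∫ y, v (x₀ + s • y) * Real.exp (-(1 / 2) * ‖y‖ ^ 2))
    + B * I * s ^ 2 / 2
  have hG : ∀ s, HasDerivAt G
      (s * (∫ y, lap v (x₀ + s • y) * Real.exp (-(1 / 2) * ‖y‖ ^ 2)) + B * I * s) s := fun s => by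
    refine (hasDerivAt_integral_mul_gaussian hv hc x₀ s).add ?_
    convert! ((hasDerivAt_pow 2 s).const_mul (B * I)).div_const 2 using 1
    simp; ring
  have hmono : MonotoneOn G (Ici 0) := by
    refine monotoneOn_of_deriv_nonneg (convex_Ici 0)
      (fun s _ => (hG s).continuousAt.continuousWithinAt)
      (fun s _ => (hG s).differentiableAt.differentiableWithinAt) fun s hs => ?_
    rw [interior_Ici] at hs
    rw [(hG s).deriv]
    have h2 : -B * I ≤ ∫ y, lap v (x₀ + s • y) * Real.exp (-(1 / 2) * ‖y‖ ^ 2) := by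
      rw [hI, ← integral_const_mul]
      refine integral_mono (hΦi.const_mul _)
        (integrable_mul_of_continuous_hasCompactSupport hlap hlapc hΦi x₀ s) fun y => ?_
      exact mul_le_mul_of_nonneg_right (hB _) (Real.exp_pos _).le
    nlinarith [mem_Ioi.1 hs]
  have h0 := hmono (mem_Ici.2 le_rfl) (mem_Ici.2 hr) hr
  simp only [G, zero_smul, add_zero, integral_const_mul, ← hI] at h0
  linarith

theorem le_integral_sq_of_lap_ge {N : ℕ} {v : Euc N → ℝ} (hv : ContDiff ℝ 2 v)
    (hc : HasCompactSupport v) {B : ℝ} (hB : ∀ x, -B ≤ lap v x) (x₀ : Euc N) {r : ℝ}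
    (hr : 0 < r) (hpos : 0 < v x₀) (hrB : B * r ^ 2 ≤ v x₀) :
    r ^ N * (∫ y : Euc N, Real.exp (-(1 / 2) * ‖y‖ ^ 2)) * v x₀ ^ 2 / 4 ≤ ∫ x, v x ^ 2 := by
  have hΦi : Integrable (fun y : Euc N => Real.exp (-(1 / 2) * ‖y‖ ^ 2)) :=
    integrable_exp_neg_mul_sq_norm (by norm_num)
  have h1 := le_integral_mul_gaussian hv hc hB x₀ hr.le
  set I := ∫ y : Euc N, Real.exp (-(1 / 2) * ‖y‖ ^ 2) with hI
  have hI0 : 0 ≤ I := integral_nonneg fun y => (Real.exp_pos _).le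
  set V := v x₀
  have hv2 : Continuous fun x => v x ^ 2 := hv.continuous.pow 2
  have hv2c : HasCompactSupport fun x => v x ^ 2 :=
    hc.comp_left (g := fun t : ℝ => t ^ 2) (by simp)
  have hint : Integrable fun y => v (x₀ + r • y) ^ 2 := by
    have h := hv2.integrable_of_hasCompactSupport (μ := volume) hv2c
    exact (h.comp_add_left x₀).comp_smul hr.ne'
  have h2 : ∫ y, v (x₀ + r • y) * Real.exp (-(1 / 2) * ‖y‖ ^ 2)
      ≤ ∫ y, ((1 / V) * v (x₀ + r • y) ^ 2 + V / 4 * Real.exp (-(1 / 2) * ‖y‖ ^ 2)) := by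
    refine integral_mono
      (integrable_mul_of_continuous_hasCompactSupport hv.continuous hc hΦi x₀ r)
      ((hint.const_mul _).add (hΦi.const_mul _)) fun y => ?_
    have ha : Real.exp (-(1 / 2) * ‖y‖ ^ 2) ≤ 1 := Real.exp_le_one_iff.2 (by nlinarith [sq_nonneg ‖y‖])
    have hb := (Real.exp_pos (-(1 / 2) * ‖y‖ ^ 2)).le
    set t := v (x₀ + r • y)
    set E := Real.exp (-(1 / 2) * ‖y‖ ^ 2)
    have key : (t - V / 2) ^ 2 / V * E + (1 - E) * (t ^ 2 / V) ≥ 0 := by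
      have : 0 ≤ 1 - E := by linarith
      positivity
    have : (t - V / 2) ^ 2 / V * E + (1 - E) * (t ^ 2 / V) = 1 / V * t ^ 2 + V / 4 * E - t * E := by
      field_simp; ring
    show t * E ≤ 1 / V * t ^ 2 + V / 4 * E
    linarith
  rw [integral_add (hint.const_mul _) (hΦi.const_mul _), integral_const_mul, integral_const_mul,
    ← hI] at h2
  have h3 : ∫ y, v (x₀ + r • y) ^ 2 = (r ^ N)⁻¹ * ∫ x, v x ^ 2 := by
    rw [Measure.integral_comp_smul volume (fun y => v (x₀ + y) ^ 2) r,
      integral_add_left_eq_self (fun y => v y ^ 2) x₀, finrank_euclideanSpace_fin,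
      abs_of_pos (by positivity), smul_eq_mul]
  rw [h3] at h2
  have h4 : V / 2 * I ≤ (V - B * r ^ 2 / 2) * I := by gcongr; linarith
  have h5 : V / 4 * I ≤ 1 / V * ((r ^ N)⁻¹ * ∫ x, v x ^ 2) := by linarith
  have hrN : 0 < r ^ N := by positivity
  have h6 : V / 4 * I * (V * r ^ N) ≤ 1 / V * ((r ^ N)⁻¹ * ∫ x, v x ^ 2) * (V * r ^ N) := by gcongr
  have h7 : 1 / V * ((r ^ N)⁻¹ * ∫ x, v x ^ 2) * (V * r ^ N) = ∫ x, v x ^ 2 := by field_simp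
  rw [h7] at h6
  linarith

theorem hasDerivAt_max_zero_pow (n : ℕ) (s : ℝ) :
    HasDerivAt (fun s : ℝ => max s 0 ^ (n + 2)) ((n + 2) * max s 0 ^ (n + 1)) s := by
  have hne : ∀ s : ℝ, s ≠ 0 →
      HasDerivAt (fun s : ℝ => max s 0 ^ (n + 2)) ((n + 2) * max s 0 ^ (n + 1)) s := by
    intro s hs
    rcases lt_or_gt_of_ne hs with h | h
    · have : (fun s : ℝ => max s 0 ^ (n + 2)) =ᶠ[𝓝 s] fun _ => 0 := by
        filter_upwards [Iio_mem_nhds h] with t ht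
        simp [max_eq_right (le_of_lt (mem_Iio.1 ht))]
      rw [max_eq_right h.le]
      simpa using (hasDerivAt_const s (0 : ℝ)).congr_of_eventuallyEq this
    · have : (fun s : ℝ => max s 0 ^ (n + 2)) =ᶠ[𝓝 s] fun s => s ^ (n + 2) := by
        filter_upwards [Ioi_mem_nhds h] with t ht
        simp [max_eq_left (le_of_lt (mem_Ioi.1 ht))]
      rw [max_eq_left h.le]
      simpa using (hasDerivAt_pow (n + 2) s).congr_of_eventuallyEq this
  by_cases hs : s = 0
  · subst hs
    exact hasDerivAt_of_hasDerivAt_of_ne (fun y hy => hne y hy)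
      (by fun_prop : Continuous _).continuousAt
      (by fun_prop : Continuous fun s : ℝ => ((n : ℝ) + 2) * max s 0 ^ (n + 1)).continuousAt
  · exact hne s hs

theorem contDiff_max_zero_pow_three : ContDiff ℝ 2 (fun s : ℝ => max s 0 ^ 3) := by
  have h1 : deriv (fun s : ℝ => max s 0 ^ 3) = fun s => 3 * max s 0 ^ 2 := by
    ext s
    rw [(hasDerivAt_max_zero_pow 1 s).deriv]
    norm_num
  have h2 : deriv (fun s : ℝ => 3 * max s 0 ^ 2) = fun s => 3 * (2 * max s 0) := by
    ext s
    rw [((hasDerivAt_max_zero_pow 0 s).const_mul 3).deriv]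
    norm_num
  rw [show (2 : WithTop ℕ∞) = 1 + 1 by norm_num, contDiff_succ_iff_deriv]
  refine ⟨fun s => (hasDerivAt_max_zero_pow 1 s).differentiableAt, by simp, ?_⟩
  rw [h1, contDiff_one_iff_deriv, h2]
  exact ⟨fun s => ((hasDerivAt_max_zero_pow 0 s).const_mul 3).differentiableAt, by fun_prop⟩

theorem lap_congr {N : ℕ} {u v : Euc N → ℝ} {x : Euc N} (h : u =ᶠ[𝓝 x] v) :
    lap u x = lap v x := by
  refine Finset.sum_congr rfl fun i _ => ?_
  have : (fun y => fderiv ℝ u y (EuclideanSpace.single i 1)) =ᶠ[𝓝 x]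
      fun y => fderiv ℝ v y (EuclideanSpace.single i 1) :=
    (h.fderiv (𝕜 := ℝ)).mono fun y hy => by simp only [hy]
  rw [this.fderiv_eq]

theorem lap_comp {N : ℕ} {u : Euc N → ℝ} {x : Euc N} (hu : ContDiffAt ℝ 2 u x)
    {φ φ₁ φ₂ : ℝ → ℝ} (h₁ : ∀ s, HasDerivAt φ (φ₁ s) s) (h₂ : ∀ s, HasDerivAt φ₁ (φ₂ s) s) :
    lap (fun y => φ (u y)) x = φ₁ (u x) * lap u x +
      φ₂ (u x) * ∑ i, (fderiv ℝ u x (EuclideanSpace.single i 1)) ^ 2 := by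
  have hev : ∀ᶠ y in 𝓝 x, DifferentiableAt ℝ u y :=
    (hu.eventually (by simp)).mono fun y hy => hy.differentiableAt (by norm_num)
  have hdd : DifferentiableAt ℝ (fderiv ℝ u) x :=
    (hu.fderiv_right (m := 1) (by norm_num)).differentiableAt (by norm_num)
  unfold lap
  rw [Finset.mul_sum, Finset.mul_sum, ← Finset.sum_add_distrib]
  refine Finset.sum_congr rfl fun i _ => ?_
  have h : (fun y => fderiv ℝ (fun y => φ (u y)) y (EuclideanSpace.single i 1)) =ᶠ[𝓝 x]
      fun y => φ₁ (u y) * fderiv ℝ u y (EuclideanSpace.single i 1) := by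
    filter_upwards [hev] with y hy
    have := ((h₁ (u y)).comp_hasFDerivAt y hy.hasFDerivAt).fderiv
    simp only [Function.comp_def] at this
    rw [this]; simp
  rw [h.fderiv_eq]
  have ha : HasFDerivAt (fun y => φ₁ (u y)) (φ₂ (u x) • fderiv ℝ u x) x :=
    (h₂ (u x)).comp_hasFDerivAt x hev.self_of_nhds.hasFDerivAt
  have hb : DifferentiableAt ℝ (fun y => fderiv ℝ u y (EuclideanSpace.single i 1)) x :=
    hdd.clm_apply (differentiableAt_const _)
  rw [(ha.fun_mul hb.hasFDerivAt).fderiv]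
  simp
  ring

theorem lap_nonpos_of_isLocalMax {N : ℕ} {u : Euc N → ℝ} {x : Euc N} (hu : ContDiffAt ℝ 2 u x)
    (hmax : IsLocalMax u x) : lap u x ≤ 0 := by
  have hev : ∀ᶠ y in 𝓝 x, DifferentiableAt ℝ u y :=
    (hu.eventually (by simp)).mono fun y hy => hy.differentiableAt (by norm_num)
  have hdd : DifferentiableAt ℝ (fderiv ℝ u) x :=
    (hu.fderiv_right (m := 1) (by norm_num)).differentiableAt (by norm_num)
  refine Finset.sum_nonpos fun i _ => ?_
  set e : Euc N := EuclideanSpace.single i 1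
  have hline : ∀ t : ℝ, HasDerivAt (fun t : ℝ => x + t • e) e t := fun t => by
    simpa using ((hasDerivAt_id t).smul_const e).const_add x
  have hx : x + (0 : ℝ) • e = x := by simp
  have htend : Tendsto (fun t : ℝ => x + t • e) (𝓝 0) (𝓝 x) := by
    have := (hline 0).continuousAt.tendsto
    rwa [hx] at this
  set γ : ℝ → ℝ := fun t => u (x + t • e) with hγ
  have hd : deriv γ =ᶠ[𝓝 0] fun t => fderiv ℝ u (x + t • e) e := by
    filter_upwards [htend.eventually hev] with t ht
    exact (ht.hasFDerivAt.comp_hasDerivAt t (hline t)).deriv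
  have hb : DifferentiableAt ℝ (fun y => fderiv ℝ u y e) x :=
    hdd.clm_apply (differentiableAt_const _)
  have hd2 : deriv (deriv γ) 0 = fderiv ℝ (fun y => fderiv ℝ u y e) x e := by
    rw [hd.deriv_eq]
    have hb' : HasFDerivAt (fun y => fderiv ℝ u y e) (fderiv ℝ (fun y => fderiv ℝ u y e) x)
        (x + (0 : ℝ) • e) := by rw [hx]; exact hb.hasFDerivAt
    exact (hb'.comp_hasDerivAt 0 (hline 0)).deriv
  have hmaxγ : IsLocalMax γ 0 := by
    have := htend.eventually hmax
    simpa [IsLocalMax, IsMaxFilter, hγ] using this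
  have hcont : ContinuousAt γ 0 :=
    ContinuousAt.comp (g := u) (by rw [hx]; exact hu.continuousAt) (hline 0).continuousAt
  rw [← hd2]
  by_contra! hpos
  have hmin := isLocalMin_of_deriv_deriv_pos hpos hmaxγ.deriv_eq_zero hcont
  have hconst : γ =ᶠ[𝓝 0] fun _ => γ 0 := by
    filter_upwards [hmin, hmaxγ] with t h1 h2 using le_antisymm h2 h1
  have : deriv γ =ᶠ[𝓝 0] fun _ => 0 := hconst.deriv.trans (by simp)
  rw [this.deriv_eq] at hpos
  simp at hpos

theorem indicator_eventuallyEq_of_isOpen {X : Type*} [TopologicalSpace X] {Ω : Set X}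
    (hΩ : IsOpen Ω) (w : X → ℝ) {x : X} (hx : x ∈ Ω) : Ω.indicator w =ᶠ[𝓝 x] w := by
  filter_upwards [hΩ.mem_nhds hx] with y hy
  simp [hy]

/-- The truncation `(u - c)₊ ^ 3` of a function vanishing on the boundary of a bounded open set,
extended by zero, is of class `C²` with compact support. -/
theorem contDiff_truncation {N : ℕ} {Ω : Set (Euc N)} (hΩ : IsOpen Ω)
    (hb : Bornology.IsBounded Ω) {u : Euc N → ℝ} (hu : ContDiffOn ℝ 2 u Ω)
    (huc : ContinuousOn u (closure Ω)) (hfr : ∀ x ∈ frontier Ω, u x = 0) {c : ℝ} (hc : 0 < c) :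
    ∃ K ⊆ Ω, (∀ x, x ∉ K → Ω.indicator (fun x => max (u x - c) 0 ^ 3) =ᶠ[𝓝 x] fun _ => 0) ∧
      ContDiff ℝ 2 (Ω.indicator fun x => max (u x - c) 0 ^ 3) ∧
      HasCompactSupport (Ω.indicator fun x => max (u x - c) 0 ^ 3) := by
  set v : Euc N → ℝ := Ω.indicator fun x => max (u x - c) 0 ^ 3 with hv
  set K : Set (Euc N) := closure Ω ∩ u ⁻¹' Ici c
  have hKc : IsClosed K := huc.preimage_isClosed_of_isClosed isClosed_closure isClosed_Ici
  have hK : IsCompact K :=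
    Metric.isCompact_of_isClosed_isBounded hKc (hb.closure.subset inter_subset_left)
  have hKΩ : K ⊆ Ω := fun x hx => by
    by_contra hxΩ
    have hxf : x ∈ frontier Ω := ⟨hx.1, by rwa [hΩ.interior_eq]⟩
    have : c ≤ u x := hx.2
    rw [hfr x hxf] at this
    linarith
  have hvK : ∀ x, x ∉ K → v x = 0 := fun x hx => by
    by_cases hxΩ : x ∈ Ω
    · have : u x < c := by
        by_contra! h
        exact hx ⟨subset_closure hxΩ, h⟩
      simp [hv, hxΩ, max_eq_right (by linarith : u x - c ≤ 0)]
    · simp [hv, hxΩ]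
  have hvK0 : ∀ x, x ∉ K → v =ᶠ[𝓝 x] fun _ => 0 := fun x hx => by
    filter_upwards [hKc.isOpen_compl.mem_nhds hx] with y hy using hvK y hy
  have huat : ∀ x ∈ Ω, ContDiffAt ℝ 2 u x := fun x hx => hu.contDiffAt (hΩ.mem_nhds hx)
  refine ⟨K, hKΩ, hvK0, contDiff_iff_contDiffAt.2 fun x => by
    by_cases hx : x ∈ K
    · refine ContDiffAt.congr_of_eventuallyEq ?_ (indicator_eventuallyEq_of_isOpen hΩ _ (hKΩ hx))
      exact contDiff_max_zero_pow_three.contDiffAt.comp x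
        ((huat x (hKΩ hx)).sub contDiffAt_const)
    · exact contDiffAt_const.congr_of_eventuallyEq (hvK0 x hx), HasCompactSupport.intro hK hvK⟩

/-- A lower bound on the mass of a nonnegative function vanishing on the boundary of a bounded
open set, in terms of its maximum and a lower bound for its Laplacian. -/
theorem le_setIntegral_sq_of_lap_ge {N : ℕ} {Ω : Set (Euc N)} (hΩ : IsOpen Ω)
    (hb : Bornology.IsBounded Ω) {u : Euc N → ℝ} (hu : ContDiffOn ℝ 2 u Ω)
    (huc : ContinuousOn u (closure Ω)) (hu0 : ∀ x ∈ Ω, 0 ≤ u x) (hfr : ∀ x ∈ frontier Ω, u x = 0)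
    {x₀ : Euc N} (hx₀ : x₀ ∈ Ω) (hM : 0 < u x₀) (hmax : ∀ x ∈ Ω, u x ≤ u x₀)
    {A : ℝ} (hA0 : 0 ≤ A) (hA : ∀ x ∈ Ω, -A ≤ lap u x) {r : ℝ} (hr : 0 < r)
    (hAr : 6 * A * r ^ 2 ≤ u x₀) :
    r ^ N * (∫ y : Euc N, Real.exp (-(1 / 2) * ‖y‖ ^ 2)) * u x₀ ^ 2 / 16
      ≤ ∫ x in Ω, u x ^ 2 := by
  set M := u x₀
  obtain ⟨K, hKΩ, hvK0, hvC, hvc⟩ := contDiff_truncation hΩ hb hu huc hfr (half_pos hM)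
  set v : Euc N → ℝ := Ω.indicator fun x => max (u x - M / 2) 0 ^ 3 with hv
  have hvΩ : ∀ x ∈ Ω, v =ᶠ[𝓝 x] fun x => max (u x - M / 2) 0 ^ 3 :=
    fun x hx => indicator_eventuallyEq_of_isOpen hΩ _ hx
  have huat : ∀ x ∈ Ω, ContDiffAt ℝ 2 u x := fun x hx => hu.contDiffAt (hΩ.mem_nhds hx)
  have hB0 : 0 ≤ 3 * (M / 2) ^ 2 * A := by positivity
  have hlap : ∀ x, -(3 * (M / 2) ^ 2 * A) ≤ lap v x := fun x => by
    by_cases hx : x ∈ K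
    · have hxΩ := hKΩ hx
      rw [lap_congr (hvΩ x hxΩ), lap_comp (φ := fun s => max (s - M / 2) 0 ^ 3)
        (φ₁ := fun s => 3 * max (s - M / 2) 0 ^ 2) (φ₂ := fun s => 3 * (2 * max (s - M / 2) 0))
        (huat x hxΩ) ?_ ?_]
      · have h1 : 0 ≤ 3 * (2 * max (u x - M / 2) 0) *
            ∑ i, (fderiv ℝ u x (EuclideanSpace.single i 1)) ^ 2 :=
          mul_nonneg (by positivity) (Finset.sum_nonneg fun i _ => sq_nonneg _)
        have h2 : max (u x - M / 2) 0 ^ 2 ≤ (M / 2) ^ 2 := by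
          gcongr
          exact max_le (by linarith [hmax x hxΩ]) (by linarith)
        have h3 : 3 * max (u x - M / 2) 0 ^ 2 * (-A) ≤ 3 * max (u x - M / 2) 0 ^ 2 * lap u x :=
          mul_le_mul_of_nonneg_left (hA x hxΩ) (by positivity)
        have h4 : max (u x - M / 2) 0 ^ 2 * A ≤ (M / 2) ^ 2 * A := by gcongr
        linarith
      · intro s
        have := (hasDerivAt_max_zero_pow 1 (s - M / 2)).comp_sub_const s (M / 2)
        norm_num at this
        exact this
      · intro s
        have := ((hasDerivAt_max_zero_pow 0 (s - M / 2)).comp_sub_const s (M / 2)).const_mul 3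
        norm_num at this
        exact this
    · have h1 : lap v x = 0 := by
        rw [lap_congr (hvK0 x hx)]
        simp [lap]
      linarith
  have hvx : v x₀ = (M / 2) ^ 3 := by
    simp only [hv, indicator_of_mem hx₀]
    rw [max_eq_left (by simp only [M]; linarith)]
    ring
  have key := le_integral_sq_of_lap_ge hvC hvc hlap x₀ hr (by rw [hvx]; positivity)
    (by rw [hvx]; nlinarith [mul_le_mul_of_nonneg_left hAr (sq_nonneg (M / 2))])
  rw [hvx] at key
  have hv2 : Integrable fun x => v x ^ 2 := by
    have h : Continuous fun x => v x ^ 2 := hvC.continuous.pow 2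
    have hc : HasCompactSupport fun x => v x ^ 2 :=
      hvc.comp_left (g := fun t : ℝ => t ^ 2) (by simp)
    exact h.integrable_of_hasCompactSupport hc
  have hcmp : ∫ x, v x ^ 2 ≤ (M / 2) ^ 4 * ∫ x in Ω, u x ^ 2 := by
    have hint : IntegrableOn (fun x => u x ^ 2) Ω :=
      ((huc.pow 2).integrableOn_compact hb.isCompact_closure).mono_set subset_closure
    rw [← integral_const_mul, ← integral_indicator hΩ.measurableSet]
    refine integral_mono hv2
      ((integrable_indicator_iff hΩ.measurableSet).2 (hint.const_mul _)) fun x => ?_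
    by_cases hx : x ∈ Ω
    · simp only [hv, indicator_of_mem hx]
      have h0 : 0 ≤ max (u x - M / 2) 0 := le_max_right _ _
      have h1 : max (u x - M / 2) 0 ≤ M / 2 := max_le (by linarith [hmax x hx]) (by linarith)
      have h2 : max (u x - M / 2) 0 ≤ u x := max_le (by linarith) (hu0 x hx)
      calc (max (u x - M / 2) 0 ^ 3) ^ 2
          = max (u x - M / 2) 0 ^ 4 * max (u x - M / 2) 0 ^ 2 := by ring
        _ ≤ (M / 2) ^ 4 * u x ^ 2 :=
          mul_le_mul (pow_le_pow_left₀ h0 h1 4) (pow_le_pow_left₀ h0 h2 2) (by positivity)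
            (by positivity)
    · simp [hv, hx]
  have hM4 : 0 < (M / 2) ^ 4 := by positivity
  refine le_of_mul_le_mul_left (le_trans (le_of_eq ?_) (key.trans hcmp)) hM4
  ring

theorem sub_single_mem_and_le {N : ℕ} {Ω : Set (Euc N)} {f : Euc N → ℝ → ℝ} {d : Euc N → ℝ}
    {g : Euc N → ℝ → ℝ} {p : ℝ} {u : ℝ → Euc N → ℝ} (H : Standing N Ω f d g p u) {y : Euc N}
    (hy : y ∈ Ω) (i : Fin N) :
    y - EuclideanSpace.single i (y i) ∈ Ω ∧ ∀ t, f y t ≤ f (y - EuclideanSpace.single i (y i)) t := by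
  obtain ⟨ℓ, -, β, -, -, -, hsymm⟩ := H.symm
  let e : Euc N ≃ₗᵢ[ℝ] Euc N := LinearIsometryEquiv.piLpCongrRight 2
    (fun j : Fin N => if j = i then LinearIsometryEquiv.neg ℝ else LinearIsometryEquiv.refl ℝ ℝ)
  have he : ∀ x j, e x j = if j = i then - x j else x j := fun x j => by
    simp only [e, LinearIsometryEquiv.piLpCongrRight_apply]
    split_ifs <;> simp
  have hmem : e y ∈ Ω := by
    rw [← (hsymm e fun j x hx k hk => by rw [he, hx k hk]; simp).1]
    exact mem_image_of_mem e hy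
  have h0 : y - EuclideanSpace.single i (y i) ∈ Ω := by
    refine H.conv i y hy (e y) hmem (fun j hj => by rw [he, if_neg hj]) ?_
    refine ⟨1 / 2, 1 / 2, by norm_num, by norm_num, by norm_num, ?_⟩
    ext j
    by_cases hj : j = i
    · subst hj; simp [he]
    · simp [he, hj]; ring
  refine ⟨h0, (H.mono i _ h0 y hy (fun j hj => ?_) ?_).1⟩
  · simp [hj]
  · simp

theorem zero_mem_and_le {N : ℕ} {Ω : Set (Euc N)} {f : Euc N → ℝ → ℝ} {d : Euc N → ℝ}
    {g : Euc N → ℝ → ℝ} {p : ℝ} {u : ℝ → Euc N → ℝ} (H : Standing N Ω f d g p u) {x : Euc N}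
    (hx : x ∈ Ω) : (0 : Euc N) ∈ Ω ∧ ∀ t, f x t ≤ f 0 t := by
  have : ∀ S : Finset (Fin N), ∃ z ∈ Ω, (∀ i ∈ S, z i = 0) ∧ ∀ t, f x t ≤ f z t := by
    intro S
    induction S using Finset.induction_on with
    | empty => exact ⟨x, hx, by simp, fun t => le_rfl⟩
    | insert i S _ ih =>
      obtain ⟨z, hz, hz0, hzf⟩ := ih
      obtain ⟨h1, h2⟩ := sub_single_mem_and_le H hz i
      refine ⟨_, h1, fun j hj => ?_, fun t => (hzf t).trans (h2 t)⟩
      by_cases hji : j = i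
      · subst hji; simp
      · simp [hji, hz0 j ((Finset.mem_insert.1 hj).resolve_left hji)]
  obtain ⟨z, hz, hz0, hzf⟩ := this Finset.univ
  obtain rfl : z = 0 := by ext i; simp [hz0 i]
  exact ⟨hz, hzf⟩

section GrowthAtZero

variable {p : ℝ} {F G : ℝ → ℝ}

theorem exists_le_mul_of_split (hp : 2 < p) (hF : Continuous F)
    (hsplit : ∀ t, F t = |t| ^ (p - 2) * t + G t)
    (hG : Tendsto (fun t : ℝ => G t / t) (𝓝[≠] (0 : ℝ)) (𝓝 0)) (T : ℝ) :
    ∃ L, 0 ≤ L ∧ ∀ t, 0 < t → t ≤ T → F t ≤ L * t := by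
  have hev : ∀ᶠ t in 𝓝[≠] (0 : ℝ), G t / t < 1 := hG.eventually (gt_mem_nhds one_pos)
  rw [eventually_nhdsWithin_iff] at hev
  obtain ⟨ε, hε, hball⟩ := Metric.eventually_nhds_iff.1 hev
  obtain ⟨C, hC⟩ := isCompact_Icc.exists_bound_of_continuousOn (s := Icc 0 T) hF.continuousOn
  set δ := min (ε / 2) 1
  have hδ : 0 < δ := by positivity
  refine ⟨max 2 (C / δ), by positivity, fun t ht htT => ?_⟩
  rcases le_or_gt t δ with h | h
  · have h1 : G t / t < 1 := hball (by
      rw [Real.dist_eq, sub_zero, abs_of_pos ht]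
      linarith [min_le_left (ε / 2) 1]) ht.ne'
    rw [div_lt_one ht] at h1
    have h2 : |t| ^ (p - 2) ≤ 1 := Real.rpow_le_one (abs_nonneg _)
      (by rw [abs_of_pos ht]; exact h.trans (min_le_right _ _)) (by linarith)
    have h3 : |t| ^ (p - 2) * t ≤ 1 * t := by gcongr
    calc F t ≤ 2 * t := by rw [hsplit]; linarith
      _ ≤ _ := by gcongr; exact le_max_left _ _
  · have h1 := (le_abs_self _).trans (hC t ⟨ht.le, htT⟩)
    have hC0 : 0 ≤ C := (abs_nonneg _).trans (hC t ⟨ht.le, htT⟩)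
    calc F t ≤ C / δ * δ := by rwa [div_mul_cancel₀ _ hδ.ne']
      _ ≤ C / δ * t := by gcongr
      _ ≤ _ := by gcongr; exact le_max_right _ _

theorem exists_forall_le_two_mul_rpow (hp : 2 < p) (hF : Continuous F)
    (hsplit : ∀ t, F t = |t| ^ (p - 2) * t + G t)
    (hG : Tendsto (fun t : ℝ => G t / t) (𝓝[≠] (0 : ℝ)) (𝓝 0))
    (hG' : Tendsto (fun t : ℝ => G t / t ^ (p - 1)) atTop (𝓝 0)) :
    ∃ T, 1 ≤ T ∧ ∀ M, T ≤ M → ∀ t, 0 < t → t ≤ M → F t ≤ 2 * M ^ (p - 1) := by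
  obtain ⟨T₁, hT₁⟩ := eventually_atTop.1 (hG'.eventually (gt_mem_nhds one_pos))
  obtain ⟨L, hL0, hL⟩ := exists_le_mul_of_split hp hF hsplit hG T₁
  refine ⟨max 1 (L * T₁), le_max_left _ _, fun M hM t ht htM => ?_⟩
  have hM1 : 1 ≤ M := (le_max_left _ _).trans hM
  rcases le_or_gt t T₁ with h | h
  · have h1 : M ≤ M ^ (p - 1) := Real.self_le_rpow_of_one_le hM1 (by linarith)
    have h2 : L * t ≤ L * T₁ := by gcongr
    have h3 : L * T₁ ≤ M := (le_max_right _ _).trans hM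
    linarith [hL t ht h]
  · have h1 := hT₁ t h.le
    rw [div_lt_one (by positivity)] at h1
    have h2 : |t| ^ (p - 2) * t = t ^ (p - 1) := by
      rw [abs_of_pos ht, ← Real.rpow_add_one ht.ne']
      ring_nf
    have h3 : t ^ (p - 1) ≤ M ^ (p - 1) := Real.rpow_le_rpow ht.le htM (by linarith)
    rw [hsplit, h2]
    linarith

end GrowthAtZero

/-- in the mass-subcritical case `2 < p < 2 + 4/N`,
`∫_Ω u_λ² → +∞` as `λ → +∞`. -/
theorem statement5 {N : ℕ} {Ω : Set (Euc N)} {f : Euc N → ℝ → ℝ} {d : Euc N → ℝ}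
    {g : Euc N → ℝ → ℝ} {p : ℝ} {u : ℝ → Euc N → ℝ}
    (H : Standing N Ω f d g p u) (hp : p < 2 + 4 / (N : ℝ)) :
    Tendsto (fun lam : ℝ => ∫ x in Ω, (u lam x) ^ 2) atTop atTop := by
  obtain ⟨z, hz⟩ := H.conn.nonempty
  have h0Ω : (0 : Euc N) ∈ Ω := (zero_mem_and_le H hz).1
  have hp2 := H.hp.1
  have hN : (0 : ℝ) < N := by
    have := H.dim
    exact_mod_cast (by omega : 0 < N)
  have hF : Continuous (f 0) := by
    rw [← continuousOn_univ]
    exact H.f_c1.continuousOn.comp (f := fun t : ℝ => ((0 : Euc N), t)) (by fun_prop)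
      fun t _ => ⟨h0Ω, mem_univ _⟩
  have hsplit : ∀ t, f 0 t = |t| ^ (p - 2) * t + g 0 t := fun t => by
    rw [H.f_split, H.d_zero, one_mul]
  obtain ⟨T₀, hT₀, hgrowth⟩ := exists_forall_le_two_mul_rpow hp2 hF hsplit (H.g_zero 0 h0Ω)
    (H.g_top 0 h0Ω)
  set I : ℝ := ∫ y : Euc N, Real.exp (-(1 / 2) * ‖y‖ ^ 2) with hI
  have hIpos : 0 < I := by
    rw [hI, GaussianFourier.integral_rexp_neg_mul_sq_norm (by norm_num)]
    positivity
  set q : ℝ := 2 + (2 - p) / 2 * N with hq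
  have hqpos : 0 < q := by
    have h1 : (p - 2) * N < 4 := by
      rw [← lt_div_iff₀ hN]; linarith
    rw [hq]; linarith
  set c : ℝ := I / (16 * 4 ^ N)
  have hc : 0 < c := by positivity
  rw [tendsto_atTop]
  intro b
  have hlim : Tendsto (fun M : ℝ => c * M ^ q) atTop atTop :=
    (tendsto_rpow_atTop hqpos).const_mul_atTop hc
  obtain ⟨T₁, hT₁⟩ := eventually_atTop.1 (hlim.eventually_ge_atTop b)
  obtain ⟨L, hL0, hL⟩ := exists_le_mul_of_split hp2 hF hsplit (H.g_zero 0 h0Ω) (max T₀ T₁)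
  filter_upwards [eventually_gt_atTop L, eventually_gt_atTop (-firstEig Ω)] with lam hlam hlam'
  obtain ⟨hu2, huc, hupos, hufr, heq⟩ := (H.sol lam hlam').1
  obtain ⟨x₀, hx₀c, hx₀max⟩ := H.bdd.isCompact_closure.exists_isMaxOn
    (⟨0, subset_closure h0Ω⟩ : (closure Ω).Nonempty) huc
  have hmax : ∀ x ∈ Ω, u lam x ≤ u lam x₀ := fun x hx => hx₀max (subset_closure hx)
  have hM : 0 < u lam x₀ := (hupos 0 h0Ω).trans_le (hmax 0 h0Ω)
  have hx₀ : x₀ ∈ Ω := by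
    by_contra h
    have hxf : x₀ ∈ frontier Ω := ⟨hx₀c, by rwa [H.isOpen.interior_eq]⟩
    rw [hufr x₀ hxf] at hM
    exact lt_irrefl _ hM
  have hloc : IsLocalMax (u lam) x₀ := by
    filter_upwards [H.isOpen.mem_nhds hx₀] with x hx using hmax x hx
  have hlap0 : lap (u lam) x₀ ≤ 0 :=
    lap_nonpos_of_isLocalMax (hu2.contDiffAt (H.isOpen.mem_nhds hx₀)) hloc
  set M := u lam x₀ with hMdef
  have hMlarge : max T₀ T₁ < M := by
    by_contra! h
    have h1 := heq x₀ hx₀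
    have h2 := (zero_mem_and_le H hx₀).2 M
    have h3 := hL M hM h
    have h4 : L * M < lam * M := by gcongr
    rw [← hMdef] at h1
    linarith
  have hlow : ∀ x ∈ Ω, -(2 * M ^ (p - 1)) ≤ lap (u lam) x := fun x hx => by
    have h1 := heq x hx
    have h2 := (zero_mem_and_le H hx).2 (u lam x)
    have h3 := hgrowth M ((le_max_left _ _).trans hMlarge.le) _ (hupos x hx) (hmax x hx)
    have h4 : 0 ≤ lam * u lam x := mul_nonneg (hL0.trans hlam.le) (hupos x hx).le
    linarith
  have hr2 : (M ^ ((2 - p) / 2) / 4) ^ 2 = M ^ (2 - p) / 16 := by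
    rw [div_pow, ← Real.rpow_mul_natCast hM.le]
    norm_num
  have hpow : M ^ (p - 1) * M ^ (2 - p) = M := by
    rw [← Real.rpow_add hM]
    ring_nf
    exact Real.rpow_one M
  have key := le_setIntegral_sq_of_lap_ge H.isOpen H.bdd hu2 huc (fun x hx => (hupos x hx).le) hufr
    hx₀ hM hmax (by positivity) hlow (r := M ^ ((2 - p) / 2) / 4) (by positivity)
    (by rw [hr2]; linarith)
  refine (hT₁ M ((le_max_right _ _).trans hMlarge.le)).trans (le_trans (le_of_eq ?_) key)
  rw [div_pow, ← Real.rpow_mul_natCast hM.le, hq, Real.rpow_add hM, Real.rpow_two]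
  simp only [c, ← hI, ← hMdef]
  field_simp
end
end

section
/- Assume (C1)–(C4) and 2 < p < 2 + 4/N. Then for every c ∈ (0, +∞) there exist λ > −λ₁(B_R) and a positive solution u of (P_λ) with ∫_{B_R} u² dx = c. -/
open MeasureTheory Set Filter Topology

noncomputable section

/-- The function `H(r; m)` from Yanagida's uniqueness theorem. -/
def Hfun (N : ℕ) (p : ℝ) (h : ℝ → ℝ) (r m : ℝ) : ℝ :=
  2 * r ^ (m + 2) * deriv h r / p -
    (2 * (N : ℝ) - 4 - m - 2 * (m + 2) / p) * r ^ (m + 1) * h r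

/-- The nonlinearity `h(|x|) t^{p-1}` of problem `(P_λ)` on the ball. -/
def fball (N : ℕ) (h : ℝ → ℝ) (p : ℝ) : Euc N → ℝ → ℝ :=
  fun x t => h ‖x‖ * t ^ (p - 1)

open scoped RealInnerProductSpace

/-- Bounded sequences in a separable Hilbert space have weakly convergent subsequences. -/
theorem exists_weak_subseq_limit {H : Type*} [NormedAddCommGroup H] [InnerProductSpace ℝ H]
    [CompleteSpace H] [TopologicalSpace.SeparableSpace H] {x : ℕ → H} {C : ℝ}
    (hx : ∀ n, ‖x n‖ ≤ C) :
    ∃ (w : H) (φ : ℕ → ℕ), StrictMono φ ∧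
      ∀ y, Tendsto (fun n => ⟪y, x (φ n)⟫) atTop (𝓝 ⟪y, w⟫) := by
  have hcpt := WeakDual.isSeqCompact_closedBall (𝕜 := ℝ) (E := H) 0 C
  let z : ℕ → WeakDual ℝ H := fun n =>
    StrongDual.toWeakDual (InnerProductSpace.toDual ℝ H (x n))
  have hz : ∀ n, z n ∈ WeakDual.toStrongDual ⁻¹' Metric.closedBall (0 : StrongDual ℝ H) C := by
    intro n
    simp only [z, mem_preimage, mem_closedBall_zero_iff]
    exact ((InnerProductSpace.toDual ℝ H).norm_map (x n)).trans_le (hx n)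
  obtain ⟨a, -, φ, hφ, ha⟩ := hcpt hz
  refine ⟨(InnerProductSpace.toDual ℝ H).symm (WeakDual.toStrongDual a), φ, hφ, fun y => ?_⟩
  have h1 := ((WeakDual.eval_continuous y).tendsto a).comp ha
  have h2 : ⟪y, (InnerProductSpace.toDual ℝ H).symm (WeakDual.toStrongDual a)⟫ = a y := by
    rw [real_inner_comm]
    exact InnerProductSpace.toDual_symm_apply
  rw [h2]
  refine h1.congr fun n => ?_
  rw [real_inner_comm]
  rfl

theorem abs_rpow_tangent_le {p : ℝ} (hp : 2 < p) (a b : ℝ) :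
    |a| ^ p + p * (|a| ^ (p - 2) * a) * (b - a) ≤ |b| ^ p := by
  have hconv : ConvexOn ℝ univ (fun x : ℝ => |x| ^ p) := by
    have h1 : ConvexOn ℝ univ (fun x : ℝ => ‖x‖) := convexOn_univ_norm
    have h2 := (convexOn_rpow (p := p) (by linarith))
    refine ⟨convex_univ, fun x _ y _ s t hs ht hst => ?_⟩
    have h3 := h1.2 (mem_univ x) (mem_univ y) hs ht hst
    have h4 := h2.2 (norm_nonneg x) (norm_nonneg y) hs ht hst
    simp only [Real.norm_eq_abs] at h3 h4
    exact (Real.rpow_le_rpow (abs_nonneg _) h3 (by linarith)).trans h4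
  have hd := hasDerivAt_abs_rpow a (p := p) (by linarith)
  rcases lt_trichotomy a b with hab | hab | hab
  · have h := hconv.le_slope_of_hasDerivAt (mem_univ a) (mem_univ b) hab hd
    rw [slope_def_field, le_div_iff₀ (by linarith)] at h
    nlinarith
  · subst hab; simp
  · have h := hconv.slope_le_of_hasDerivAt (mem_univ b) (mem_univ a) hab hd
    rw [slope_def_field, div_le_iff₀ (by linarith)] at h
    nlinarith

/-- The mass `∫ ⟪k x, w⟫² dμ`. -/
def massF {H X : Type*} [NormedAddCommGroup H] [InnerProductSpace ℝ H] [MeasurableSpace X]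
    (μ : Measure X) (k : X → H) (w : H) : ℝ := ∫ x, ⟪k x, w⟫ ^ 2 ∂μ

/-- The potential term `∫ g |⟪k x, w⟫|^p dμ`. -/
def potF {H X : Type*} [NormedAddCommGroup H] [InnerProductSpace ℝ H] [MeasurableSpace X]
    (μ : Measure X) (k : X → H) (g : X → ℝ) (p : ℝ) (w : H) : ℝ :=
  ∫ x, g x * |⟪k x, w⟫| ^ p ∂μ

/-- The energy `‖w‖² / 2 - potF w / p`. -/
def energyF {H X : Type*} [NormedAddCommGroup H] [InnerProductSpace ℝ H] [MeasurableSpace X]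
    (μ : Measure X) (k : X → H) (g : X → ℝ) (p : ℝ) (w : H) : ℝ :=
  ‖w‖ ^ 2 / 2 - potF μ k g p w / p

/-- The feature map `k` is dominated by `B ∈ L² ∩ L^p`, and the weight `g` is
nonnegative and bounded by `M`. -/
structure IsAdmissible {H X : Type*} [NormedAddCommGroup H] [InnerProductSpace ℝ H]
    [MeasurableSpace X] (μ : Measure X) (k : X → H) (g : X → ℝ) (p : ℝ) (B : X → ℝ) (M : ℝ) :
    Prop where
  two_lt : 2 < p
  meas_k : ∀ w, AEStronglyMeasurable (fun x => ⟪k x, w⟫) μ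
  le_B : ∀ᵐ x ∂μ, ‖k x‖ ≤ B x
  int_B2 : Integrable (fun x => B x ^ 2) μ
  int_Bp : Integrable (fun x => B x ^ p) μ
  meas_g : AEStronglyMeasurable g μ
  g_nonneg : ∀ᵐ x ∂μ, 0 ≤ g x
  g_le : ∀ᵐ x ∂μ, g x ≤ M
  M_nonneg : 0 ≤ M

namespace IsAdmissible

variable {H X : Type*} [NormedAddCommGroup H] [InnerProductSpace ℝ H]
  {k : X → H} {g : X → ℝ} {p : ℝ} {B : X → ℝ} {M : ℝ}

theorem abs_inner_le {x : X} (hx : ‖k x‖ ≤ B x) (w : H) : |⟪k x, w⟫| ≤ ‖w‖ * B x := by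
  have := abs_real_inner_le_norm (k x) w
  have h2 := mul_le_mul_of_nonneg_right hx (norm_nonneg w)
  linarith

theorem pot_le {x : X} (hp : 2 < p) (hx : ‖k x‖ ≤ B x) (h0 : 0 ≤ g x) (h1 : g x ≤ M) (hM : 0 ≤ M)
    {w : H} {L : ℝ} (hL : ‖w‖ ≤ L) :
    ‖g x * |⟪k x, w⟫| ^ p‖ ≤ M * L ^ p * B x ^ p := by
  have hB : 0 ≤ B x := (norm_nonneg _).trans hx
  have hL0 : 0 ≤ L := (norm_nonneg _).trans hL
  rw [Real.norm_of_nonneg (by positivity), mul_assoc, ← Real.mul_rpow hL0 hB]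
  gcongr
  exact (abs_inner_le hx w).trans (by gcongr)

theorem sq_le {x : X} (hx : ‖k x‖ ≤ B x) {w : H} {L : ℝ} (hL : ‖w‖ ≤ L) :
    ‖⟪k x, w⟫ ^ 2‖ ≤ L ^ 2 * B x ^ 2 := by
  have hB : 0 ≤ B x := (norm_nonneg _).trans hx
  rw [Real.norm_of_nonneg (by positivity), ← mul_pow, ← sq_abs]
  gcongr
  exact (abs_inner_le hx w).trans (by gcongr)

variable [MeasurableSpace X] {μ : Measure X}

theorem meas_pot (A : IsAdmissible μ k g p B M) (w : H) :
    AEStronglyMeasurable (fun x => g x * |⟪k x, w⟫| ^ p) μ := by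
  refine A.meas_g.mul ?_
  exact ((A.meas_k w).norm.aemeasurable.pow_const p).aestronglyMeasurable

theorem integrable_pot (A : IsAdmissible μ k g p B M) (w : H) :
    Integrable (fun x => g x * |⟪k x, w⟫| ^ p) μ := by
  refine (A.int_Bp.const_mul (M * ‖w‖ ^ p)).mono' (A.meas_pot w) ?_
  filter_upwards [A.le_B, A.g_nonneg, A.g_le] with x h1 h2 h3
  exact pot_le A.two_lt h1 h2 h3 A.M_nonneg le_rfl

theorem integrable_mul (A : IsAdmissible μ k g p B M) (w v : H) :
    Integrable (fun x => ⟪k x, w⟫ * ⟪k x, v⟫) μ := by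
  refine (A.int_B2.const_mul (‖w‖ * ‖v‖)).mono' ((A.meas_k w).mul (A.meas_k v)) ?_
  filter_upwards [A.le_B] with x h1
  have hB : 0 ≤ B x := (norm_nonneg _).trans h1
  rw [norm_mul, Real.norm_eq_abs, Real.norm_eq_abs]
  calc |⟪k x, w⟫| * |⟪k x, v⟫| ≤ (‖w‖ * B x) * (‖v‖ * B x) := by
        gcongr
        · exact abs_inner_le h1 w
        · exact abs_inner_le h1 v
    _ = _ := by ring

theorem integrable_sq (A : IsAdmissible μ k g p B M) (w : H) :
    Integrable (fun x => ⟪k x, w⟫ ^ 2) μ := by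
  simpa [sq] using A.integrable_mul w w

theorem integrable_nonlin (A : IsAdmissible μ k g p B M) (w v : H) :
    Integrable (fun x => g x * (|⟪k x, w⟫| ^ (p - 2) * ⟪k x, w⟫) * ⟪k x, v⟫) μ := by
  have h2p := A.two_lt
  have hm : AEStronglyMeasurable
      (fun x => g x * (|⟪k x, w⟫| ^ (p - 2) * ⟪k x, w⟫) * ⟪k x, v⟫) μ :=
    (A.meas_g.mul ((((A.meas_k w).norm.aemeasurable.pow_const (p - 2)).aestronglyMeasurable).mul
      (A.meas_k w))).mul (A.meas_k v)
  refine (A.int_Bp.const_mul (M * (‖w‖ ^ (p - 2) * ‖w‖ * ‖v‖))).mono' hm ?_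
  filter_upwards [A.le_B, A.g_nonneg, A.g_le] with x h1 h2 h3
  have hB : 0 ≤ B x := (norm_nonneg _).trans h1
  have hsplit : B x ^ p = B x ^ (p - 2) * B x * B x := by
    rcases hB.eq_or_lt with h | h
    · rw [← h, Real.zero_rpow (by linarith)]; simp
    · rw [mul_assoc, ← sq, ← Real.rpow_two, ← Real.rpow_add h]; ring_nf
  have hM := A.M_nonneg
  rw [norm_mul, norm_mul, norm_mul, Real.norm_of_nonneg h2,
    Real.norm_of_nonneg (by positivity : 0 ≤ |⟪k x, w⟫| ^ (p - 2)), Real.norm_eq_abs,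
    Real.norm_eq_abs, hsplit]
  calc g x * (|⟪k x, w⟫| ^ (p - 2) * |⟪k x, w⟫|) * |⟪k x, v⟫|
      ≤ M * ((‖w‖ * B x) ^ (p - 2) * (‖w‖ * B x)) * (‖v‖ * B x) := by
        gcongr
        · exact abs_inner_le h1 w
        · exact abs_inner_le h1 w
        · exact abs_inner_le h1 v
    _ = _ := by rw [Real.mul_rpow (norm_nonneg _) hB]; ring

theorem potF_le (A : IsAdmissible μ k g p B M) {w : H} {L : ℝ} (hL : ‖w‖ ≤ L) :
    potF μ k g p w ≤ M * L ^ p * ∫ x, B x ^ p ∂μ := by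
  rw [← integral_const_mul]
  refine integral_mono_ae (A.integrable_pot w) (A.int_Bp.const_mul _) ?_
  filter_upwards [A.le_B, A.g_nonneg, A.g_le] with x h1 h2 h3
  exact (le_abs_self _).trans (pot_le A.two_lt h1 h2 h3 A.M_nonneg hL)

/-- Under coercivity, the energy attains its minimum on every nonempty mass level set. -/
theorem exists_minimizer [CompleteSpace H] [TopologicalSpace.SeparableSpace H]
    (A : IsAdmissible μ k g p B M) {c : ℝ} (w₀ : H)
    (hw₀ : massF μ k w₀ = c) {L₀ : ℝ}
    (hco : ∀ w, massF μ k w = c → L₀ ≤ ‖w‖ → potF μ k g p w / p ≤ ‖w‖ ^ 2 / 4) :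
    ∃ w, massF μ k w = c ∧ ∀ v, massF μ k v = c → energyF μ k g p w ≤ energyF μ k g p v := by
  have h2p := A.two_lt
  set S := energyF μ k g p '' {w | massF μ k w = c} with hS
  set K := M * |L₀| ^ p * ∫ x, B x ^ p ∂μ with hK
  have hbdd : BddBelow S := by
    refine ⟨min 0 (-(K / p)), ?_⟩
    rintro _ ⟨w, hw, rfl⟩
    rcases le_or_gt L₀ ‖w‖ with h | h
    · have := hco w hw h
      refine (min_le_left _ _).trans ?_
      unfold energyF
      nlinarith [sq_nonneg ‖w‖]
    · refine (min_le_right _ _).trans ?_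
      have h1 : potF μ k g p w / p ≤ K / p := by
        gcongr
        exact A.potF_le (h.le.trans (le_abs_self _))
      unfold energyF
      nlinarith [sq_nonneg ‖w‖]
  have hne : S.Nonempty := ⟨_, w₀, hw₀, rfl⟩
  obtain ⟨e, -, he, heS⟩ := exists_seq_tendsto_sInf hne hbdd
  choose w hw hwe using heS
  obtain ⟨K₁, hK₁⟩ := he.bddAbove_range
  have hbound : ∀ n, ‖w n‖ ≤ |L₀| + (1 + 4 * |K₁|) := by
    intro n
    have hE : energyF μ k g p (w n) ≤ K₁ := by rw [hwe n]; exact hK₁ ⟨n, rfl⟩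
    have := abs_nonneg L₀
    have h5 := le_abs_self K₁
    have h6 := abs_nonneg K₁
    rcases le_or_gt L₀ ‖w n‖ with h | h
    · have := hco (w n) (hw n) h
      unfold energyF at hE
      nlinarith [sq_nonneg (‖w n‖ - 1), sq_nonneg (‖w n‖ - 2)]
    · have := le_abs_self L₀
      linarith
  obtain ⟨w', φ, hφ, hweak⟩ := exists_weak_subseq_limit hbound
  set L := |L₀| + (1 + 4 * |K₁|)
  have hmass : Tendsto (fun n => massF μ k (w (φ n))) atTop (𝓝 (massF μ k w')) := by
    refine tendsto_integral_of_dominated_convergence (fun x => L ^ 2 * B x ^ 2)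
      (fun n => (A.integrable_sq _).aestronglyMeasurable) (A.int_B2.const_mul _) ?_ ?_
    · intro n
      filter_upwards [A.le_B] with x hx
      exact sq_le hx (hbound _)
    · exact Eventually.of_forall fun x => (hweak (k x)).pow 2
  have hpot : Tendsto (fun n => potF μ k g p (w (φ n))) atTop (𝓝 (potF μ k g p w')) := by
    refine tendsto_integral_of_dominated_convergence (fun x => M * L ^ p * B x ^ p)
      (fun n => A.meas_pot _) (A.int_Bp.const_mul _) ?_ ?_
    · intro n
      filter_upwards [A.le_B, A.g_nonneg, A.g_le] with x h1 h2 h3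
      exact pot_le A.two_lt h1 h2 h3 A.M_nonneg (hbound _)
    · exact Eventually.of_forall fun x =>
        (((hweak (k x)).abs).rpow_const (Or.inr (by linarith))).const_mul _
  have hmc : massF μ k w' = c :=
    tendsto_nhds_unique hmass (by
      have : (fun n => massF μ k (w (φ n))) = fun _ => c := funext fun n => hw (φ n)
      rw [this]; exact tendsto_const_nhds)
  refine ⟨w', hmc, ?_⟩
  have heφ := he.comp hφ.tendsto_atTop
  have hlim : Tendsto (fun n => energyF μ k g p (w (φ n)) + potF μ k g p (w (φ n)) / p) atTop
      (𝓝 (sInf S + potF μ k g p w' / p)) := by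
    refine Tendsto.add ?_ (hpot.div_const p)
    refine heφ.congr fun n => ?_
    simp [hwe]
  have hle : ⟪w', w'⟫ ≤ (‖w'‖ ^ 2 / 2) + (sInf S + potF μ k g p w' / p) := by
    refine le_of_tendsto_of_tendsto' (hweak w') (hlim.const_add _) fun n => ?_
    have h1 := real_inner_le_norm w' (w (φ n))
    unfold energyF
    nlinarith [sq_nonneg (‖w'‖ - ‖w (φ n)‖)]
  rw [real_inner_self_eq_norm_sq] at hle
  intro v hv
  have h1 : sInf S ≤ energyF μ k g p v := csInf_le hbdd ⟨v, hv, rfl⟩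
  refine le_trans ?_ h1
  unfold energyF
  linarith


/-- Euler–Lagrange equation of a constrained minimizer. -/
theorem euler_lagrange (A : IsAdmissible μ k g p B M) {c : ℝ} (hc : 0 < c) {w : H}
    (hw : massF μ k w = c)
    (hmin : ∀ v, massF μ k v = c → energyF μ k g p w ≤ energyF μ k g p v) (φ : H) :
    ⟪w, φ⟫ + (potF μ k g p w - ‖w‖ ^ 2) / c * ∫ x, ⟪k x, w⟫ * ⟪k x, φ⟫ ∂μ =
      ∫ x, g x * (|⟪k x, w⟫| ^ (p - 2) * ⟪k x, w⟫) * ⟪k x, φ⟫ ∂μ := by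
  have h2p := A.two_lt
  set a := ∫ x, ⟪k x, w⟫ * ⟪k x, φ⟫ ∂μ with ha
  set b := massF μ k φ with hb
  set D := ∫ x, g x * (|⟪k x, w⟫| ^ (p - 2) * ⟪k x, w⟫) * ⟪k x, φ⟫ ∂μ with hD
  set P := potF μ k g p w with hP
  set m : ℝ → ℝ := fun t => c + 2 * t * a + t ^ 2 * b with hm
  have hmass : ∀ t : ℝ, massF μ k (w + t • φ) = m t := by
    intro t
    have : ∀ x, ⟪k x, w + t • φ⟫ ^ 2 =
        ⟪k x, w⟫ ^ 2 + 2 * t * (⟪k x, w⟫ * ⟪k x, φ⟫) + t ^ 2 * ⟪k x, φ⟫ ^ 2 := by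
      intro x
      rw [inner_add_right, real_inner_smul_right]; ring
    simp only [massF, this]
    have hadd : Integrable (fun x => ⟪k x, w⟫ ^ 2 + 2 * t * (⟪k x, w⟫ * ⟪k x, φ⟫)) μ :=
      (A.integrable_sq w).add ((A.integrable_mul w φ).const_mul _)
    rw [integral_add hadd ((A.integrable_sq φ).const_mul _), integral_add (A.integrable_sq w)
      ((A.integrable_mul w φ).const_mul _), integral_const_mul, integral_const_mul]
    simp only [hm, ← hw, ha, hb, massF]
  have hpot : ∀ t : ℝ, P + p * t * D ≤ potF μ k g p (w + t • φ) := by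
    intro t
    have h1 : P + p * t * D = ∫ x, (g x * |⟪k x, w⟫| ^ p +
        p * t * (g x * (|⟪k x, w⟫| ^ (p - 2) * ⟪k x, w⟫) * ⟪k x, φ⟫)) ∂μ := by
      rw [integral_add (A.integrable_pot w) ((A.integrable_nonlin w φ).const_mul _),
        integral_const_mul]
      rfl
    rw [h1]
    refine integral_mono_ae ((A.integrable_pot w).add ((A.integrable_nonlin w φ).const_mul _))
      (A.integrable_pot _) ?_
    filter_upwards [A.g_nonneg] with x hx
    have h2 := mul_le_mul_of_nonneg_left
      (abs_rpow_tangent_le h2p (⟪k x, w⟫) (⟪k x, w + t • φ⟫)) hx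
    refine le_trans (le_of_eq ?_) h2
    rw [inner_add_right, real_inner_smul_right]
    ring
  set s : ℝ → ℝ := fun t => c / m t with hs
  set G : ℝ → ℝ := fun t => s t * (‖w‖ ^ 2 + 2 * t * ⟪w, φ⟫ + t ^ 2 * ‖φ‖ ^ 2) / 2 -
    s t ^ (p / 2) * (P / p + t * D) with hG
  have hm0 : m 0 = c := by simp [hm]
  have hs0 : s 0 = 1 := by simp only [hs, hm0]; exact div_self hc.ne'
  have hG0 : G 0 = energyF μ k g p w := by
    simp [hG, hs0, energyF, hP]
  have hmd : HasDerivAt m (2 * a) 0 := by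
    have h1 : HasDerivAt m (0 + 2 * 1 * a + (2 : ℕ) * (0 : ℝ) ^ (2 - 1) * 1 * b) 0 := by
      refine ((hasDerivAt_const _ _).add ?_).add ?_
      · exact ((hasDerivAt_id (0 : ℝ)).const_mul 2).mul_const a
      · exact ((hasDerivAt_id (0 : ℝ)).pow 2).mul_const b
    simpa using h1
  have hsd : HasDerivAt s (-(2 * a) / c) 0 := by
    have h1 := (hasDerivAt_const (0 : ℝ) c).div hmd (by rw [hm0]; exact hc.ne')
    rw [hm0] at h1
    refine h1.congr_deriv ?_
    field_simp
    ring
  have hspd : HasDerivAt (fun t => s t ^ (p / 2)) (-(2 * a) / c * (p / 2)) 0 := by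
    have h1 := hsd.rpow_const (p := p / 2) (Or.inl (by rw [hs0]; norm_num))
    rw [hs0] at h1
    simpa using h1
  have hnd : HasDerivAt (fun t : ℝ => ‖w‖ ^ 2 + 2 * t * ⟪w, φ⟫ + t ^ 2 * ‖φ‖ ^ 2)
      (2 * ⟪w, φ⟫) 0 := by
    have h1 : HasDerivAt (fun t : ℝ => ‖w‖ ^ 2 + 2 * t * ⟪w, φ⟫ + t ^ 2 * ‖φ‖ ^ 2)
        (0 + 2 * 1 * ⟪w, φ⟫ + (2 : ℕ) * (0 : ℝ) ^ (2 - 1) * 1 * ‖φ‖ ^ 2) 0 := by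
      refine ((hasDerivAt_const _ _).add ?_).add ?_
      · exact ((hasDerivAt_id (0 : ℝ)).const_mul 2).mul_const _
      · exact ((hasDerivAt_id (0 : ℝ)).pow 2).mul_const _
    simpa using h1
  have hld : HasDerivAt (fun t : ℝ => P / p + t * D) D 0 := by
    simpa using ((hasDerivAt_id (0 : ℝ)).mul_const D).const_add (P / p)
  have hGd : HasDerivAt G (-(2 * a) / c * ‖w‖ ^ 2 / 2 + ⟪w, φ⟫ - (-(a / c) * P + D)) 0 := by
    have h1 := ((hsd.mul hnd).div_const 2).sub (hspd.mul hld)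
    refine h1.congr_deriv ?_
    simp only [hs0]
    simp
    field_simp
  have hloc : IsLocalMin G 0 := by
    have hpos : ∀ᶠ t in 𝓝 (0 : ℝ), 0 < m t :=
      hmd.continuousAt.eventually_const_lt (by rw [hm0]; exact hc)
    filter_upwards [hpos] with t ht
    rw [hG0]
    have hst : 0 < s t := div_pos hc ht
    set v := √(s t) • (w + t • φ) with hv
    have hin : ∀ x, ⟪k x, v⟫ = √(s t) * ⟪k x, w + t • φ⟫ := fun x => real_inner_smul_right _ _ _
    have hmv : massF μ k v = c := by
      have : massF μ k v = s t * massF μ k (w + t • φ) := by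
        simp only [massF, hin, mul_pow, Real.sq_sqrt hst.le]
        rw [integral_const_mul]
      rw [this, hmass]
      exact div_mul_cancel₀ c ht.ne'
    have hpv : potF μ k g p v = s t ^ (p / 2) * potF μ k g p (w + t • φ) := by
      have h1 : √(s t) ^ p = s t ^ (p / 2) := by
        rw [Real.sqrt_eq_rpow, ← Real.rpow_mul hst.le]; ring_nf
      simp only [potF, hin]
      rw [← integral_const_mul]
      congr 1; ext x
      rw [abs_mul, abs_of_nonneg (Real.sqrt_nonneg _),
        Real.mul_rpow (Real.sqrt_nonneg _) (abs_nonneg _), h1]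
      ring
    have hnv : ‖v‖ ^ 2 = s t * (‖w‖ ^ 2 + 2 * t * ⟪w, φ⟫ + t ^ 2 * ‖φ‖ ^ 2) := by
      rw [hv, norm_smul, mul_pow, Real.norm_of_nonneg (Real.sqrt_nonneg _), Real.sq_sqrt hst.le,
        norm_add_sq_real, real_inner_smul_right, norm_smul, mul_pow, Real.norm_eq_abs, sq_abs]
      ring
    refine (hmin v hmv).trans ?_
    have h1 : s t ^ (p / 2) * (P / p + t * D) ≤ potF μ k g p v / p := by
      rw [hpv, mul_div_assoc]
      have h3 : P / p + t * D = (P + p * t * D) / p := by field_simp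
      rw [h3]
      have := hpot t
      gcongr
    have h2 : energyF μ k g p v = s t * (‖w‖ ^ 2 + 2 * t * ⟪w, φ⟫ + t ^ 2 * ‖φ‖ ^ 2) / 2 -
        potF μ k g p v / p := by rw [energyF, hnv]
    rw [h2]
    simp only [hG]
    linarith
  have hzero := hloc.hasDerivAt_eq_zero hGd
  field_simp at hzero ⊢
  linarith

end IsAdmissible

/-- Radial fundamental solution `∫_r^R s^{1-N} ds`, vanishing at `R`. -/
def radGreen (N : ℕ) (R r : ℝ) : ℝ := ∫ s in r..R, (s ^ (N - 1))⁻¹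

section RadGreen

variable {N : ℕ} {R : ℝ}

theorem intervalIntegrable_inv_pow {r s : ℝ} (hr : 0 < r) (hs : 0 < s) (n : ℕ) :
    IntervalIntegrable (fun t : ℝ => (t ^ n)⁻¹) volume r s := by
  refine ContinuousOn.intervalIntegrable fun t ht => ?_
  have : 0 < t := lt_of_lt_of_le (lt_min hr hs) ht.1
  exact ((continuousAt_id.pow n).inv₀ (pow_ne_zero _ this.ne')).continuousWithinAt

theorem radGreen_sub {r s : ℝ} (hR : 0 < R) (hr : 0 < r) (hs : 0 < s) :
    radGreen N R r - radGreen N R s = ∫ t in r..s, (t ^ (N - 1))⁻¹ := by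
  unfold radGreen
  rw [sub_eq_iff_eq_add, intervalIntegral.integral_add_adjacent_intervals]
  · exact intervalIntegrable_inv_pow hr hs _
  · exact intervalIntegrable_inv_pow hs hR _

theorem radGreen_self : radGreen N R R = 0 := by simp [radGreen]

theorem radGreen_anti {r s : ℝ} (hR : 0 < R) (hr : 0 < r) (hrs : r ≤ s) :
    radGreen N R s ≤ radGreen N R r := by
  rw [← sub_nonneg, radGreen_sub hR hr (hr.trans_le hrs)]
  refine intervalIntegral.integral_nonneg hrs fun t ht => ?_
  have : 0 < t := hr.trans_le ht.1
  positivity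

theorem radGreen_nonneg {r : ℝ} (hr : 0 < r) (hrR : r ≤ R) : 0 ≤ radGreen N R r := by
  rw [← radGreen_self (N := N) (R := R)]
  exact radGreen_anti (hr.trans_le hrR) hr hrR

theorem radGreen_pos {r : ℝ} (hr : 0 < r) (hrR : r < R) : 0 < radGreen N R r := by
  refine intervalIntegral.intervalIntegral_pos_of_pos_on
    (intervalIntegrable_inv_pow hr (hr.trans hrR) _) (fun t ht => ?_) hrR
  have : 0 < t := hr.trans ht.1
  positivity

theorem radGreen_sub_le {r s : ℝ} (hR : 0 < R) (hr : 0 < r) (hrs : r ≤ s) :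
    radGreen N R r - radGreen N R s ≤ (r ^ (N - 1))⁻¹ * (s - r) := by
  rw [radGreen_sub hR hr (hr.trans_le hrs)]
  calc ∫ t in r..s, (t ^ (N - 1))⁻¹ ≤ ∫ _ in r..s, (r ^ (N - 1))⁻¹ := by
        refine intervalIntegral.integral_mono_on hrs
          (intervalIntegrable_inv_pow hr (hr.trans_le hrs) _) (by simp) fun t ht => ?_
        have := ht.1
        gcongr
    _ = _ := by simp [mul_comm]

theorem hasDerivAt_radGreen {r : ℝ} (hR : 0 < R) (hr : 0 < r) :
    HasDerivAt (radGreen N R) (-(r ^ (N - 1))⁻¹) r := by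
  refine intervalIntegral.integral_hasDerivAt_left (intervalIntegrable_inv_pow hr hR _) ?_ ?_
  · refine ContinuousOn.stronglyMeasurableAtFilter (s := Ioi 0) isOpen_Ioi (fun t ht => ?_) r hr
    exact ((continuousAt_id.pow _).inv₀ (pow_ne_zero _ (ne_of_gt ht))).continuousWithinAt
  · exact (continuousAt_id.pow _).inv₀ (pow_ne_zero _ hr.ne')

theorem continuousOn_radGreen (hR : 0 < R) : ContinuousOn (radGreen N R) (Ioi 0) :=
  fun _ hr => (hasDerivAt_radGreen hR hr).continuousAt.continuousWithinAt

theorem radGreen_mul_pow_le {r : ℝ} (hr : 0 < r) (hrR : r ≤ R) :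
    radGreen N R r * r ^ (N - 1) ≤ R := by
  have h := radGreen_sub_le (N := N) (hr.trans_le hrR) hr hrR
  rw [radGreen_self, sub_zero] at h
  calc radGreen N R r * r ^ (N - 1) ≤ (r ^ (N - 1))⁻¹ * (R - r) * r ^ (N - 1) := by gcongr
    _ = R - r := by field_simp
    _ ≤ R := by linarith

theorem radGreen_le_rpow (hN : 2 ≤ N) {r α : ℝ} (hr : 0 < r) (hrR : r ≤ R) (hα : 0 < α)
    (hαN : (N : ℝ) - 2 ≤ α) : radGreen N R r ≤ R ^ (α + 2 - N) / α * r ^ (-α) := by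
  have hR := hr.trans_le hrR
  have hnot : (0 : ℝ) ∉ uIcc r R := by
    rw [uIcc_of_le hrR]; exact fun h => absurd h.1 (not_le.2 hr)
  calc radGreen N R r ≤ ∫ s in r..R, R ^ (α + 2 - N) * s ^ (-α - 1) := by
        refine intervalIntegral.integral_mono_on hrR (intervalIntegrable_inv_pow hr hR _) ?_
          fun t ht => ?_
        · exact (intervalIntegral.intervalIntegrable_rpow (Or.inr hnot)).const_mul _
        · have ht0 : 0 < t := hr.trans_le ht.1
          have h1 : (t ^ (N - 1))⁻¹ = t ^ (α + 2 - N) * t ^ (-α - 1) := by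
            rw [← Real.rpow_add ht0, ← Real.rpow_natCast, ← Real.rpow_neg ht0.le,
              Nat.cast_sub (by omega)]
            congr 1; push_cast; ring
          rw [h1]
          have := ht.2
          gcongr
          linarith
    _ = R ^ (α + 2 - N) * ((R ^ (-α) - r ^ (-α)) / (-α)) := by
        rw [intervalIntegral.integral_const_mul, integral_rpow (Or.inr ⟨by linarith, hnot⟩)]
        congr 3 <;> ring_nf
    _ = R ^ (α + 2 - N) / α * (r ^ (-α) - R ^ (-α)) := by field_simp; ring
    _ ≤ _ := by
        gcongr
        have := Real.rpow_nonneg hR.le (-α)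
        linarith

end RadGreen

/-- The Green operator of the radial Dirichlet Laplacian on the ball of radius `R`. -/
def greenOp (N : ℕ) (R : ℝ) (f : ℝ → ℝ) (r : ℝ) : ℝ :=
  ∫ ρ in Ioo 0 R, ρ ^ (N - 1) * (radGreen N R (max r ρ) * f ρ)

section GreenOp

variable {N : ℕ} {R F : ℝ} {f : ℝ → ℝ}

theorem measurable_green_kernel (hR : 0 < R) (hf : ContinuousOn f (Ioo 0 R)) (r : ℝ) :
    AEStronglyMeasurable (fun ρ => ρ ^ (N - 1) * (radGreen N R (max r ρ) * f ρ))
      (volume.restrict (Ioo 0 R)) := by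
  refine ContinuousOn.aestronglyMeasurable ?_ measurableSet_Ioo
  refine (continuousOn_id.pow _).mul (ContinuousOn.mul ?_ hf)
  exact (continuousOn_radGreen hR).comp (continuous_const.max continuous_id).continuousOn
    fun ρ hρ => lt_of_lt_of_le hρ.1 (le_max_right _ _)

theorem norm_green_kernel_le {r ρ : ℝ} (hrR : r ≤ R) (hρ : ρ ∈ Ioo 0 R)
    (hb : |f ρ| ≤ F) : ‖ρ ^ (N - 1) * (radGreen N R (max r ρ) * f ρ)‖ ≤ R * F := by
  have hρ0 := hρ.1
  have h0 : 0 ≤ radGreen N R (max r ρ) :=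
    radGreen_nonneg (lt_max_of_lt_right hρ.1) (max_le hrR hρ.2.le)
  have h1 : radGreen N R (max r ρ) ≤ radGreen N R ρ :=
    radGreen_anti (hρ.1.trans hρ.2) hρ.1 (le_max_right _ _)
  have h2 := radGreen_mul_pow_le (N := N) hρ.1 hρ.2.le
  have hF : 0 ≤ F := (abs_nonneg _).trans hb
  have h3 := h0.trans h1
  rw [norm_mul, norm_mul, Real.norm_of_nonneg (by positivity), Real.norm_of_nonneg h0,
    Real.norm_eq_abs]
  calc ρ ^ (N - 1) * (radGreen N R (max r ρ) * |f ρ|)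
      ≤ ρ ^ (N - 1) * (radGreen N R ρ * F) := by gcongr
    _ = (radGreen N R ρ * ρ ^ (N - 1)) * F := by ring
    _ ≤ _ := by gcongr

theorem integrableOn_green (hR : 0 < R) (hf : ContinuousOn f (Ioo 0 R))
    (hb : ∀ ρ ∈ Ioo 0 R, |f ρ| ≤ F) {r : ℝ} (hrR : r ≤ R) :
    IntegrableOn (fun ρ => ρ ^ (N - 1) * (radGreen N R (max r ρ) * f ρ)) (Ioo 0 R) := by
  refine (integrable_const (R * F)).mono' (measurable_green_kernel hR hf r) ?_
  exact (ae_restrict_iff' measurableSet_Ioo).2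
    (Eventually.of_forall fun ρ hρ => norm_green_kernel_le hrR hρ (hb ρ hρ))

theorem greenOp_right : greenOp N R f R = 0 := by
  refine setIntegral_eq_zero_of_forall_eq_zero fun ρ hρ => ?_
  rw [max_eq_left hρ.2.le, radGreen_self]; simp

theorem abs_greenOp_le (hb : ∀ ρ ∈ Ioo 0 R, |f ρ| ≤ F) {r : ℝ}
    (hr : 0 < r) (hrR : r ≤ R) :
    |greenOp N R f r| ≤ radGreen N R r * (R ^ (N - 1) * F * R) := by
  have hR := hr.trans_le hrR
  have h := norm_setIntegral_le_of_norm_le_const (μ := volume) (s := Ioo 0 R)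
    (f := fun ρ => ρ ^ (N - 1) * (radGreen N R (max r ρ) * f ρ))
    (C := R ^ (N - 1) * (radGreen N R r * F)) (by simp) (fun ρ hρ => by
      have hρ0 := hρ.1
      have h0 : 0 ≤ radGreen N R (max r ρ) :=
        radGreen_nonneg (lt_max_of_lt_right hρ.1) (max_le hrR hρ.2.le)
      have h1 : radGreen N R (max r ρ) ≤ radGreen N R r :=
        radGreen_anti hR hr (le_max_left _ _)
      rw [norm_mul, norm_mul, Real.norm_of_nonneg (by positivity), Real.norm_of_nonneg h0,
        Real.norm_eq_abs]
      have h2 := hb ρ hρ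
      have h3 := hρ.2.le
      have h4 := h0.trans h1
      gcongr)
  refine h.trans (le_of_eq ?_)
  simp [hR.le]; ring

theorem abs_greenOp_zero_sub_le (hR : 0 < R) (hf : ContinuousOn f (Ioo 0 R))
    (hb : ∀ ρ ∈ Ioo 0 R, |f ρ| ≤ F) {r F' : ℝ} (hr : 0 < r) (hrR : r ≤ R)
    (hb' : ∀ ρ ∈ Ioo 0 r, |f ρ| ≤ F') :
    |greenOp N R f 0 - greenOp N R f r| ≤ F' * r ^ 2 := by
  unfold greenOp
  rw [← integral_sub (integrableOn_green hR hf hb hR.le) (integrableOn_green hR hf hb hrR)]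
  have hsupp : ∫ ρ in Ioo 0 R, (ρ ^ (N - 1) * (radGreen N R (max 0 ρ) * f ρ) -
        ρ ^ (N - 1) * (radGreen N R (max r ρ) * f ρ)) =
      ∫ ρ in Ioo 0 r, (ρ ^ (N - 1) * (radGreen N R (max 0 ρ) * f ρ) -
        ρ ^ (N - 1) * (radGreen N R (max r ρ) * f ρ)) := by
    refine setIntegral_eq_of_subset_of_forall_sdiff_eq_zero measurableSet_Ioo
      (Ioo_subset_Ioo_right hrR) fun ρ hρ => ?_
    have : r ≤ ρ := by
      by_contra hlt
      exact hρ.2 ⟨hρ.1.1, not_le.1 hlt⟩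
    rw [max_eq_right this, max_eq_right hρ.1.1.le]; ring
  rw [hsupp, ← Real.norm_eq_abs]
  have h := norm_setIntegral_le_of_norm_le_const (μ := volume) (s := Ioo 0 r)
    (f := fun ρ => ρ ^ (N - 1) * (radGreen N R (max 0 ρ) * f ρ) -
        ρ ^ (N - 1) * (radGreen N R (max r ρ) * f ρ)) (C := F' * r) (by simp) (fun ρ hρ => by
      have hρ0 := hρ.1
      rw [max_eq_right hρ.1.le, max_eq_left hρ.2.le]
      have h1 := radGreen_sub_le (N := N) hR hρ.1 hρ.2.le
      have h2 := radGreen_anti (N := N) hR hρ.1 hρ.2.le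
      have h3 := hb' ρ hρ
      have hF' : 0 ≤ F' := (abs_nonneg _).trans h3
      have : ρ ^ (N - 1) * (radGreen N R ρ * f ρ) - ρ ^ (N - 1) * (radGreen N R r * f ρ) =
        ρ ^ (N - 1) * (radGreen N R ρ - radGreen N R r) * f ρ := by ring
      rw [this, norm_mul, norm_mul, Real.norm_of_nonneg (by positivity),
        Real.norm_of_nonneg (by linarith), Real.norm_eq_abs]
      calc ρ ^ (N - 1) * (radGreen N R ρ - radGreen N R r) * |f ρ|
          ≤ ρ ^ (N - 1) * ((ρ ^ (N - 1))⁻¹ * (r - ρ)) * F' := by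
            have := sub_nonneg.2 hρ.2.le
            gcongr
        _ = (r - ρ) * F' := by field_simp
        _ ≤ r * F' := by gcongr; linarith
        _ = _ := mul_comm _ _)
  refine h.trans (le_of_eq ?_)
  simp [hr.le]; ring

theorem intervalIntegrable_pow_mul (hf : ContinuousOn f (Ioo 0 R))
    (hb : ∀ ρ ∈ Ioo 0 R, |f ρ| ≤ F) {r : ℝ} (hr : 0 < r) (hrR : r < R) :
    IntervalIntegrable (fun ρ => ρ ^ (N - 1) * f ρ) volume 0 r := by
  rw [intervalIntegrable_iff_integrableOn_Ioo_of_le hr.le]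
  have hsub : Ioo 0 r ⊆ Ioo 0 R := Ioo_subset_Ioo_right hrR.le
  refine (integrable_const (R ^ (N - 1) * F)).mono'
    (((continuousOn_id.pow _).mul (hf.mono hsub)).aestronglyMeasurable measurableSet_Ioo) ?_
  refine (ae_restrict_iff' measurableSet_Ioo).2 (Eventually.of_forall fun ρ hρ => ?_)
  have hρ0 := hρ.1
  rw [norm_mul, Real.norm_of_nonneg (by positivity), Real.norm_eq_abs]
  have h1 := hb ρ (hsub hρ)
  have h2 := (hsub hρ).2.le
  have hR := hr.trans hrR
  gcongr

theorem greenOp_eq (hR : 0 < R) (hf : ContinuousOn f (Ioo 0 R))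
    (hb : ∀ ρ ∈ Ioo 0 R, |f ρ| ≤ F) {r : ℝ} (hr : r ∈ Ioo 0 R) :
    greenOp N R f r = radGreen N R r * (∫ ρ in (0 : ℝ)..r, ρ ^ (N - 1) * f ρ) +
      ∫ ρ in r..R, ρ ^ (N - 1) * (radGreen N R ρ * f ρ) := by
  have hint := integrableOn_green (N := N) hR hf hb hr.2.le
  have hII : ∀ a b, a ∈ Icc 0 R → b ∈ Icc 0 R → IntervalIntegrable
      (fun ρ => ρ ^ (N - 1) * (radGreen N R (max r ρ) * f ρ)) volume a b := by
    intro a b ha hb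
    have : IntervalIntegrable
      (fun ρ => ρ ^ (N - 1) * (radGreen N R (max r ρ) * f ρ)) volume 0 R := by
      rwa [intervalIntegrable_iff_integrableOn_Ioo_of_le hR.le]
    refine this.mono_set ?_
    rw [uIcc_of_le hR.le]
    exact uIcc_subset_Icc ha hb
  unfold greenOp
  rw [← integral_Ioc_eq_integral_Ioo, ← intervalIntegral.integral_of_le hR.le,
    ← intervalIntegral.integral_add_adjacent_intervals
      (hII 0 r ⟨le_rfl, hR.le⟩ ⟨hr.1.le, hr.2.le⟩) (hII r R ⟨hr.1.le, hr.2.le⟩ ⟨hR.le, le_rfl⟩)]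
  congr 1
  · rw [← intervalIntegral.integral_const_mul]
    refine intervalIntegral.integral_congr fun ρ hρ => ?_
    rw [uIcc_of_le hr.1.le] at hρ
    simp only [max_eq_left hρ.2]; ring
  · refine intervalIntegral.integral_congr fun ρ hρ => ?_
    rw [uIcc_of_le hr.2.le] at hρ
    simp only [max_eq_right hρ.1]

theorem hasDerivAt_greenOp (hR : 0 < R) (hf : ContinuousOn f (Ioo 0 R))
    (hb : ∀ ρ ∈ Ioo 0 R, |f ρ| ≤ F) {r : ℝ} (hr : r ∈ Ioo 0 R) :
    HasDerivAt (greenOp N R f) (-(r ^ (N - 1))⁻¹ * ∫ ρ in (0 : ℝ)..r, ρ ^ (N - 1) * f ρ) r := by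
  have hcf : ContinuousOn (fun ρ => ρ ^ (N - 1) * f ρ) (Ioo 0 R) :=
    (continuousOn_id.pow _).mul hf
  have hcg : ContinuousOn (fun ρ => ρ ^ (N - 1) * (radGreen N R ρ * f ρ)) (Ioo 0 R) :=
    (continuousOn_id.pow _).mul (((continuousOn_radGreen hR).mono fun _ h => h.1).mul hf)
  have h1 : HasDerivAt (fun r => ∫ ρ in (0 : ℝ)..r, ρ ^ (N - 1) * f ρ) (r ^ (N - 1) * f r) r :=
    intervalIntegral.integral_hasDerivAt_right (intervalIntegrable_pow_mul hf hb hr.1 hr.2)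
      (hcf.stronglyMeasurableAtFilter isOpen_Ioo r hr) (hcf.continuousAt (isOpen_Ioo.mem_nhds hr))
  have hII : IntervalIntegrable (fun ρ => ρ ^ (N - 1) * (radGreen N R ρ * f ρ)) volume r R := by
    rw [intervalIntegrable_iff_integrableOn_Ioo_of_le hr.2.le]
    refine ((integrableOn_green (N := N) (r := 0) hR hf hb hR.le).mono_set
      (Ioo_subset_Ioo_left hr.1.le)).congr_fun (fun ρ hρ => ?_) measurableSet_Ioo
    simp only [max_eq_right (hr.1.trans hρ.1).le]
  have h2 : HasDerivAt (fun r => ∫ ρ in r..R, ρ ^ (N - 1) * (radGreen N R ρ * f ρ))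
      (-(r ^ (N - 1) * (radGreen N R r * f r))) r :=
    intervalIntegral.integral_hasDerivAt_left hII
      (hcg.stronglyMeasurableAtFilter isOpen_Ioo r hr) (hcg.continuousAt (isOpen_Ioo.mem_nhds hr))
  have h3 := ((hasDerivAt_radGreen (N := N) hR hr.1).mul h1).add h2
  refine (h3.congr_deriv (by ring)).congr_of_eventuallyEq ?_
  filter_upwards [isOpen_Ioo.mem_nhds hr] with t ht
  exact greenOp_eq hR hf hb ht

theorem continuousOn_greenOp (hR : 0 < R) (hf : ContinuousOn f (Ioo 0 R))
    (hb : ∀ ρ ∈ Ioo 0 R, |f ρ| ≤ F) : ContinuousOn (greenOp N R f) (Icc 0 R) := by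
  intro r hr
  rcases hr.1.eq_or_lt with h0 | h0
  · subst h0
    refine tendsto_iff_norm_sub_tendsto_zero.2 ?_
    have hlim : Tendsto (fun r : ℝ => F * r ^ 2) (𝓝[Icc 0 R] 0) (𝓝 0) := by
      have : ContinuousAt (fun r : ℝ => F * r ^ 2) 0 := by fun_prop
      simpa [ContinuousAt] using this.mono_left nhdsWithin_le_nhds
    refine squeeze_zero' (Eventually.of_forall fun _ => norm_nonneg _) ?_ hlim
    filter_upwards [self_mem_nhdsWithin] with r hr
    rcases hr.1.eq_or_lt with h | h
    · rw [← h]; simp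
    · rw [norm_sub_rev]
      exact abs_greenOp_zero_sub_le hR hf hb h hr.2 fun ρ hρ => hb ρ ⟨hρ.1, hρ.2.trans_le hr.2⟩
  · rcases hr.2.eq_or_lt with h1 | h1
    · subst h1
      have hlim : Tendsto (fun t => radGreen N r t * (r ^ (N - 1) * F * r)) (𝓝[Icc 0 r] r)
          (𝓝 0) := by
        have := ((hasDerivAt_radGreen (N := N) hR hR).continuousAt.mul_const
          (r ^ (N - 1) * F * r))
        simpa [ContinuousAt, radGreen_self] using this.mono_left nhdsWithin_le_nhds
      rw [ContinuousWithinAt, greenOp_right]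
      refine squeeze_zero_norm' ?_ hlim
      filter_upwards [self_mem_nhdsWithin, mem_nhdsWithin_of_mem_nhds (Ioi_mem_nhds hR)]
        with t ht ht'
      exact abs_greenOp_le hb ht' ht.2
    · exact (hasDerivAt_greenOp hR hf hb ⟨h0, h1⟩).continuousAt.continuousWithinAt

end GreenOp

/-- The rescaled radial average `r^{-N} ∫_0^r ρ^{N-1} f`, continuously extended to `0`. -/
def radMean (N : ℕ) (f : ℝ → ℝ) (r : ℝ) : ℝ :=
  if r = 0 then f 0 / N else (r ^ N)⁻¹ * ∫ ρ in (0 : ℝ)..r, ρ ^ (N - 1) * f ρ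

section RadMean

variable {N : ℕ} {R : ℝ} {f : ℝ → ℝ}

theorem continuousOn_pow_mul_Icc (hf : ContinuousOn f (Ico 0 R)) {r : ℝ} (hrR : r < R) :
    ContinuousOn (fun ρ => ρ ^ (N - 1) * f ρ) (Icc 0 r) :=
  (continuousOn_id.pow _).mul (hf.mono fun _ h => ⟨h.1, h.2.trans_lt hrR⟩)

theorem hasDerivAt_integral_pow_mul (hf : ContinuousOn f (Ico 0 R)) {r : ℝ} (hr : r ∈ Ioo 0 R) :
    HasDerivAt (fun r => ∫ ρ in (0 : ℝ)..r, ρ ^ (N - 1) * f ρ) (r ^ (N - 1) * f r) r := by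
  have hcf : ContinuousOn (fun ρ => ρ ^ (N - 1) * f ρ) (Ioo 0 R) :=
    (continuousOn_id.pow _).mul (hf.mono Ioo_subset_Ico_self)
  refine intervalIntegral.integral_hasDerivAt_right ?_
      (hcf.stronglyMeasurableAtFilter isOpen_Ioo r hr) (hcf.continuousAt (isOpen_Ioo.mem_nhds hr))
  refine ContinuousOn.intervalIntegrable ?_
  rw [uIcc_of_le hr.1.le]
  exact continuousOn_pow_mul_Icc hf hr.2

theorem hasDerivAt_radMean (hN : 1 ≤ N) (hf : ContinuousOn f (Ico 0 R)) {r : ℝ}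
    (hr : r ∈ Ioo 0 R) :
    HasDerivAt (radMean N f) ((f r - N * radMean N f r) / r) r := by
  have hr0 := hr.1.ne'
  have h1 : HasDerivAt (fun r : ℝ => (r ^ N)⁻¹) (-(N * r ^ (N - 1)) / (r ^ N) ^ 2) r :=
    (hasDerivAt_pow N r).inv (pow_ne_zero _ hr0)
  have h2 := h1.mul (hasDerivAt_integral_pow_mul (N := N) hf hr)
  have hpow : r ^ N = r ^ (N - 1) * r := by rw [← pow_succ]; congr 1; omega
  refine (h2.congr_deriv ?_).congr_of_eventuallyEq ?_
  · rw [radMean, if_neg hr0, hpow]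
    field_simp
    ring
  · filter_upwards [isOpen_Ioo.mem_nhds hr] with t ht
    simp [radMean, ht.1.ne']

theorem continuousOn_radMean (hN : 1 ≤ N) (hf : ContinuousOn f (Ico 0 R)) :
    ContinuousOn (radMean N f) (Ico 0 R) := by
  intro r hr
  rcases hr.1.eq_or_lt with h0 | h0
  · subst h0
    have hN0 : (N : ℝ) ≠ 0 := by positivity
    rw [ContinuousWithinAt, Metric.tendsto_nhdsWithin_nhds]
    intro ε hε
    have hfc := hf 0 hr
    rw [ContinuousWithinAt, Metric.tendsto_nhdsWithin_nhds] at hfc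
    obtain ⟨δ, hδ, hfδ⟩ := hfc (ε / 2) (by positivity)
    refine ⟨δ, hδ, fun {r} hr' hd => ?_⟩
    rcases hr'.1.eq_or_lt with h | h
    · rw [← h]; simpa using hε
    · have hcon := (continuousOn_pow_mul_Icc (N := N) hf hr'.2)
      have hI1 : IntervalIntegrable (fun ρ => ρ ^ (N - 1) * f ρ) volume 0 r :=
        ContinuousOn.intervalIntegrable (by rwa [uIcc_of_le h.le])
      have hI2 : IntervalIntegrable (fun ρ : ℝ => ρ ^ (N - 1) * f 0) volume 0 r :=
        (by fun_prop : Continuous fun ρ : ℝ => ρ ^ (N - 1) * f 0).intervalIntegrable _ _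
      have hpow : r ^ N = r ^ (N - 1) * r := by rw [← pow_succ]; congr 1; omega
      have hsub : radMean N f r - radMean N f 0 =
          (r ^ N)⁻¹ * ∫ ρ in (0 : ℝ)..r, (ρ ^ (N - 1) * f ρ - ρ ^ (N - 1) * f 0) := by
        rw [intervalIntegral.integral_sub hI1 hI2, intervalIntegral.integral_mul_const,
          integral_pow, mul_sub]
        have : ((N - 1 : ℕ) : ℝ) + 1 = N := by
          rw [Nat.cast_sub hN]; push_cast; ring
        rw [this, Nat.sub_add_cancel hN]
        simp only [radMean, if_neg h.ne', if_true, zero_pow (by omega : N ≠ 0)]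
        field_simp
        ring
      have hle := intervalIntegral.norm_integral_le_of_norm_le_const (a := 0) (b := r)
        (f := fun ρ => ρ ^ (N - 1) * f ρ - ρ ^ (N - 1) * f 0) (C := r ^ (N - 1) * (ε / 2))
        (fun ρ hρ => by
          rw [uIoc_of_le h.le] at hρ
          have hρ0 := hρ.1
          have hρr := hρ.2
          rw [← mul_sub, norm_mul, Real.norm_of_nonneg (by positivity)]
          have : dist (f ρ) (f 0) < ε / 2 := by
            refine hfδ ⟨hρ.1.le, hρ.2.trans_lt hr'.2⟩ (lt_of_le_of_lt ?_ hd)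
            simp only [Real.dist_eq, sub_zero, abs_of_pos hρ0, abs_of_pos h]
            exact hρr
          rw [dist_eq_norm] at this
          gcongr)
      rw [dist_eq_norm, hsub, norm_mul, norm_inv, Real.norm_of_nonneg (by positivity)]
      refine lt_of_le_of_lt (mul_le_mul_of_nonneg_left hle (by positivity)) ?_
      rw [sub_zero, abs_of_pos h, hpow]
      field_simp
      linarith
  · exact (hasDerivAt_radMean hN hf ⟨h0, hr.2⟩).continuousAt.continuousWithinAt

/-- The derivative of `x ↦ radMean N f ‖x‖ • x`. -/
def radFieldDeriv (N : ℕ) (f : ℝ → ℝ) (x : Euc N) : Euc N →L[ℝ] Euc N :=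
  radMean N f ‖x‖ • ContinuousLinearMap.id ℝ (Euc N) +
    (((f ‖x‖ - N * radMean N f ‖x‖) / ‖x‖ ^ 2) • innerSL ℝ x).smulRight x

theorem hasFDerivAt_norm_of_ne {N : ℕ} {x : Euc N} (hx : x ≠ 0) :
    HasFDerivAt (fun y : Euc N => ‖y‖) (‖x‖⁻¹ • innerSL ℝ x) x := by
  have h1 := (hasStrictFDerivAt_norm_sq x).hasFDerivAt
  have hn : ‖x‖ ≠ 0 := norm_ne_zero_iff.2 hx
  have h2 := h1.sqrt (pow_ne_zero 2 hn)
  refine (h2.congr_fderiv ?_).congr_of_eventuallyEq (Eventually.of_forall fun y => ?_)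
  · rw [Real.sqrt_sq (norm_nonneg x), ← Nat.cast_smul_eq_nsmul ℝ, smul_smul]
    congr 1
    field_simp
    norm_num
  · simp [Real.sqrt_sq (norm_nonneg y)]

theorem tendsto_norm_nhdsWithin_zero {N : ℕ} (hR : 0 < R) :
    Tendsto (fun x : Euc N => ‖x‖) (𝓝 0) (𝓝[Ico 0 R] 0) := by
  refine tendsto_nhdsWithin_iff.2 ⟨by simpa using (continuous_norm (E := Euc N)).tendsto 0, ?_⟩
  filter_upwards [Metric.ball_mem_nhds (0 : Euc N) hR] with x hx
  exact ⟨norm_nonneg x, by simpa using hx⟩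

theorem hasFDerivAt_radField (hN : 1 ≤ N) (hf : ContinuousOn f (Ico 0 R)) {x : Euc N}
    (hx : ‖x‖ < R) :
    HasFDerivAt (fun y : Euc N => radMean N f ‖y‖ • y) (radFieldDeriv N f x) x := by
  by_cases h0 : x = 0
  · subst h0
    have hR : 0 < R := by simpa using hx
    have : radFieldDeriv N f 0 = radMean N f 0 • ContinuousLinearMap.id ℝ (Euc N) := by
      ext; simp [radFieldDeriv]
    rw [this]
    refine HasFDerivAt.of_isLittleO ?_
    have hlim : Tendsto (fun y : Euc N => radMean N f ‖y‖ - radMean N f 0) (𝓝 0) (𝓝 0) := by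
      have := ((continuousOn_radMean hN hf) 0 ⟨le_rfl, hR⟩).tendsto.comp
        (tendsto_norm_nhdsWithin_zero (N := N) hR)
      simpa using this.sub_const (radMean N f 0)
    have h1 := (Asymptotics.isLittleO_one_iff ℝ).2 hlim |>.smul_isBigO
      (Asymptotics.isBigO_refl (fun y : Euc N => y) (𝓝 0))
    simp only [one_smul] at h1
    refine h1.congr (fun y => ?_) (fun y => by simp)
    simp [sub_smul]
  · have hn : 0 < ‖x‖ := norm_pos_iff.2 h0
    have h1 := (hasDerivAt_radMean hN hf ⟨hn, hx⟩).comp_hasFDerivAt x (hasFDerivAt_norm_of_ne h0)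
    have h2 := h1.smul (hasFDerivAt_id x)
    refine h2.congr_fderiv ?_
    ext y i
    simp only [radFieldDeriv, id]
    simp [smul_smul]
    left
    field_simp
    exact Or.inl trivial

theorem continuousOn_radFieldDeriv (hN : 1 ≤ N) (hf : ContinuousOn f (Ico 0 R)) :
    ContinuousOn (radFieldDeriv N f) (Metric.ball 0 R) := by
  intro x hx
  have hxR : ‖x‖ < R := by simpa using hx
  have hQ := continuousOn_radMean hN hf
  by_cases h0 : x = 0
  · subst h0
    have hR : 0 < R := by simpa using hx
    refine ContinuousAt.continuousWithinAt ?_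
    refine tendsto_iff_norm_sub_tendsto_zero.2 ?_
    have hnorm := tendsto_norm_nhdsWithin_zero (N := N) hR
    have hQ0 : Tendsto (fun y : Euc N => radMean N f ‖y‖) (𝓝 0) (𝓝 (radMean N f 0)) :=
      (hQ 0 ⟨le_rfl, hR⟩).tendsto.comp hnorm
    have hf0 : Tendsto (fun y : Euc N => f ‖y‖) (𝓝 0) (𝓝 (f 0)) :=
      (hf 0 ⟨le_rfl, hR⟩).tendsto.comp hnorm
    have hN0 : (N : ℝ) ≠ 0 := by positivity
    have hlim : Tendsto (fun y : Euc N => |radMean N f ‖y‖ - radMean N f 0| +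
        |f ‖y‖ - N * radMean N f ‖y‖|) (𝓝 0) (𝓝 0) := by
      have h1 := ((hQ0.sub_const (radMean N f 0)).abs).add ((hf0.sub (hQ0.const_mul (N : ℝ))).abs)
      have h2 : |radMean N f 0 - radMean N f 0| + |f 0 - N * radMean N f 0| = 0 := by
        simp [radMean]; field_simp; simp
      rwa [h2] at h1
    refine squeeze_zero (fun _ => norm_nonneg _) (fun y => ?_) hlim
    have hz : radFieldDeriv N f 0 = radMean N f 0 • ContinuousLinearMap.id ℝ (Euc N) := by
      ext; simp [radFieldDeriv]
    have hsub : radFieldDeriv N f y - radFieldDeriv N f 0 =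
        (radMean N f ‖y‖ - radMean N f 0) • ContinuousLinearMap.id ℝ (Euc N) +
        (((f ‖y‖ - N * radMean N f ‖y‖) / ‖y‖ ^ 2) • innerSL ℝ y).smulRight y := by
      rw [hz, radFieldDeriv]
      ext v i
      simp
      ring
    rw [hsub]
    refine (norm_add_le _ _).trans (add_le_add ?_ ?_)
    · rw [norm_smul, Real.norm_eq_abs]
      exact mul_le_of_le_one_right (abs_nonneg _) ContinuousLinearMap.norm_id_le
    · rw [ContinuousLinearMap.norm_smulRight_apply, norm_smul, innerSL_apply_norm, norm_div,
        Real.norm_eq_abs, norm_pow, norm_norm]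
      by_cases hy : y = 0
      · simp [hy]
      · have : ‖y‖ ≠ 0 := norm_ne_zero_iff.2 hy
        apply le_of_eq
        field_simp
  · have hn : 0 < ‖x‖ := norm_pos_iff.2 h0
    refine ContinuousAt.continuousWithinAt ?_
    have hmem : Ico 0 R ∈ 𝓝 ‖x‖ := Ico_mem_nhds hn hxR
    have hQc : ContinuousAt (fun y : Euc N => radMean N f ‖y‖) x :=
      ContinuousAt.comp (f := fun y : Euc N => ‖y‖) (g := radMean N f) (hQ.continuousAt hmem)
        continuous_norm.continuousAt
    have hfc : ContinuousAt (fun y : Euc N => f ‖y‖) x :=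
      ContinuousAt.comp (f := fun y : Euc N => ‖y‖) (g := f) (hf.continuousAt hmem)
        continuous_norm.continuousAt
    have hcoef : ContinuousAt (fun y : Euc N => (f ‖y‖ - N * radMean N f ‖y‖) / ‖y‖ ^ 2) x :=
      (hfc.sub (continuousAt_const.mul hQc)).div (continuous_norm.continuousAt.pow 2)
        (pow_ne_zero 2 hn.ne')
    refine (hQc.smul continuousAt_const).add ?_
    have hin : ContinuousAt (fun y : Euc N =>
        ((f ‖y‖ - N * radMean N f ‖y‖) / ‖y‖ ^ 2) • innerSL ℝ y) x :=
      hcoef.smul (innerSL ℝ).continuous.continuousAt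
    exact (ContinuousLinearMap.smulRightL ℝ (Euc N) (Euc N)).continuous₂.continuousAt.comp
      (hin.prodMk continuousAt_id)

theorem hasFDerivAt_radial {U : ℝ → ℝ} {C : ℝ} (hN : 1 ≤ N)
    (hU : ∀ r ∈ Ioo 0 R,
      HasDerivAt U (-(r ^ (N - 1))⁻¹ * ∫ ρ in (0 : ℝ)..r, ρ ^ (N - 1) * f ρ) r)
    (hU0 : ∀ r ∈ Ioo 0 R, |U 0 - U r| ≤ C * r ^ 2) {x : Euc N} (hx : ‖x‖ < R) :
    HasFDerivAt (fun y : Euc N => U ‖y‖) (-innerSL ℝ (radMean N f ‖x‖ • x)) x := by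
  by_cases h0 : x = 0
  · subst h0
    have hR : 0 < R := by simpa using hx
    refine HasFDerivAt.of_isLittleO ?_
    have h1 : (fun y : Euc N => U ‖y‖ - U 0) =O[𝓝 0] fun y => ‖y‖ ^ 2 := by
      refine Asymptotics.IsBigO.of_bound C ?_
      filter_upwards [Metric.ball_mem_nhds (0 : Euc N) hR] with y hy
      by_cases hy0 : y = 0
      · simp [hy0]
      · have := hU0 ‖y‖ ⟨norm_pos_iff.2 hy0, by simpa using hy⟩
        rwa [norm_pow, norm_norm, Real.norm_eq_abs, abs_sub_comm]
    have h2 : (fun y : Euc N => ‖y‖ ^ 2) =o[𝓝 0] fun y => y := by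
      have := Asymptotics.isLittleO_pow_id (𝕜 := ℝ) (n := 2) (by norm_num)
      have h3 := this.comp_tendsto (by simpa using (continuous_norm (E := Euc N)).tendsto 0 :
        Tendsto (fun y : Euc N => ‖y‖) (𝓝 0) (𝓝 0))
      exact h3.trans_isBigO (Asymptotics.isBigO_refl _ _).norm_left
    refine (h1.trans_isLittleO h2).congr (fun y => ?_) (fun y => by simp)
    simp
  · have hn : 0 < ‖x‖ := norm_pos_iff.2 h0
    have h1 := (hU ‖x‖ ⟨hn, hx⟩).comp_hasFDerivAt x (hasFDerivAt_norm_of_ne h0)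
    refine h1.congr_fderiv ?_
    have hpow : ‖x‖ ^ N = ‖x‖ ^ (N - 1) * ‖x‖ := by rw [← pow_succ]; congr 1; omega
    ext y
    simp [radMean, hn.ne', hpow]
    field_simp

theorem contDiffOn_radial {U : ℝ → ℝ} {C : ℝ} (hN : 1 ≤ N) (hf : ContinuousOn f (Ico 0 R))
    (hU : ∀ r ∈ Ioo 0 R,
      HasDerivAt U (-(r ^ (N - 1))⁻¹ * ∫ ρ in (0 : ℝ)..r, ρ ^ (N - 1) * f ρ) r)
    (hU0 : ∀ r ∈ Ioo 0 R, |U 0 - U r| ≤ C * r ^ 2) :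
    ContDiffOn ℝ 2 (fun x : Euc N => U ‖x‖) (Metric.ball 0 R) ∧
      ∀ x ∈ Metric.ball (0 : Euc N) R, -lap (fun x : Euc N => U ‖x‖) x = f ‖x‖ := by
  have hball : UniqueDiffOn ℝ (Metric.ball (0 : Euc N) R) := Metric.isOpen_ball.uniqueDiffOn
  have hV : ContDiffOn ℝ 1 (fun y : Euc N => radMean N f ‖y‖ • y) (Metric.ball 0 R) := by
    have : (1 : WithTop ℕ∞) = 0 + 1 := by norm_num
    rw [this, contDiffOn_succ_iff_hasFDerivWithinAt_of_uniqueDiffOn hball]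
    refine ⟨by simp, radFieldDeriv N f, contDiffOn_zero.2 (continuousOn_radFieldDeriv hN hf),
      fun x hx => (hasFDerivAt_radField hN hf (by simpa using hx)).hasFDerivWithinAt⟩
  constructor
  · have : (2 : WithTop ℕ∞) = 1 + 1 := by norm_num
    rw [this, contDiffOn_succ_iff_hasFDerivWithinAt_of_uniqueDiffOn hball]
    refine ⟨by simp, fun x => -innerSL ℝ (radMean N f ‖x‖ • x), ?_,
      fun x hx => (hasFDerivAt_radial hN hU hU0 (by simpa using hx)).hasFDerivWithinAt⟩
    exact ((innerSL ℝ).contDiff.comp_contDiffOn hV).neg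
  · intro x hx
    have hxR : ‖x‖ < R := by simpa using hx
    have hi : ∀ i : Fin N, fderiv ℝ (fun y => fderiv ℝ (fun x : Euc N => U ‖x‖) y
        (EuclideanSpace.single i 1)) x (EuclideanSpace.single i 1) =
        -(radFieldDeriv N f x (EuclideanSpace.single i 1)) i := by
      intro i
      have h1 : (fun y => fderiv ℝ (fun x : Euc N => U ‖x‖) y (EuclideanSpace.single i 1)) =ᶠ[𝓝 x]
          fun y => -(EuclideanSpace.proj (𝕜 := ℝ) i (radMean N f ‖y‖ • y)) := by
        filter_upwards [Metric.isOpen_ball.mem_nhds hx] with y hy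
        rw [(hasFDerivAt_radial hN hU hU0 (by simpa using hy)).fderiv]
        simp [EuclideanSpace.inner_single_right]
      rw [h1.fderiv_eq]
      have h2 := ((EuclideanSpace.proj (𝕜 := ℝ) i).hasFDerivAt.comp x
        (hasFDerivAt_radField hN hf hxR)).neg
      have h3 : fderiv ℝ (fun y => -(EuclideanSpace.proj (𝕜 := ℝ) i (radMean N f ‖y‖ • y))) x =
        _ := h2.fderiv
      rw [h3]
      simp
    rw [lap, Finset.sum_congr rfl fun i _ => hi i, Finset.sum_neg_distrib, neg_neg]
    simp only [radFieldDeriv, add_apply, smul_apply,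
      ContinuousLinearMap.id_apply, ContinuousLinearMap.smulRight_apply, PiLp.add_apply,
      PiLp.smul_apply, innerSL_apply_apply, EuclideanSpace.inner_single_right]
    simp only [PiLp.single_apply, if_true, Finset.sum_add_distrib, smul_eq_mul]
    by_cases h0 : x = 0
    · have hN0 : (N : ℝ) ≠ 0 := by positivity
      simp [h0, radMean]; field_simp
    · have hn : ‖x‖ ≠ 0 := norm_ne_zero_iff.2 h0
      have hs : ∑ i, x i * x i = ‖x‖ ^ 2 := by
        rw [EuclideanSpace.real_norm_sq_eq]; simp [sq]
      simp
      simp_rw [mul_assoc, ← Finset.mul_sum, hs]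
      field_simp
      ring

end RadMean

/-- The measure `ρ^(N-1) dρ` on `(0, R)`. -/
def radMeasure (N : ℕ) (R : ℝ) : Measure ℝ :=
  (volume.restrict (Ioo 0 R)).withDensity fun ρ => ENNReal.ofReal (ρ ^ (N - 1))

section RadMeasure

variable {N : ℕ} {R : ℝ}

theorem ae_radMeasure : ∀ᵐ ρ ∂radMeasure N R, ρ ∈ Ioo 0 R :=
  (withDensity_absolutelyContinuous _ _).ae_le (ae_restrict_mem measurableSet_Ioo)

theorem integral_radMeasure (g : ℝ → ℝ) :
    ∫ ρ, g ρ ∂radMeasure N R = ∫ ρ in Ioo 0 R, ρ ^ (N - 1) * g ρ := by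
  rw [radMeasure, integral_withDensity_eq_integral_toReal_smul (by fun_prop) (by simp)]
  refine setIntegral_congr_fun measurableSet_Ioo fun ρ hρ => ?_
  have : 0 ≤ ρ ^ (N - 1) := pow_nonneg hρ.1.le _
  simp [ENNReal.toReal_ofReal this]

theorem integrable_radMeasure_iff {g : ℝ → ℝ} :
    Integrable g (radMeasure N R) ↔ IntegrableOn (fun ρ => ρ ^ (N - 1) * g ρ) (Ioo 0 R) := by
  rw [radMeasure, integrable_withDensity_iff_integrable_smul' (by fun_prop) (by simp)]
  refine integrableOn_congr_fun (fun ρ hρ => ?_) measurableSet_Ioo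
  have : 0 ≤ ρ ^ (N - 1) := pow_nonneg hρ.1.le _
  simp [ENNReal.toReal_ofReal this]

theorem aestronglyMeasurable_radMeasure {g : ℝ → ℝ} (hg : ContinuousOn g (Ioo 0 R)) :
    AEStronglyMeasurable g (radMeasure N R) :=
  (hg.aestronglyMeasurable measurableSet_Ioo).mono_ac (withDensity_absolutelyContinuous _ _)

theorem pow_pred_mul_rpow (hN : 1 ≤ N) {ρ : ℝ} (hρ : 0 < ρ) (a : ℝ) :
    ρ ^ (N - 1) * ρ ^ a = ρ ^ (a + N - 1) := by
  rw [← Real.rpow_natCast, ← Real.rpow_add hρ, Nat.cast_sub hN]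
  congr 1
  push_cast
  ring

theorem integrable_rpow_radMeasure (hN : 1 ≤ N) {a : ℝ} (ha : 0 < a + N) :
    Integrable (fun ρ => ρ ^ a) (radMeasure N R) := by
  rw [integrable_radMeasure_iff]
  rcases le_or_gt R 0 with hR | hR
  · simp [Ioo_eq_empty (not_lt.2 hR)]
  refine (integrableOn_congr_fun (fun ρ hρ => ?_) measurableSet_Ioo).2
    ((intervalIntegral.integrableOn_Ioo_rpow_iff hR (s := a + N - 1)).2 (by linarith))
  exact pow_pred_mul_rpow hN hρ.1 a

end RadMeasure

/-- `k` is a feature map whose Gram kernel is the radial Green function. -/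
def IsRadKernel {H : Type*} [NormedAddCommGroup H] [InnerProductSpace ℝ H]
    (N : ℕ) (R : ℝ) (k : ℝ → H) : Prop :=
  ∀ r ∈ Ioc 0 R, ∀ s ∈ Ioc 0 R, ⟪k r, k s⟫ = radGreen N R (max r s)

/-- The indicator functions of `(0, Γ r)` in `L²(ℝ)`. -/
def radKernel (N : ℕ) (R r : ℝ) : Lp ℝ 2 (volume : Measure ℝ) :=
  indicatorConstLp 2 (measurableSet_Ioo (a := 0) (b := radGreen N R r)) (by simp) 1

theorem isRadKernel_radKernel {N : ℕ} {R : ℝ} (hR : 0 < R) :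
    IsRadKernel N R (radKernel N R) := by
  intro r hr s hs
  have hmax : radGreen N R (max r s) = min (radGreen N R r) (radGreen N R s) := by
    rcases le_total r s with h | h
    · rw [max_eq_right h, min_eq_right (radGreen_anti hR hr.1 h)]
    · rw [max_eq_left h, min_eq_left (radGreen_anti hR hs.1 h)]
  have h0 : 0 ≤ radGreen N R (max r s) :=
    radGreen_nonneg (lt_max_of_lt_left hr.1) (max_le hr.2 hs.2)
  refine (L2.real_inner_indicatorConstLp_one_indicatorConstLp_one measurableSet_Ioo
    measurableSet_Ioo (by simp) (by simp)).trans ?_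
  rw [Ioo_inter_Ioo, max_self, ← hmax, measureReal_def, Real.volume_Ioo, sub_zero,
    ENNReal.toReal_ofReal h0]

namespace IsRadKernel

variable {H : Type*} [NormedAddCommGroup H] [InnerProductSpace ℝ H]
  {N : ℕ} {R : ℝ} {k : ℝ → H}

theorem norm_sq (K : IsRadKernel N R k) {r : ℝ} (hr : r ∈ Ioc 0 R) :
    ‖k r‖ ^ 2 = radGreen N R r := by
  rw [← real_inner_self_eq_norm_sq, K r hr r hr, max_self]

theorem norm_sub_sq (K : IsRadKernel N R k) (hR : 0 < R) {r s : ℝ} (hr : r ∈ Ioc 0 R)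
    (hs : s ∈ Ioc 0 R) : ‖k r - k s‖ ^ 2 = |radGreen N R r - radGreen N R s| := by
  rw [norm_sub_sq_real, K.norm_sq hr, K.norm_sq hs, K r hr s hs]
  rcases le_total r s with h | h
  · have := radGreen_anti (N := N) hR hr.1 h
    rw [max_eq_right h, abs_of_nonneg (by linarith)]; ring
  · have := radGreen_anti (N := N) hR hs.1 h
    rw [max_eq_left h, abs_of_nonpos (by linarith)]; ring

theorem right_eq_zero (K : IsRadKernel N R k) (hR : 0 < R) : k R = 0 := by
  have := K.norm_sq ⟨hR, le_rfl⟩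
  rw [radGreen_self] at this
  simpa using this

theorem continuousOn (K : IsRadKernel N R k) (hR : 0 < R) : ContinuousOn k (Ioc 0 R) := by
  intro r hr
  refine tendsto_iff_norm_sub_tendsto_zero.2 ?_
  have h1 : Tendsto (fun s => Real.sqrt |radGreen N R s - radGreen N R r|) (𝓝[Ioc 0 R] r)
      (𝓝 0) := by
    have hc : ContinuousWithinAt (radGreen N R) (Ioc 0 R) r :=
      (continuousOn_radGreen hR r hr.1).mono fun x hx => hx.1
    have := ((hc.tendsto.sub_const (radGreen N R r)).abs).sqrt
    simpa using this
  refine h1.congr' ?_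
  filter_upwards [self_mem_nhdsWithin] with s hs
  rw [← K.norm_sub_sq hR hs hr, Real.sqrt_sq (norm_nonneg _)]

theorem continuousOn_inner (K : IsRadKernel N R k) (hR : 0 < R) (w : H) :
    ContinuousOn (fun r => ⟪k r, w⟫) (Ioc 0 R) :=
  (K.continuousOn hR).inner continuousOn_const

theorem inner_sub_sq_le (K : IsRadKernel N R k) (hR : 0 < R) {r s : ℝ} (hr : 0 < r) (hrs : r ≤ s)
    (hsR : s ≤ R) (w : H) :
    (⟪k r, w⟫ - ⟪k s, w⟫) ^ 2 ≤ ‖w‖ ^ 2 * ((r ^ (N - 1))⁻¹ * (s - r)) := by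
  have hr' : r ∈ Ioc 0 R := ⟨hr, hrs.trans hsR⟩
  have hs' : s ∈ Ioc 0 R := ⟨hr.trans_le hrs, hsR⟩
  calc (⟪k r, w⟫ - ⟪k s, w⟫) ^ 2 ≤ (‖k r - k s‖ * ‖w‖) ^ 2 := by
        rw [← inner_sub_left, ← sq_abs]
        gcongr
        exact abs_real_inner_le_norm _ _
    _ = ‖w‖ ^ 2 * |radGreen N R r - radGreen N R s| := by
        rw [mul_pow, K.norm_sub_sq hR hr' hs', mul_comm]
    _ ≤ _ := by
        gcongr
        rw [abs_of_nonneg (sub_nonneg.2 (radGreen_anti hR hr hrs))]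
        exact radGreen_sub_le hR hr hrs

end IsRadKernel

theorem exists_growth_exponent {n p : ℝ} (hn : 2 ≤ n) (hp2 : 2 < p) (hp : p < 2 + 4 / n) :
    ∃ α : ℝ, 0 < α ∧ n - 2 < α ∧ α < n ∧ p - 2 < n - p * α / 2 ∧
      2 * (α - (n - 2)) < 2 - α * (p - 2) / 2 := by
  have hn0 : 0 < n := by linarith
  have hq : n * (p - 2) < 4 := by
    have : p - 2 < 4 / n := by linarith
    rwa [lt_div_iff₀ hn0, mul_comm] at this
  set ε : ℝ := min ((p - 2) / 2) ((2 - n * (p - 2) / 2) / p)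
  have hp0 : 0 < p := by linarith
  have hε : 0 < ε := lt_min (by linarith) (div_pos (by linarith) hp0)
  have h1 : ε ≤ (p - 2) / 2 := min_le_left _ _
  have h2 : ε * p ≤ 2 - n * (p - 2) / 2 := by
    rw [← le_div_iff₀ hp0]; exact min_le_right _ _
  have h3 : 0 < ε * p := by positivity
  refine ⟨n - 2 + ε, by linarith, by linarith, ?_, by nlinarith, by nlinarith⟩
  nlinarith

theorem eventually_rpow_add_rpow_le {a b A B K : ℝ} (ha : a < 2) (hb : b < 2) (hK : 0 < K) :
    ∀ᶠ L : ℝ in atTop, A * L ^ a + B * L ^ b ≤ K * L ^ 2 := by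
  have h : Tendsto (fun L : ℝ => A * L ^ (-(2 - a)) + B * L ^ (-(2 - b))) atTop (𝓝 0) := by
    simpa using ((tendsto_rpow_neg_atTop (sub_pos.2 ha)).const_mul A).add
      ((tendsto_rpow_neg_atTop (sub_pos.2 hb)).const_mul B)
  filter_upwards [h.eventually_le_const hK, eventually_gt_atTop 0] with L hL h0
  have key : ∀ e : ℝ, L ^ (-(2 - e)) * L ^ 2 = L ^ e := fun e => by
    rw [← Real.rpow_natCast, ← Real.rpow_add h0]
    congr 1
    push_cast
    ring
  calc A * L ^ a + B * L ^ b = (A * L ^ (-(2 - a)) + B * L ^ (-(2 - b))) * L ^ 2 := by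
        rw [add_mul, mul_assoc, mul_assoc, key, key]
    _ ≤ K * L ^ 2 := by gcongr

namespace IsRadKernel

variable {H : Type*} [NormedAddCommGroup H] [InnerProductSpace ℝ H]
  {N : ℕ} {R p α M : ℝ} {k : ℝ → H} {h : ℝ → ℝ}

theorem norm_le_rpow (K : IsRadKernel N R k) (hN : 2 ≤ N) (hα : 0 < α) (hαN : (N : ℝ) - 2 < α)
    {r : ℝ} (hr : r ∈ Ioc 0 R) : ‖k r‖ ≤ Real.sqrt (R ^ (α + 2 - N) / α) * r ^ (-α / 2) := by
  have hr0 := hr.1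
  have hR : 0 < R := hr.1.trans_le hr.2
  refine abs_le_of_sq_le_sq' ?_ (by positivity) |>.2
  rw [K.norm_sq hr, mul_pow, Real.sq_sqrt (by positivity), ← Real.rpow_natCast,
    ← Real.rpow_mul hr0.le]
  have := radGreen_le_rpow hN hr.1 hr.2 hα hαN.le
  rwa [show -α / 2 * ((2 : ℕ) : ℝ) = -α by push_cast; ring]

theorem isAdmissible (K : IsRadKernel N R k) (hN : 2 ≤ N) (hR : 0 < R) (hp : 2 < p)
    (hα : 0 < α) (hαN : (N : ℝ) - 2 < α) (hαN' : α < N) (hpα : p - 2 < N - p * α / 2)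
    (hc : ContinuousOn h (Ioo 0 R)) (h0 : ∀ r ∈ Ioo 0 R, 0 ≤ h r) (hM : ∀ r ∈ Ioo 0 R, h r ≤ M)
    (hM0 : 0 ≤ M) :
    IsAdmissible (radMeasure N R) k h p
      (fun r => Real.sqrt (R ^ (α + 2 - N) / α) * r ^ (-α / 2)) M where
  two_lt := hp
  meas_k w := aestronglyMeasurable_radMeasure
    ((K.continuousOn_inner hR w).mono Ioo_subset_Ioc_self)
  le_B := ae_radMeasure.mono fun r hr => K.norm_le_rpow hN hα hαN ⟨hr.1, hr.2.le⟩
  int_B2 := by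
    refine ((integrable_rpow_radMeasure (N := N) (R := R) (by omega) (a := -α)
      (by linarith)).const_mul (Real.sqrt (R ^ (α + 2 - N) / α) ^ 2)).congr ?_
    filter_upwards [ae_radMeasure] with r hr
    rw [mul_pow, ← Real.rpow_natCast (r ^ _), ← Real.rpow_mul hr.1.le]
    congr 2
    push_cast
    ring
  int_Bp := by
    refine ((integrable_rpow_radMeasure (N := N) (R := R) (by omega) (a := -α / 2 * p)
      (by linarith)).const_mul (Real.sqrt (R ^ (α + 2 - N) / α) ^ p)).congr ?_
    filter_upwards [ae_radMeasure] with r hr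
    have := hr.1
    rw [Real.mul_rpow (by positivity) (by positivity), ← Real.rpow_mul hr.1.le]
  meas_g := aestronglyMeasurable_radMeasure hc
  g_nonneg := ae_radMeasure.mono h0
  g_le := ae_radMeasure.mono hM
  M_nonneg := hM0

theorem inner_pow_four_le (K : IsRadKernel N R k) (hR : 0 < R) {w : H}
    (hint : Integrable (fun r => ⟪k r, w⟫ ^ 2) (radMeasure N R)) {r : ℝ} (hr : r ∈ Ioo 0 R) :
    |⟪k r, w⟫| ^ 4 * (r ^ (N - 1)) ^ 2 ≤ 16 * massF (radMeasure N R) k w * ‖w‖ ^ 2 := by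
  have hr0 := hr.1
  set m := |⟪k r, w⟫| with hm
  have hm0 : 0 ≤ m := abs_nonneg _
  set L := ‖w‖
  set P := r ^ (N - 1) with hP
  have hP0 : 0 < P := by positivity
  rcases (norm_nonneg w).eq_or_lt with hL | hL
  · have : w = 0 := norm_eq_zero.1 hL.symm
    simp [hm, L, this]
  have hLne : L ≠ 0 := hL.ne'
  set δ := m ^ 2 * P / (4 * L ^ 2) with hδ
  have hδ0 : 0 ≤ δ := by positivity
  have h1 : m ^ 2 ≤ L ^ 2 * (P⁻¹ * (R - r)) := by
    have := K.inner_sub_sq_le hR hr0 hr.2.le le_rfl w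
    rwa [K.right_eq_zero hR, inner_zero_left, sub_zero, ← sq_abs] at this
  have hδR : r + δ ≤ R := by
    have : δ ≤ (R - r) / 4 := by
      rw [hδ, div_le_iff₀ (by positivity)]
      calc m ^ 2 * P ≤ L ^ 2 * (P⁻¹ * (R - r)) * P := by gcongr
        _ = _ := by field_simp
    have := hr.2
    linarith
  have h2 : ∀ s ∈ Ioo r (r + δ), m ^ 2 / 4 * P ≤ s ^ (N - 1) * ⟪k s, w⟫ ^ 2 := by
    intro s hs
    have h3 : (⟪k r, w⟫ - ⟪k s, w⟫) ^ 2 ≤ (m / 2) ^ 2 := by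
      refine (K.inner_sub_sq_le hR hr0 hs.1.le (hs.2.le.trans hδR) w).trans ?_
      calc L ^ 2 * (P⁻¹ * (s - r)) ≤ L ^ 2 * (P⁻¹ * δ) := by
            have : s - r ≤ δ := by linarith [hs.2]
            gcongr
        _ = (m / 2) ^ 2 := by rw [hδ]; field_simp; norm_num
    have h4 := abs_le_of_sq_le_sq h3 (by positivity)
    have h5 : m / 2 ≤ |⟪k s, w⟫| := by
      have := abs_sub_abs_le_abs_sub ⟪k r, w⟫ ⟪k s, w⟫
      linarith
    calc m ^ 2 / 4 * P = P * (m / 2) ^ 2 := by ring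
      _ ≤ s ^ (N - 1) * |⟪k s, w⟫| ^ 2 := by
          have := hs.1.le
          rw [hP]
          have := hr0.trans hs.1
          gcongr
      _ = _ := by rw [sq_abs]
  have h6 : m ^ 2 / 4 * P * δ ≤ massF (radMeasure N R) k w := by
    rw [massF, integral_radMeasure]
    have hsub : Ioo r (r + δ) ⊆ Ioo 0 R := fun s hs => ⟨hr0.trans hs.1, hs.2.trans_le hδR⟩
    have hint' := integrable_radMeasure_iff.1 hint
    calc m ^ 2 / 4 * P * δ = ∫ s in Ioo r (r + δ), m ^ 2 / 4 * P := by
          simp [hδ0, mul_comm]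
      _ ≤ ∫ s in Ioo r (r + δ), s ^ (N - 1) * ⟪k s, w⟫ ^ 2 :=
          setIntegral_mono_on (integrableOn_const (by simp)) (hint'.mono_set hsub) measurableSet_Ioo h2
      _ ≤ _ := by
          refine setIntegral_mono_set hint' ?_ hsub.eventuallyLE
          refine (ae_restrict_iff' measurableSet_Ioo).2 (ae_of_all _ fun s hs => ?_)
          have := hs.1
          show 0 ≤ s ^ (N - 1) * ⟪k s, w⟫ ^ 2
          positivity
  calc m ^ 4 * P ^ 2 = 16 * (m ^ 2 / 4 * P * δ) * L ^ 2 := by rw [hδ]; field_simp; norm_num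
    _ ≤ _ := by gcongr

theorem abs_inner_rpow_le (K : IsRadKernel N R k) (hN : 2 ≤ N) (hR : 0 < R) (hp : 2 < p)
    (hα : 0 < α) (hαN : (N : ℝ) - 2 < α) {τ : ℝ} (hτ : 0 ≤ τ) {w : H} (hw : 0 < ‖w‖)
    (hint : Integrable (fun r => ⟪k r, w⟫ ^ 2) (radMeasure N R)) {r : ℝ} (hr : r ∈ Ioo 0 R) :
    |⟪k r, w⟫| ^ p ≤
      Real.sqrt (R ^ (α + 2 - N) / α) ^ p * ‖w‖ ^ (p - τ) * r ^ (-α / 2 * p - τ) +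
      (16 * massF (radMeasure N R) k w) ^ ((p - 2) / 4) * ‖w‖ ^ (N * (p - 2) / 2) *
        ⟪k r, w⟫ ^ 2 := by
  have hr0 := hr.1
  have hmass : 0 ≤ massF (radMeasure N R) k w := integral_nonneg fun _ => sq_nonneg _
  set m := |⟪k r, w⟫| with hm
  have hm0 : 0 ≤ m := abs_nonneg _
  set L := ‖w‖
  set S := Real.sqrt (R ^ (α + 2 - N) / α)
  have hS : 0 ≤ S := Real.sqrt_nonneg _
  rcases le_total (r * L) 1 with hrL | hrL
  · refine le_add_of_le_of_nonneg ?_ (by positivity)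
    have h1 : m ≤ S * r ^ (-α / 2) * L :=
      (abs_real_inner_le_norm _ _).trans (by
        gcongr; exact K.norm_le_rpow hN hα hαN ⟨hr.1, hr.2.le⟩)
    calc m ^ p ≤ (S * r ^ (-α / 2) * L) ^ p := by gcongr
      _ = S ^ p * L ^ p * r ^ (-α / 2 * p) * 1 := by
          rw [Real.mul_rpow (by positivity) hw.le, Real.mul_rpow hS (by positivity),
            ← Real.rpow_mul hr0.le]
          ring
      _ ≤ S ^ p * L ^ p * r ^ (-α / 2 * p) * (r * L) ^ (-τ) := by
          gcongr
          exact Real.one_le_rpow_of_pos_of_le_one_of_nonpos (by positivity) hrL (by linarith)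
      _ = _ := by
          rw [Real.mul_rpow hr0.le hw.le, sub_eq_add_neg, Real.rpow_add hw, sub_eq_add_neg,
            Real.rpow_add hr0]
          ring
  · refine le_add_of_nonneg_of_le (by positivity) ?_
    have h1 : m ^ 4 ≤ 16 * massF (radMeasure N R) k w * L ^ (2 * N : ℝ) := by
      have h2 := K.inner_pow_four_le hR hint hr
      have h3 : 1 ≤ (r ^ (N - 1)) ^ 2 * (L ^ (N - 1)) ^ 2 := by
        rw [← mul_pow, ← mul_pow]
        exact one_le_pow₀ (one_le_pow₀ hrL)
      have h4 : L ^ (2 * N : ℝ) = L ^ 2 * (L ^ (N - 1)) ^ 2 := by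
        rw [← pow_mul, ← pow_add, ← Real.rpow_natCast]
        congr 1
        have : (2 + (N - 1) * 2 : ℕ) = 2 * N := by omega
        rw [this]
        push_cast
        ring
      calc m ^ 4 = m ^ 4 * 1 := (mul_one _).symm
        _ ≤ m ^ 4 * ((r ^ (N - 1)) ^ 2 * (L ^ (N - 1)) ^ 2) := by gcongr
        _ = m ^ 4 * (r ^ (N - 1)) ^ 2 * (L ^ (N - 1)) ^ 2 := by ring
        _ ≤ 16 * massF (radMeasure N R) k w * L ^ 2 * (L ^ (N - 1)) ^ 2 := by gcongr
        _ = _ := by rw [h4]; ring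
    calc m ^ p = (m ^ 4) ^ ((p - 2) / 4) * m ^ 2 := by
          rw [← Real.rpow_natCast m 4, ← Real.rpow_mul hm0, ← Real.rpow_natCast m 2,
            ← Real.rpow_add' hm0 (by push_cast; linarith)]
          congr 1
          push_cast
          ring
      _ ≤ (16 * massF (radMeasure N R) k w * L ^ (2 * N : ℝ)) ^ ((p - 2) / 4) * m ^ 2 := by
          gcongr
      _ = _ := by
          rw [Real.mul_rpow (by positivity) (by positivity), ← Real.rpow_mul hw.le, hm, sq_abs]
          ring_nf

theorem coercive (K : IsRadKernel N R k) (hN : 2 ≤ N) (hR : 0 < R) (hp : 2 < p)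
    (hpN : p < 2 + 4 / (N : ℝ))
    (hα : 0 < α) (hαN : (N : ℝ) - 2 < α) (hαN' : α < N) (hpα : p - 2 < N - p * α / 2)
    (hc : ContinuousOn h (Ioo 0 R)) (h0 : ∀ r ∈ Ioo 0 R, 0 ≤ h r) (hM : ∀ r ∈ Ioo 0 R, h r ≤ M)
    (hM0 : 0 ≤ M) (c : ℝ) :
    ∃ L₀ : ℝ, ∀ w, massF (radMeasure N R) k w = c → L₀ ≤ ‖w‖ →
      potF (radMeasure N R) k h p w / p ≤ ‖w‖ ^ 2 / 4 := by
  have A := K.isAdmissible hN hR hp hα hαN hαN' hpα hc h0 hM hM0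
  obtain ⟨τ, hτ1, hτ2⟩ := exists_between hpα
  set S := Real.sqrt (R ^ (α + 2 - N) / α)
  have hN0 : (0 : ℝ) < N := by positivity
  have hb : N * (p - 2) / 2 < 2 := by
    have : p - 2 < 4 / N := by linarith
    rw [lt_div_iff₀ hN0] at this
    linarith
  have hI := integrable_rpow_radMeasure (N := N) (R := R) (by omega) (a := -α / 2 * p - τ)
    (by linarith)
  have hev := eventually_rpow_add_rpow_le (a := p - τ) (b := N * (p - 2) / 2)
    (A := M * (S ^ p * ∫ r, r ^ (-α / 2 * p - τ) ∂radMeasure N R))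
    (B := M * ((16 * c) ^ ((p - 2) / 4) * c)) (K := p / 4) (by linarith) hb (by linarith)
  obtain ⟨L₁, hL₁⟩ := eventually_atTop.1 hev
  refine ⟨max L₁ 1, fun w hw hL => ?_⟩
  have hL0 : 0 < ‖w‖ := zero_lt_one.trans_le ((le_max_right _ _).trans hL)
  have hL1 := hL₁ _ ((le_max_left _ _).trans hL)
  rw [div_le_iff₀ (by linarith)]
  have hsq := A.integrable_sq w
  calc potF (radMeasure N R) k h p w
      ≤ ∫ r, M * (S ^ p * ‖w‖ ^ (p - τ) * r ^ (-α / 2 * p - τ) +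
        (16 * c) ^ ((p - 2) / 4) * ‖w‖ ^ (N * (p - 2) / 2) * ⟪k r, w⟫ ^ 2) ∂radMeasure N R := by
        refine integral_mono_ae (A.integrable_pot w)
          (((hI.const_mul _).add (hsq.const_mul _)).const_mul _) ?_
        filter_upwards [ae_radMeasure] with r hr
        have := K.abs_inner_rpow_le hN hR hp hα hαN (τ := τ) (by linarith) hL0 hsq hr
        rw [hw] at this
        exact mul_le_mul (hM r hr) this (by positivity) hM0
    _ = M * (S ^ p * ∫ r, r ^ (-α / 2 * p - τ) ∂radMeasure N R) * ‖w‖ ^ (p - τ) +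
        M * ((16 * c) ^ ((p - 2) / 4) * c) * ‖w‖ ^ (N * (p - 2) / 2) := by
        rw [integral_const_mul, integral_add (hI.const_mul _) (hsq.const_mul _),
          integral_const_mul, integral_const_mul]
        have : ∫ r, ⟪k r, w⟫ ^ 2 ∂radMeasure N R = c := hw
        rw [this]
        ring
    _ ≤ p / 4 * ‖w‖ ^ 2 := hL1
    _ = _ := by ring

theorem exists_mass_eq (K : IsRadKernel N R k) (hR : 0 < R)
    (hint : ∀ w, Integrable (fun r => ⟪k r, w⟫ ^ 2) (radMeasure N R)) {c : ℝ} (hc : 0 < c) :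
    ∃ w, massF (radMeasure N R) k w = c := by
  have hmid : R / 2 ∈ Ioo 0 R := ⟨by linarith, by linarith⟩
  have hpos : 0 < massF (radMeasure N R) k (k (R / 2)) := by
    have h1 := K.inner_pow_four_le hR (hint (k (R / 2))) hmid
    have h2 : 0 < ⟪k (R / 2), k (R / 2)⟫ := by
      rw [K _ (Ioo_subset_Ioc_self hmid) _ (Ioo_subset_Ioc_self hmid), max_self]
      exact radGreen_pos hmid.1 hmid.2
    by_contra hneg
    have h3 : 0 < |⟪k (R / 2), k (R / 2)⟫| ^ 4 * ((R / 2) ^ (N - 1)) ^ 2 := by positivity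
    have h4 : 16 * massF (radMeasure N R) k (k (R / 2)) * ‖k (R / 2)‖ ^ 2 ≤ 0 :=
      mul_nonpos_of_nonpos_of_nonneg (by linarith) (by positivity)
    linarith
  set m := massF (radMeasure N R) k (k (R / 2)) with hm
  refine ⟨Real.sqrt (c / m) • k (R / 2), ?_⟩
  have : ∀ r, ⟪k r, Real.sqrt (c / m) • k (R / 2)⟫ ^ 2 = c / m * ⟪k r, k (R / 2)⟫ ^ 2 := by
    intro r
    rw [real_inner_smul_right, mul_pow, Real.sq_sqrt (by positivity)]
  simp only [massF, this, integral_const_mul]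
  rw [← massF, ← hm]
  field_simp

end IsRadKernel

/-- The right-hand side `h |u|^(p-2) u - lam u` of the equation `-Δ u = h |u|^(p-2) u - lam u`. -/
def schrodingerRHS (h : ℝ → ℝ) (p lam : ℝ) (u : ℝ → ℝ) (ρ : ℝ) : ℝ :=
  h ρ * (|u ρ| ^ (p - 2) * u ρ) - lam * u ρ

theorem abs_schrodingerRHS_le {h u : ℝ → ℝ} {p lam M ρ : ℝ} (h0 : 0 ≤ h ρ) (hM : h ρ ≤ M) :
    |schrodingerRHS h p lam u ρ| ≤ (M * |u ρ| ^ (p - 2) + |lam|) * |u ρ| := by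
  have h1 : 0 ≤ |u ρ| ^ (p - 2) := by positivity
  calc |schrodingerRHS h p lam u ρ| ≤ |h ρ * (|u ρ| ^ (p - 2) * u ρ)| + |lam * u ρ| := abs_sub _ _
    _ = (h ρ * |u ρ| ^ (p - 2) + |lam|) * |u ρ| := by
        rw [abs_mul, abs_mul, abs_mul, abs_of_nonneg h0, abs_of_nonneg h1]; ring
    _ ≤ _ := by gcongr

theorem continuousOn_schrodingerRHS {h u : ℝ → ℝ} {p lam : ℝ} {s : Set ℝ} (hp : 2 < p)
    (hh : ContinuousOn h s) (hu : ContinuousOn u s) :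
    ContinuousOn (schrodingerRHS h p lam u) s :=
  (hh.mul ((hu.abs.rpow_const fun _ _ => Or.inr (by linarith)).mul hu)).sub
    (continuousOn_const.mul hu)

/-- One step of the decay improvement for solutions of `u = G f` with `|f| ≤ C ρ^(η-2) |u|`. -/
theorem green_bootstrap_step {N : ℕ} {R α η C γ D : ℝ} {u f : ℝ → ℝ} (hN : 2 ≤ N) (hα : 0 < α)
    (hαN : (N : ℝ) - 2 < α) (hη : 2 * (α - (N - 2)) < η) (hC : 0 ≤ C)
    (hu : ∀ r ∈ Ioo 0 R, u r = greenOp N R f r)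
    (hf : ∀ r ∈ Ioo 0 R, |f r| ≤ C * r ^ (η - 2) * |u r|) (hγα : γ ≤ α)
    (hD : ∀ r ∈ Ioo 0 R, |u r| ≤ D * r ^ (-γ)) :
    ∃ D', ∀ r ∈ Ioo 0 R, |u r| ≤ D' * r ^ (-max 0 (γ - η / 2)) := by
  set σ := max 0 (γ - η / 2) with hσ
  have hσ0 : 0 ≤ σ := le_max_left _ _
  have hσ1 : γ - η / 2 ≤ σ := le_max_right _ _
  have hσα : σ ≤ α := max_le hα.le (by linarith)
  set A := R ^ (α + 2 - N) / α
  set e := -(α - σ) + (η - 2) - γ with he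
  have hI : IntegrableOn (fun ρ : ℝ => ρ ^ (N - 1) * ρ ^ e) (Ioo 0 R) :=
    integrable_radMeasure_iff.1
      (integrable_rpow_radMeasure (N := N) (R := R) (by omega) (a := e) (by linarith))
  refine ⟨A * C * D * ∫ ρ in Ioo 0 R, ρ ^ (N - 1) * ρ ^ e, fun r hr => ?_⟩
  have hr0 := hr.1
  rw [hu r hr, greenOp]
  have hA : 0 ≤ A := by
    have : 0 < R := hr.1.trans hr.2
    positivity
  calc |∫ ρ in Ioo 0 R, ρ ^ (N - 1) * (radGreen N R (max r ρ) * f ρ)|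
      ≤ ∫ ρ in Ioo 0 R, A * C * D * r ^ (-σ) * (ρ ^ (N - 1) * ρ ^ e) := by
        rw [← Real.norm_eq_abs]
        refine norm_integral_le_of_norm_le (hI.const_mul _) ?_
        refine (ae_restrict_iff' measurableSet_Ioo).2 (ae_of_all _ fun ρ hρ => ?_)
        have hρ0 := hρ.1
        have hmax : 0 < max r ρ := lt_max_of_lt_left hr0
        have hmaxR : max r ρ ≤ R := max_le hr.2.le hρ.2.le
        have hG0 := radGreen_nonneg (N := N) hmax hmaxR
        have hG : radGreen N R (max r ρ) ≤ A * (r ^ (-σ) * ρ ^ (-(α - σ))) := by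
          refine (radGreen_le_rpow hN hmax hmaxR hα hαN.le).trans ?_
          have : (max r ρ) ^ (-α) = (max r ρ) ^ (-σ) * (max r ρ) ^ (-(α - σ)) := by
            rw [← Real.rpow_add hmax]; congr 1; ring
          rw [this]
          refine mul_le_mul_of_nonneg_left (mul_le_mul ?_ ?_ (by positivity) (by positivity)) hA
          · exact Real.rpow_le_rpow_of_nonpos hr0 (le_max_left _ _) (by linarith)
          · exact Real.rpow_le_rpow_of_nonpos hρ0 (le_max_right _ _) (by linarith)
        rw [Real.norm_eq_abs, abs_mul, abs_mul, abs_of_nonneg hG0,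
          abs_of_nonneg (by positivity : 0 ≤ ρ ^ (N - 1))]
        have hsplit : ρ ^ e = ρ ^ (-(α - σ)) * ρ ^ (η - 2) * ρ ^ (-γ) := by
          rw [← Real.rpow_add hρ0, ← Real.rpow_add hρ0]; congr 1
        calc ρ ^ (N - 1) * (radGreen N R (max r ρ) * |f ρ|)
            ≤ ρ ^ (N - 1) * ((A * (r ^ (-σ) * ρ ^ (-(α - σ)))) *
              (C * ρ ^ (η - 2) * (D * ρ ^ (-γ)))) := by
              gcongr
              exact (hf ρ hρ).trans (by gcongr; exact hD ρ hρ)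
          _ = _ := by rw [hsplit]; ring
    _ = _ := by rw [integral_const_mul]; ring

theorem green_bootstrap {N : ℕ} {R α η C D : ℝ} {u f : ℝ → ℝ} (hN : 2 ≤ N) (hα : 0 < α)
    (hαN : (N : ℝ) - 2 < α) (hη : 2 * (α - (N - 2)) < η) (hC : 0 ≤ C)
    (hu : ∀ r ∈ Ioo 0 R, u r = greenOp N R f r)
    (hf : ∀ r ∈ Ioo 0 R, |f r| ≤ C * r ^ (η - 2) * |u r|)
    (hD : ∀ r ∈ Ioo 0 R, |u r| ≤ D * r ^ (-α / 2)) :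
    ∃ D', ∀ r ∈ Ioo 0 R, |u r| ≤ D' := by
  have hη0 : 0 < η := by linarith
  have key : ∀ n : ℕ, ∃ D', ∀ r ∈ Ioo 0 R, |u r| ≤ D' * r ^ (-max 0 (α / 2 - n * (η / 2))) := by
    intro n
    induction n with
    | zero =>
      refine ⟨D, fun r hr => (hD r hr).trans (le_of_eq ?_)⟩
      congr 2
      rw [Nat.cast_zero, zero_mul, sub_zero, max_eq_right (by positivity)]
      ring
    | succ n ih =>
      obtain ⟨D₁, hD₁⟩ := ih
      obtain ⟨D₂, hD₂⟩ := green_bootstrap_step hN hα hαN hη hC hu hf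
        (max_le hα.le (by have : 0 ≤ n * (η / 2) := by positivity
                          linarith)) hD₁
      refine ⟨D₂, fun r hr => (hD₂ r hr).trans (le_of_eq ?_)⟩
      congr 3
      push_cast
      rcases le_total 0 (α / 2 - n * (η / 2)) with h | h
      · rw [max_eq_right h]; congr 1; ring
      · rw [max_eq_left h, max_eq_left (by linarith), max_eq_left (by linarith)]
  obtain ⟨n, hn⟩ := exists_nat_ge (α / η)
  obtain ⟨D', hD'⟩ := key n
  refine ⟨D', fun r hr => (hD' r hr).trans (le_of_eq ?_)⟩
  rw [div_le_iff₀ hη0] at hn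
  rw [max_eq_left (by linarith)]
  simp

namespace IsRadKernel

variable {H : Type*} [NormedAddCommGroup H] [InnerProductSpace ℝ H]
  {N : ℕ} {R p α M c : ℝ} {k : ℝ → H} {h B : ℝ → ℝ}

theorem green_representation (K : IsRadKernel N R k)
    (A : IsAdmissible (radMeasure N R) k h p B M) (hc : 0 < c) {w : H}
    (hw : massF (radMeasure N R) k w = c)
    (hmin : ∀ v, massF (radMeasure N R) k v = c →
      energyF (radMeasure N R) k h p w ≤ energyF (radMeasure N R) k h p v)
    {r : ℝ} (hr : r ∈ Ioc 0 R) :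
    ⟪k r, w⟫ = greenOp N R (schrodingerRHS h p
      ((potF (radMeasure N R) k h p w - ‖w‖ ^ 2) / c) fun ρ => ⟪k ρ, w⟫) r := by
  have h1 := A.euler_lagrange hc hw hmin (k r)
  set lam := (potF (radMeasure N R) k h p w - ‖w‖ ^ 2) / c
  have h2 : greenOp N R (schrodingerRHS h p lam fun ρ => ⟪k ρ, w⟫) r =
      ∫ ρ, (h ρ * (|⟪k ρ, w⟫| ^ (p - 2) * ⟪k ρ, w⟫) * ⟪k ρ, k r⟫ -
        lam * (⟪k ρ, w⟫ * ⟪k ρ, k r⟫)) ∂radMeasure N R := by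
    rw [greenOp, integral_radMeasure]
    refine setIntegral_congr_fun measurableSet_Ioo fun ρ hρ => ?_
    simp only [schrodingerRHS]
    rw [K ρ (Ioo_subset_Ioc_self hρ) r hr, max_comm]
    ring
  rw [h2, integral_sub (A.integrable_nonlin w (k r)) ((A.integrable_mul w (k r)).const_mul lam),
    integral_const_mul, ← h1, real_inner_comm]
  ring

theorem exists_bound (K : IsRadKernel N R k) (hN : 2 ≤ N) (hp : 2 < p)
    (hα : 0 < α) (hαN : (N : ℝ) - 2 < α) (hη : 2 * (α - (N - 2)) < 2 - α * (p - 2) / 2)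
    (h0 : ∀ r ∈ Ioo 0 R, 0 ≤ h r) (hM : ∀ r ∈ Ioo 0 R, h r ≤ M) (hM0 : 0 ≤ M) {w : H} {lam : ℝ}
    (hu : ∀ r ∈ Ioo 0 R, ⟪k r, w⟫ =
      greenOp N R (schrodingerRHS h p lam fun ρ => ⟪k ρ, w⟫) r) :
    ∃ D, ∀ r ∈ Ioo 0 R, |⟪k r, w⟫| ≤ D := by
  set S := Real.sqrt (R ^ (α + 2 - N) / α)
  have hS : 0 ≤ S := Real.sqrt_nonneg _
  have hbd : ∀ r ∈ Ioo 0 R, |⟪k r, w⟫| ≤ ‖w‖ * S * r ^ (-α / 2) := fun r hr => by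
    have := IsAdmissible.abs_inner_le (B := fun r => S * r ^ (-α / 2))
      (K.norm_le_rpow hN hα hαN ⟨hr.1, hr.2.le⟩) w
    rwa [← mul_assoc] at this
  rcases le_or_gt R 0 with hR | hR
  · exact ⟨0, fun r hr => absurd (hr.1.trans hr.2) (not_lt.2 hR)⟩
  refine green_bootstrap (η := 2 - α * (p - 2) / 2)
    (C := M * (‖w‖ * S) ^ (p - 2) + |lam| * R ^ (α * (p - 2) / 2))
    hN hα hαN hη (by positivity) hu (fun r hr => ?_) hbd
  have hr0 := hr.1
  have hp' : 0 ≤ p - 2 := by linarith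
  refine (abs_schrodingerRHS_le (h0 r hr) (hM r hr)).trans ?_
  refine mul_le_mul_of_nonneg_right ?_ (abs_nonneg _)
  rw [add_mul]
  refine add_le_add ?_ ?_
  · rw [mul_assoc]
    gcongr
    calc |⟪k r, w⟫| ^ (p - 2) ≤ (‖w‖ * S * r ^ (-α / 2)) ^ (p - 2) := by
          gcongr; exact hbd r hr
      _ = _ := by
          rw [Real.mul_rpow (by positivity) (by positivity), ← Real.rpow_mul hr0.le]
          congr 2
          ring
  · have h1 : r ^ (2 - α * (p - 2) / 2 - 2) = (r ^ (α * (p - 2) / 2))⁻¹ := by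
      rw [← Real.rpow_neg hr0.le]; congr 1; ring
    rw [h1, mul_assoc]
    refine le_mul_of_one_le_right (abs_nonneg _) ?_
    rw [← div_eq_mul_inv, one_le_div (by positivity)]
    have := hr.2.le
    gcongr

end IsRadKernel

theorem eq_zero_of_linear_system {x y a b : ℝ → ℝ} {l R t₀ : ℝ} (ha : ContinuousOn a (Ioo l R))
    (hb : ContinuousOn b (Ioo l R)) (hx : ∀ t ∈ Ioo l R, HasDerivAt x (a t * y t) t)
    (hy : ∀ t ∈ Ioo l R, HasDerivAt y (b t * x t) t) (ht₀ : t₀ ∈ Ioo l R) (hx0 : x t₀ = 0)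
    (hy0 : y t₀ = 0) {t : ℝ} (ht : t ∈ Ioo l R) : x t = 0 := by
  obtain ⟨l', hl', hl''⟩ := exists_between (lt_min ht₀.1 ht.1)
  obtain ⟨R', hR', hR''⟩ := exists_between (max_lt ht₀.2 ht.2)
  have hsub : Icc l' R' ⊆ Ioo l R := fun s hs => ⟨hl'.trans_le hs.1, hs.2.trans_lt hR''⟩
  obtain ⟨A, hA⟩ := isCompact_Icc.exists_bound_of_continuousOn (ha.mono hsub)
  obtain ⟨B, hB⟩ := isCompact_Icc.exists_bound_of_continuousOn (hb.mono hsub)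
  let v : ℝ → ℝ × ℝ → ℝ × ℝ := fun t z => (a t * z.2, b t * z.1)
  have hlip : ∀ t ∈ Ioo l' R', LipschitzOnWith (Real.toNNReal (max A B)) (v t) univ := by
    intro t ht
    have hA' := hA t (Ioo_subset_Icc_self ht)
    have hB' := hB t (Ioo_subset_Icc_self ht)
    have h0 : 0 ≤ max A B := le_max_of_le_left ((norm_nonneg _).trans hA')
    refine LipschitzOnWith.of_dist_le_mul fun z _ z' _ => ?_
    rw [Real.coe_toNNReal _ h0, Prod.dist_eq, Prod.dist_eq]
    simp only [v, Real.dist_eq, ← mul_sub, abs_mul]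
    refine max_le ?_ ?_
    · exact mul_le_mul (hA'.trans (le_max_left _ _)) (le_max_right _ _) (abs_nonneg _) h0
    · exact mul_le_mul (hB'.trans (le_max_right _ _)) (le_max_left _ _) (abs_nonneg _) h0
  have key := ODE_solution_unique_of_mem_Ioo (v := v) (f := fun t => (x t, y t))
    (g := fun _ => (0, 0)) (t₀ := t₀) hlip
    ⟨hl''.trans_le (min_le_left _ _), (le_max_left _ _).trans_lt hR'⟩
    (fun s hs => ⟨(hx s (hsub (Ioo_subset_Icc_self hs))).prodMk
      (hy s (hsub (Ioo_subset_Icc_self hs))), mem_univ _⟩)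
    (fun s _ => ⟨by
      have : v s (0, 0) = (0, 0) := by simp [v]
      rw [this]
      exact hasDerivAt_const _ _, mem_univ _⟩)
    (by rw [hx0, hy0])
    ⟨hl''.trans_le (min_le_right _ _), (le_max_right _ _).trans_lt hR'⟩
  exact congrArg Prod.fst key

/-- `U` is continuous on `[0, R]` and solves the integral equation `U = G (h |U|^(p-2) U - lam U)`,
whose right-hand side is bounded by `F`. -/
structure IsGreenSolution (N : ℕ) (R : ℝ) (h : ℝ → ℝ) (p lam F : ℝ) (U : ℝ → ℝ) : Prop where
  cont : ContinuousOn U (Icc 0 R)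
  bound : ∀ r ∈ Ioo 0 R, |schrodingerRHS h p lam U r| ≤ F
  eq_green : ∀ r, U r = greenOp N R (schrodingerRHS h p lam U) r

namespace IsGreenSolution

variable {N : ℕ} {R p lam F M : ℝ} {h U : ℝ → ℝ}

theorem continuousOn_rhs (S : IsGreenSolution N R h p lam F U) (hp : 2 < p)
    (hc : ContinuousOn h (Ioo 0 R)) : ContinuousOn (schrodingerRHS h p lam U) (Ioo 0 R) :=
  continuousOn_schrodingerRHS hp hc (S.cont.mono Ioo_subset_Icc_self)

theorem hasDerivAt (S : IsGreenSolution N R h p lam F U) (hR : 0 < R) (hp : 2 < p)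
    (hc : ContinuousOn h (Ioo 0 R)) {r : ℝ} (hr : r ∈ Ioo 0 R) :
    HasDerivAt U (-(r ^ (N - 1))⁻¹ *
      ∫ ρ in (0 : ℝ)..r, ρ ^ (N - 1) * schrodingerRHS h p lam U ρ) r := by
  have h1 := hasDerivAt_greenOp (N := N) hR (S.continuousOn_rhs hp hc) S.bound hr
  rwa [← funext S.eq_green] at h1

theorem eq_zero_of_cauchy_data (S : IsGreenSolution N R h p lam F U) (hR : 0 < R) (hp : 2 < p)
    (hc : ContinuousOn h (Ioo 0 R)) {r₀ : ℝ} (hr₀ : r₀ ∈ Ioo 0 R) (hU : U r₀ = 0)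
    (hU' : HasDerivAt U 0 r₀) {r : ℝ} (hr : r ∈ Ioo 0 R) : U r = 0 := by
  have hcr := S.continuousOn_rhs hp hc
  have hcU := S.cont.mono Ioo_subset_Icc_self
  refine eq_zero_of_linear_system (l := 0) (R := R) (t₀ := r₀)
    (y := fun r => ∫ ρ in (0 : ℝ)..r, ρ ^ (N - 1) * schrodingerRHS h p lam U ρ)
    (a := fun t => -(t ^ (N - 1))⁻¹) (b := fun t => t ^ (N - 1) * (h t * |U t| ^ (p - 2) - lam))
    ?_ ?_ (fun t ht => S.hasDerivAt hR hp hc ht) (fun t ht => ?_) hr₀ hU ?_ hr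
  · exact ((continuousOn_id.pow _).inv₀ fun t ht => pow_ne_zero _ (ne_of_gt ht.1)).neg
  · exact (continuousOn_id.pow _).mul ((hc.mul (hcU.abs.rpow_const fun _ _ =>
      Or.inr (by linarith))).sub continuousOn_const)
  · have hcont : ContinuousOn (fun ρ => ρ ^ (N - 1) * schrodingerRHS h p lam U ρ) (Ioo 0 R) :=
      (continuousOn_id.pow _).mul hcr
    refine (intervalIntegral.integral_hasDerivAt_right
      (intervalIntegrable_pow_mul hcr S.bound ht.1 ht.2)
      (hcont.stronglyMeasurableAtFilter isOpen_Ioo t ht)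
      (hcont.continuousAt (Ioo_mem_nhds ht.1 ht.2))).congr_deriv ?_
    simp only [schrodingerRHS]
    ring
  · have h1 := (S.hasDerivAt hR hp hc hr₀).unique hU'
    have h2 : (r₀ ^ (N - 1))⁻¹ ≠ 0 := inv_ne_zero (pow_ne_zero _ hr₀.1.ne')
    simpa [h2] using h1

theorem pos_zero (S : IsGreenSolution N R h p lam F U) (hR : 0 < R) (hp : 2 < p)
    (hc : ContinuousOn h (Ioo 0 R)) (h0 : ∀ r ∈ Ioo 0 R, 0 ≤ h r) (hM : ∀ r ∈ Ioo 0 R, h r ≤ M)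
    (hM0 : 0 ≤ M) (hU : ∀ r ∈ Ioo 0 R, 0 < U r) : 0 < U 0 := by
  have hnn : 0 ≤ U 0 := by
    have h1 : (𝓝[Ioo 0 R] (0 : ℝ)).NeBot := by
      rw [nhdsWithin_Ioo_eq_nhdsGT hR]; infer_instance
    have h2 : Tendsto U (𝓝[Ioo 0 R] 0) (𝓝 (U 0)) :=
      (S.cont 0 ⟨le_rfl, hR.le⟩).mono Ioo_subset_Icc_self
    exact ge_of_tendsto h2 (eventually_nhdsWithin_of_forall fun r hr => (hU r hr).le)
  refine hnn.lt_of_ne' fun hU0 => ?_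
  obtain ⟨D, hD⟩ := isCompact_Icc.exists_bound_of_continuousOn S.cont
  have hD0 : 0 ≤ D := (norm_nonneg _).trans (hD 0 ⟨le_rfl, hR.le⟩)
  set K := M * D ^ (p - 2) + |lam| with hK
  have hK0 : 0 ≤ K := by positivity
  have hf : ∀ ρ ∈ Ioo 0 R, |schrodingerRHS h p lam U ρ| ≤ K * U ρ := by
    intro ρ hρ
    refine (abs_schrodingerRHS_le (h0 ρ hρ) (hM ρ hρ)).trans ?_
    have h1 := hD ρ (Ioo_subset_Icc_self hρ)
    rw [Real.norm_eq_abs] at h1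
    have hp' : 0 ≤ p - 2 := by linarith
    rw [hK]
    nth_rw 3 [← abs_of_pos (hU ρ hρ)]
    gcongr
  obtain ⟨r₁, hr₁, hr₁R, hKr⟩ : ∃ r₁ : ℝ, 0 < r₁ ∧ r₁ < R ∧ K * r₁ ^ 2 < 1 := by
    have h1 : Tendsto (fun r : ℝ => K * r ^ 2) (𝓝[>] 0) (𝓝 0) := by
      have : Tendsto (fun r : ℝ => K * r ^ 2) (𝓝 0) (𝓝 (K * 0 ^ 2)) :=
        Continuous.tendsto (by fun_prop) 0
      simp only [ne_eq, OfNat.ofNat_ne_zero, not_false_eq_true, zero_pow, mul_zero] at this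
      exact this.mono_left nhdsWithin_le_nhds
    obtain ⟨r, h2, h3⟩ := ((h1.eventually_lt_const zero_lt_one).and
      (Ioo_mem_nhdsGT hR)).exists
    exact ⟨r, h3.1, h3.2, h2⟩
  obtain ⟨s, hs, hmax⟩ := isCompact_Icc.exists_isMaxOn (nonempty_Icc.2 hr₁.le)
    (S.cont.mono (Icc_subset_Icc_right hr₁R.le))
  have hUs : 0 < U s := (hU r₁ ⟨hr₁, hr₁R⟩).trans_le (hmax ⟨hr₁.le, le_rfl⟩)
  have hs0 : 0 < s := hs.1.lt_of_ne fun h => by rw [← h, hU0] at hUs; exact lt_irrefl _ hUs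
  have hsR : s < R := hs.2.trans_lt hr₁R
  have h1 := abs_greenOp_zero_sub_le (N := N) (F' := K * U s) hR (S.continuousOn_rhs hp hc) S.bound
    hs0 hsR.le (fun ρ hρ => (hf ρ ⟨hρ.1, hρ.2.trans hsR⟩).trans (by
      gcongr
      exact hmax ⟨hρ.1.le, hρ.2.le.trans hs.2⟩))
  rw [← S.eq_green, ← S.eq_green, hU0, zero_sub, abs_neg, abs_of_pos hUs] at h1
  have h2 : K * U s * s ^ 2 ≤ K * r₁ ^ 2 * U s := by
    have : s ^ 2 ≤ r₁ ^ 2 := by gcongr; exact hs.2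
    calc K * U s * s ^ 2 ≤ K * U s * r₁ ^ 2 := by gcongr
      _ = _ := by ring
  nlinarith

end IsGreenSolution

theorem greenOp_congr {N : ℕ} {R : ℝ} {f g : ℝ → ℝ} (hfg : ∀ ρ ∈ Ioo 0 R, f ρ = g ρ) (r : ℝ) :
    greenOp N R f r = greenOp N R g r :=
  setIntegral_congr_fun measurableSet_Ioo fun ρ hρ => by simp only [hfg ρ hρ]

theorem schrodingerRHS_congr {h u v : ℝ → ℝ} {p lam ρ : ℝ} (huv : u ρ = v ρ) :
    schrodingerRHS h p lam u ρ = schrodingerRHS h p lam v ρ := by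
  simp only [schrodingerRHS, huv]

/-- `w` minimizes the energy among the elements of mass `c`. -/
def IsEnergyMinimizer {H X : Type*} [NormedAddCommGroup H] [InnerProductSpace ℝ H]
    [MeasurableSpace X] (μ : Measure X) (k : X → H) (g : X → ℝ) (p c : ℝ) (w : H) : Prop :=
  massF μ k w = c ∧ ∀ v, massF μ k v = c → energyF μ k g p w ≤ energyF μ k g p v

theorem potF_congr {H X : Type*} [NormedAddCommGroup H] [InnerProductSpace ℝ H]
    [MeasurableSpace X] {μ : Measure X} {k : X → H} {g : X → ℝ} {p : ℝ} {w w' : H}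
    (habs : ∀ᵐ x ∂μ, |⟪k x, w'⟫| = |⟪k x, w⟫|) : potF μ k g p w' = potF μ k g p w :=
  integral_congr_ae (habs.mono fun x hx => by simp only [hx])

theorem IsEnergyMinimizer.congr {H X : Type*} [NormedAddCommGroup H] [InnerProductSpace ℝ H]
    [MeasurableSpace X] {μ : Measure X} {k : X → H} {g : X → ℝ} {p c : ℝ} {w w' : H}
    (hw : IsEnergyMinimizer μ k g p c w) (hnorm : ‖w'‖ = ‖w‖)
    (habs : ∀ᵐ x ∂μ, |⟪k x, w'⟫| = |⟪k x, w⟫|) : IsEnergyMinimizer μ k g p c w' := by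
  have h1 : massF μ k w' = massF μ k w :=
    integral_congr_ae (habs.mono fun x hx => by
      show ⟪k x, w'⟫ ^ 2 = ⟪k x, w⟫ ^ 2; rw [← sq_abs, hx, sq_abs])
  have h2 : energyF μ k g p w' = energyF μ k g p w := by
    rw [energyF, energyF, potF_congr habs, hnorm]
  exact ⟨h1.trans hw.1, fun v hv => h2.trans_le (hw.2 v hv)⟩

namespace IsRadKernel

variable {H : Type*} [NormedAddCommGroup H] [InnerProductSpace ℝ H]
  {N : ℕ} {R p α M c : ℝ} {k : ℝ → H} {h B : ℝ → ℝ}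

theorem exists_reflection [CompleteSpace H] (K : IsRadKernel N R k) {r₀ : ℝ} (hr₀ : r₀ ∈ Ioo 0 R)
    {w : H} (hw : ⟪k r₀, w⟫ = 0) :
    ∃ w', ‖w'‖ = ‖w‖ ∧ (∀ r ∈ Ioc 0 r₀, ⟪k r, w'⟫ = ⟪k r, w⟫) ∧
      ∀ r ∈ Icc r₀ R, ⟪k r, w'⟫ = -⟪k r, w⟫ := by
  set V := (Submodule.span ℝ (k '' Icc r₀ R)).topologicalClosure with hV
  have : CompleteSpace V := (Submodule.isClosed_topologicalClosure _).completeSpace_coe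
  have hmem : ∀ r ∈ Icc r₀ R, k r ∈ V := fun r hr =>
    Submodule.le_topologicalClosure _ (Submodule.subset_span (mem_image_of_mem k hr))
  have hinner : ∀ r ∈ Icc r₀ R, ⟪k r, V.starProjection w⟫ = ⟪k r, w⟫ := fun r hr => by
    rw [← Submodule.inner_starProjection_left_eq_right,
      Submodule.starProjection_eq_self_iff.2 (hmem r hr)]
  have horth : ∀ r ∈ Ioc 0 r₀, ⟪k r, V.starProjection w⟫ = 0 := by
    intro r hr
    have h1 : k r - k r₀ ∈ Vᗮ := by
      rw [hV, Submodule.orthogonal_closure, Submodule.mem_orthogonal]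
      intro u hu
      induction hu using Submodule.span_induction with
      | mem x hx =>
        obtain ⟨s, hs, rfl⟩ := hx
        have hs0 : 0 < s := hr₀.1.trans_le hs.1
        rw [inner_sub_right, K s ⟨hs0, hs.2⟩ r ⟨hr.1, hr.2.trans hr₀.2.le⟩,
          K s ⟨hs0, hs.2⟩ r₀ (Ioo_subset_Ioc_self hr₀), max_eq_left hs.1,
          max_eq_left (hr.2.trans hs.1), sub_self]
      | zero => simp
      | add x y _ _ hx hy => rw [inner_add_left, hx, hy, add_zero]
      | smul a x _ hx => rw [real_inner_smul_left, hx, mul_zero]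
    have h2 := (Submodule.mem_orthogonal _ _).1 h1 _ (V.starProjection_apply_mem w)
    rw [real_inner_comm, inner_sub_left, hinner r₀ ⟨le_rfl, hr₀.2.le⟩, hw, sub_zero] at h2
    exact h2
  have hform : ∀ r, ⟪k r, -V.reflection w⟫ = ⟪k r, w⟫ - 2 * ⟪k r, V.starProjection w⟫ := by
    intro r
    rw [Submodule.reflection_apply, inner_neg_right, inner_sub_right, two_smul, inner_add_right]
    ring
  refine ⟨-V.reflection w, by rw [norm_neg, LinearIsometryEquiv.norm_map], fun r hr => ?_,
    fun r hr => ?_⟩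
  · rw [hform, horth r hr]; ring
  · rw [hform, hinner r hr]; ring

theorem exists_isGreenSolution (K : IsRadKernel N R k) (hN : 2 ≤ N) (hR : 0 < R)
    (A : IsAdmissible (radMeasure N R) k h p B M) (hα : 0 < α) (hαN : (N : ℝ) - 2 < α)
    (hη : 2 * (α - (N - 2)) < 2 - α * (p - 2) / 2) (hcont : ContinuousOn h (Ioo 0 R))
    (h0 : ∀ r ∈ Ioo 0 R, 0 ≤ h r) (hM : ∀ r ∈ Ioo 0 R, h r ≤ M) (hc : 0 < c) {w : H}
    (hw : IsEnergyMinimizer (radMeasure N R) k h p c w) :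
    ∃ F U, IsGreenSolution N R h p ((potF (radMeasure N R) k h p w - ‖w‖ ^ 2) / c) F U ∧
      ∀ r ∈ Ioo 0 R, U r = ⟪k r, w⟫ := by
  have hp := A.two_lt
  have hM0 := A.M_nonneg
  set lam := (potF (radMeasure N R) k h p w - ‖w‖ ^ 2) / c
  have hgreen : ∀ r ∈ Ioo 0 R, ⟪k r, w⟫ =
      greenOp N R (schrodingerRHS h p lam fun ρ => ⟪k ρ, w⟫) r :=
    fun r hr => K.green_representation A hc hw.1 hw.2 (Ioo_subset_Ioc_self hr)
  obtain ⟨D, hD⟩ := K.exists_bound hN hp hα hαN hη h0 hM hM0 hgreen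
  have hucont : ContinuousOn (fun ρ => ⟪k ρ, w⟫) (Ioo 0 R) :=
    (K.continuousOn_inner hR w).mono Ioo_subset_Ioc_self
  have hfcont := continuousOn_schrodingerRHS (lam := lam) hp hcont hucont
  have hp' : 0 ≤ p - 2 := by linarith
  have hfb : ∀ ρ ∈ Ioo 0 R, |schrodingerRHS h p lam (fun ρ => ⟪k ρ, w⟫) ρ| ≤
      (M * D ^ (p - 2) + |lam|) * D := by
    intro ρ hρ
    have hD' := hD ρ hρ
    have : 0 ≤ D := (abs_nonneg _).trans hD'
    refine (abs_schrodingerRHS_le (h0 ρ hρ) (hM ρ hρ)).trans ?_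
    gcongr
  have hUu : ∀ r ∈ Ioo 0 R,
      greenOp N R (schrodingerRHS h p lam fun ρ => ⟪k ρ, w⟫) r = ⟪k r, w⟫ :=
    fun r hr => (hgreen r hr).symm
  refine ⟨(M * D ^ (p - 2) + |lam|) * D, greenOp N R (schrodingerRHS h p lam fun ρ => ⟪k ρ, w⟫),
    ⟨continuousOn_greenOp hR hfcont hfb, fun r hr => ?_, fun r => ?_⟩, hUu⟩
  · rw [schrodingerRHS_congr (v := fun ρ => ⟪k ρ, w⟫) (hUu r hr)]
    exact hfb r hr
  · exact greenOp_congr (fun ρ hρ => (schrodingerRHS_congr (v := fun ρ => ⟪k ρ, w⟫) (hUu ρ hρ)).symm) r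

theorem inner_ne_zero_of_minimizer [CompleteSpace H] (K : IsRadKernel N R k) (hN : 2 ≤ N)
    (hR : 0 < R)
    (A : IsAdmissible (radMeasure N R) k h p B M) (hα : 0 < α) (hαN : (N : ℝ) - 2 < α)
    (hη : 2 * (α - (N - 2)) < 2 - α * (p - 2) / 2) (hcont : ContinuousOn h (Ioo 0 R))
    (h0 : ∀ r ∈ Ioo 0 R, 0 ≤ h r) (hM : ∀ r ∈ Ioo 0 R, h r ≤ M) (hc : 0 < c) {w : H}
    (hw : IsEnergyMinimizer (radMeasure N R) k h p c w) {r₀ : ℝ} (hr₀ : r₀ ∈ Ioo 0 R) :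
    ⟪k r₀, w⟫ ≠ 0 := by
  intro hzero
  have hp := A.two_lt
  obtain ⟨w', hnorm, hleft, hright⟩ := K.exists_reflection hr₀ hzero
  have habs : ∀ᵐ r ∂radMeasure N R, |⟪k r, w'⟫| = |⟪k r, w⟫| := by
    filter_upwards [ae_radMeasure] with r hr
    rcases le_total r r₀ with hle | hle
    · rw [hleft r ⟨hr.1, hle⟩]
    · rw [hright r ⟨hle, hr.2.le⟩, abs_neg]
  have hw' := hw.congr hnorm habs
  obtain ⟨F, U, S, hU⟩ := K.exists_isGreenSolution hN hR A hα hαN hη hcont h0 hM hc hw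
  obtain ⟨F', U', S', hU'⟩ := K.exists_isGreenSolution hN hR A hα hαN hη hcont h0 hM hc hw'
  have hd := S.hasDerivAt hR hp hcont hr₀
  have hd' := S'.hasDerivAt hR hp hcont hr₀
  set d := -(r₀ ^ (N - 1))⁻¹ * ∫ ρ in (0 : ℝ)..r₀, ρ ^ (N - 1) * schrodingerRHS h p
    ((potF (radMeasure N R) k h p w - ‖w‖ ^ 2) / c) U ρ
  set d' := -(r₀ ^ (N - 1))⁻¹ * ∫ ρ in (0 : ℝ)..r₀, ρ ^ (N - 1) * schrodingerRHS h p
    ((potF (radMeasure N R) k h p w' - ‖w'‖ ^ 2) / c) U' ρ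
  have hnhds : Ioo 0 R ∈ 𝓝 r₀ := Ioo_mem_nhds hr₀.1 hr₀.2
  have h1 : HasDerivWithinAt U' d (Iic r₀) r₀ := by
    refine hd.hasDerivWithinAt.congr_of_eventuallyEq_of_mem ?_ self_mem_Iic
    filter_upwards [self_mem_nhdsWithin, mem_nhdsWithin_of_mem_nhds hnhds] with r hr hr'
    rw [hU' r hr', hU r hr', hleft r ⟨hr'.1, hr⟩]
  have h2 : HasDerivWithinAt U' (-d) (Ici r₀) r₀ := by
    refine hd.neg.hasDerivWithinAt.congr_of_eventuallyEq_of_mem ?_ self_mem_Ici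
    filter_upwards [self_mem_nhdsWithin, mem_nhdsWithin_of_mem_nhds hnhds] with r hr hr'
    rw [Pi.neg_apply, hU' r hr', hU r hr', hright r ⟨hr, hr'.2.le⟩]
  have h3 : d' = d := (uniqueDiffOn_Iic r₀ r₀ self_mem_Iic).eq_deriv _ hd'.hasDerivWithinAt h1
  have h4 : d' = -d := (uniqueDiffOn_Ici r₀ r₀ self_mem_Ici).eq_deriv _ hd'.hasDerivWithinAt h2
  have hd0 : d = 0 := by linarith
  rw [hd0] at hd
  have hall : ∀ r ∈ Ioo 0 R, ⟪k r, w⟫ = 0 := fun r hr => by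
    rw [← hU r hr]
    exact S.eq_zero_of_cauchy_data hR hp hcont hr₀ ((hU r₀ hr₀).trans hzero) hd hr
  have hmass : massF (radMeasure N R) k w = 0 := by
    refine integral_eq_zero_of_ae ?_
    filter_upwards [ae_radMeasure] with r hr
    simp [hall r hr]
  exact hc.ne' (hw.1.symm.trans hmass)

theorem exists_pos_minimizer [CompleteSpace H] [TopologicalSpace.SeparableSpace H]
    (K : IsRadKernel N R k) (hN : 2 ≤ N) (hR : 0 < R) (hpN : p < 2 + 4 / (N : ℝ))
    (hp : 2 < p) (hcont : ContinuousOn h (Ioo 0 R))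
    (h0 : ∀ r ∈ Ioo 0 R, 0 ≤ h r) (hM : ∀ r ∈ Ioo 0 R, h r ≤ M) (hM0 : 0 ≤ M) (hc : 0 < c) :
    ∃ lam F U, IsGreenSolution N R h p lam F U ∧ (∀ r ∈ Ioo 0 R, 0 < U r) ∧
      ∫ r in Ioo 0 R, r ^ (N - 1) * U r ^ 2 = c := by
  obtain ⟨α, hα, hαN, hαN', hpα, hη⟩ := exists_growth_exponent (by exact_mod_cast hN) hp hpN
  have A := K.isAdmissible hN hR hp hα hαN hαN' hpα hcont h0 hM hM0
  obtain ⟨w₀, hw₀⟩ := K.exists_mass_eq hR A.integrable_sq hc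
  obtain ⟨L₀, hL₀⟩ := K.coercive hN hR hp hpN hα hαN hαN' hpα hcont h0 hM hM0 c
  obtain ⟨w, hw⟩ : ∃ w, IsEnergyMinimizer (radMeasure N R) k h p c w :=
    A.exists_minimizer w₀ hw₀ hL₀
  have hne : ∀ r ∈ Ioo 0 R, ⟪k r, w⟫ ≠ 0 := fun r hr =>
    K.inner_ne_zero_of_minimizer hN hR A hα hαN hη hcont h0 hM hc hw hr
  have hucont : ContinuousOn (fun ρ => ⟪k ρ, w⟫) (Ioo 0 R) :=
    (K.continuousOn_inner hR w).mono Ioo_subset_Ioc_self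
  obtain ⟨w', hw', hpos⟩ : ∃ w', IsEnergyMinimizer (radMeasure N R) k h p c w' ∧
      ∀ r ∈ Ioo 0 R, 0 < ⟪k r, w'⟫ := by
    by_cases hpos : ∀ r ∈ Ioo 0 R, 0 < ⟪k r, w⟫
    · exact ⟨w, hw, hpos⟩
    · push Not at hpos
      obtain ⟨a, ha, ha'⟩ := hpos
      refine ⟨-w, hw.congr (norm_neg w) (ae_of_all _ fun r => by rw [inner_neg_right, abs_neg]),
        fun r hr => ?_⟩
      rw [inner_neg_right, neg_pos]
      by_contra! hcon
      obtain ⟨s, hs, hs'⟩ := isPreconnected_Ioo.intermediate_value ha hr hucont ⟨ha', hcon⟩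
      exact hne s hs hs'
  obtain ⟨F, U, S, hU⟩ := K.exists_isGreenSolution hN hR A hα hαN hη hcont h0 hM hc hw'
  refine ⟨_, F, U, S, fun r hr => hU r hr ▸ hpos r hr, ?_⟩
  rw [← hw'.1, massF, integral_radMeasure]
  exact setIntegral_congr_fun measurableSet_Ioo fun r hr => by simp only [hU r hr]

end IsRadKernel

theorem sum_sq_apply_single_le {N : ℕ} (L : Euc N →L[ℝ] ℝ) :
    ∑ i, L (EuclideanSpace.single i 1) ^ 2 ≤ ‖L‖ ^ 2 := by
  rw [← (InnerProductSpace.toDual ℝ (Euc N)).symm.norm_map L, EuclideanSpace.norm_sq_eq]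
  refine Finset.sum_le_sum fun i _ => ?_
  rw [Real.norm_eq_abs, sq_abs, ← InnerProductSpace.toDual_symm_apply (𝕜 := ℝ) (y := L),
    real_inner_comm, EuclideanSpace.inner_single_left]
  simp

theorem hasCompactSupport_sq {E : Type*} [TopologicalSpace E] {φ : E → ℝ}
    (hφ : HasCompactSupport φ) : HasCompactSupport fun x => φ x ^ 2 :=
  hφ.mono fun x hx => by
    rw [Function.mem_support] at hx ⊢
    exact fun h => hx (by rw [h, zero_pow two_ne_zero])

theorem integral_fderiv_eq_zero {E : Type*} [NormedAddCommGroup E] [NormedSpace ℝ E]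
    [FiniteDimensional ℝ E] [MeasurableSpace E] [BorelSpace E] {μ : Measure E}
    [μ.IsAddHaarMeasure] {g : E → ℝ} (hg : ContDiff ℝ 1 g) (hc : HasCompactSupport g) (v : E) :
    Integrable (fun x => fderiv ℝ g x v) μ ∧ ∫ x, fderiv ℝ g x v ∂μ = 0 := by
  have hint : Integrable (fun x => fderiv ℝ g x v) μ :=
    ((hg.continuous_fderiv one_ne_zero).clm_apply continuous_const).integrable_of_hasCompactSupport
      (hc.fderiv_apply ℝ v)
  have h := integral_mul_fderiv_eq_neg_fderiv_mul_of_integrable (μ := μ) (f := fun _ => (1 : ℝ))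
    (g := g) (v := v) (by simp) (by simpa using hint)
    (by simpa using hg.continuous.integrable_of_hasCompactSupport hc)
    (fun _ _ => differentiableAt_const _) fun x _ => hg.differentiable one_ne_zero x
  exact ⟨hint, by simpa using h⟩

theorem fderiv_picone_field {E : Type*} [NormedAddCommGroup E] [NormedSpace ℝ E] {φ ψ χ : E → ℝ}
    {x : E} (hφ : DifferentiableAt ℝ φ x) (hψ : DifferentiableAt ℝ ψ x)
    (hχ : DifferentiableAt ℝ χ x) (hne : ψ x ≠ 0) (v : E) :
    fderiv ℝ (fun y => φ y ^ 2 * ((ψ y)⁻¹ * χ y)) x v =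
      2 * φ x * fderiv ℝ φ x v * (χ x / ψ x) - φ x ^ 2 * χ x * fderiv ℝ ψ x v / ψ x ^ 2
        + φ x ^ 2 / ψ x * fderiv ℝ χ x v := by
  have e1 : HasFDerivAt (fun y => φ y ^ 2) _ x := hφ.hasFDerivAt.pow 2
  have e4 : HasFDerivAt (fun y => (ψ y)⁻¹) _ x :=
    (hasDerivAt_inv hne).comp_hasFDerivAt x hψ.hasFDerivAt
  have e5 : HasFDerivAt (fun y => φ y ^ 2 * ((ψ y)⁻¹ * χ y)) _ x :=
    e1.mul (e4.mul hχ.hasFDerivAt)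
  rw [e5.fderiv]
  simp
  field_simp
  ring

/-- **Barta's inequality**, via Picone's identity. -/
theorem mul_integral_sq_le_of_supersolution {N : ℕ} {Ω : Set (Euc N)} (hΩ : IsOpen Ω)
    {ψ φ : Euc N → ℝ} {m : ℝ} (hψ : ContDiffOn ℝ 2 ψ Ω) (hpos : ∀ x ∈ Ω, 0 < ψ x)
    (hsup : ∀ x ∈ Ω, m * ψ x ≤ -lap ψ x) (hφ : ContDiff ℝ (⊤ : ℕ∞) φ)
    (hφc : HasCompactSupport φ) (hφΩ : tsupport φ ⊆ Ω) :
    m * ∫ x, φ x ^ 2 ≤ ∫ x, ‖fderiv ℝ φ x‖ ^ 2 := by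
  have hφ1 : ContDiff ℝ 1 φ := hφ.of_le (by exact_mod_cast le_top)
  set X : Fin N → Euc N → ℝ :=
    fun i x => φ x ^ 2 * ((ψ x)⁻¹ * fderiv ℝ ψ x (EuclideanSpace.single i 1)) with hX
  have hψat : ∀ x ∈ Ω, ContDiffAt ℝ 2 ψ x := fun x hx => hψ.contDiffAt (hΩ.mem_nhds hx)
  have hdψ : ∀ i, ∀ x ∈ Ω,
      ContDiffAt ℝ 1 (fun y => fderiv ℝ ψ y (EuclideanSpace.single i 1)) x := fun i x hx =>
    ((hψat x hx).fderiv_right (m := 1) (by norm_num)).clm_apply contDiffAt_const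
  have hψ1 : ∀ x ∈ Ω, ContDiffAt ℝ 1 ψ x := fun x hx => (hψat x hx).of_le (by norm_num)
  have hsuppX : ∀ i, Function.support (X i) ⊆ Function.support φ := by
    intro i x hx hφx
    simp [hX, Function.notMem_support.1 (fun h => h hφx)] at hx
  have htsX : ∀ i, tsupport (X i) ⊆ tsupport φ := fun i => closure_mono (hsuppX i)
  have hXd : ∀ i, ContDiff ℝ 1 (X i) := by
    intro i
    refine contDiff_iff_contDiffAt.2 fun x => ?_
    by_cases hx : x ∈ tsupport (X i)
    swap
    · exact contDiffAt_const.congr_of_eventuallyEq (notMem_tsupport_iff_eventuallyEq.1 hx)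
    have hxΩ := hφΩ (htsX i hx)
    exact (hφ1.contDiffAt.pow 2).mul (((hψ1 x hxΩ).inv (hpos x hxΩ).ne').mul (hdψ i x hxΩ))
  have hXc : ∀ i, HasCompactSupport (X i) := fun i => hφc.mono (hsuppX i)
  have hXint := fun i => integral_fderiv_eq_zero (μ := volume) (hXd i) (hXc i)
    (EuclideanSpace.single i 1)
  have hsqint : Integrable (fun x => φ x ^ 2) :=
    (hφ.continuous.pow 2).integrable_of_hasCompactSupport
      (hasCompactSupport_sq hφc)
  have hdint : Integrable (fun x => ‖fderiv ℝ φ x‖ ^ 2) :=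
    ((hφ1.continuous_fderiv one_ne_zero).norm.pow 2).integrable_of_hasCompactSupport
      (hasCompactSupport_sq (hφc.fderiv (𝕜 := ℝ)).norm)
  have key : ∀ x, m * φ x ^ 2 + ∑ i, fderiv ℝ (X i) x (EuclideanSpace.single i 1) ≤
      ‖fderiv ℝ φ x‖ ^ 2 := by
    intro x
    by_cases hx : x ∈ tsupport φ
    · have hxΩ := hφΩ hx
      have hψx := hpos x hxΩ
      refine le_trans ?_ (sum_sq_apply_single_le _)
      have hXe : ∀ i, fderiv ℝ (X i) x (EuclideanSpace.single i 1) =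
          fderiv ℝ φ x (EuclideanSpace.single i 1) ^ 2
          - (fderiv ℝ φ x (EuclideanSpace.single i 1) -
            φ x * fderiv ℝ ψ x (EuclideanSpace.single i 1) / ψ x) ^ 2
          + φ x ^ 2 / ψ x * fderiv ℝ (fun y => fderiv ℝ ψ y (EuclideanSpace.single i 1)) x
              (EuclideanSpace.single i 1) := by
        intro i
        rw [fderiv_picone_field (hφ1.differentiable one_ne_zero x)
          ((hψ1 x hxΩ).differentiableAt one_ne_zero)
          ((hdψ i x hxΩ).differentiableAt one_ne_zero) hψx.ne']
        field_simp
        ring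
      simp only [hXe, Finset.sum_add_distrib, ← Finset.mul_sum, Finset.sum_sub_distrib]
      have h1 := hsup x hxΩ
      have h2 : φ x ^ 2 / ψ x * (m * ψ x) ≤ φ x ^ 2 / ψ x * -lap ψ x := by gcongr
      have h3 : φ x ^ 2 / ψ x * (m * ψ x) = m * φ x ^ 2 := by field_simp
      have h4 : 0 ≤ ∑ i, (fderiv ℝ φ x (EuclideanSpace.single i 1) -
            φ x * fderiv ℝ ψ x (EuclideanSpace.single i 1) / ψ x) ^ 2 :=
        Finset.sum_nonneg fun i _ => sq_nonneg _
      rw [h3, lap] at h2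
      linarith
    · have h1 : ∀ i, fderiv ℝ (X i) x = 0 := fun i =>
        image_eq_zero_of_notMem_tsupport fun h => hx (htsX i (tsupport_fderiv_subset ℝ h))
      simp only [h1, image_eq_zero_of_notMem_tsupport hx]
      simp
  have h1 := integral_mono ((hsqint.const_mul m).add
    (integrable_finsetSum _ fun i _ => (hXint i).1)) hdint key
  simp only [Pi.add_apply] at h1
  rw [integral_add (hsqint.const_mul m) (integrable_finsetSum _ fun i _ => (hXint i).1),
    integral_const_mul, integral_finsetSum _ fun i _ => (hXint i).1] at h1
  simpa [(hXint _).2] using h1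

theorem le_firstEig_ball {N : ℕ} {R : ℝ} (hR : 0 < R) {ψ : Euc N → ℝ} {m : ℝ}
    (hψ : ContDiffOn ℝ 2 ψ (Metric.ball 0 R)) (hpos : ∀ x ∈ Metric.ball 0 R, 0 < ψ x)
    (hsup : ∀ x ∈ Metric.ball 0 R, m * ψ x ≤ -lap ψ x) :
    m ≤ firstEig (Metric.ball (0 : Euc N) R) := by
  refine le_csInf ?_ ?_
  · let b : ContDiffBump (0 : Euc N) := ⟨R / 4, R / 2, by positivity, by linarith⟩
    refine ⟨_, b, b.contDiff, b.hasCompactSupport, ?_, fun h => ?_, rfl⟩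
    · rw [b.tsupport_eq]
      exact Metric.closedBall_subset_ball (by show R / 2 < R; linarith)
    · have h1 := b.one_of_mem_closedBall (x := 0) (Metric.mem_closedBall_self b.rIn_pos.le)
      rw [h] at h1
      simp at h1
  · rintro _ ⟨φ, hφ, hφc, hφΩ, hne, rfl⟩
    have h1 := mul_integral_sq_le_of_supersolution Metric.isOpen_ball hψ hpos hsup hφ hφc hφΩ
    obtain ⟨x, hx⟩ := Function.ne_iff.1 hne
    have h2 : 0 < ∫ x, φ x ^ 2 :=
      (hφ.continuous.pow 2).integral_pos_of_hasCompactSupport_nonneg_nonzero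
        (hasCompactSupport_sq hφc) (fun _ => sq_nonneg _)
        (pow_ne_zero 2 hx)
    rwa [le_div_iff₀ h2]

section GreenComparison

variable {N : ℕ} {R F : ℝ} {f : ℝ → ℝ}

theorem radGreen_mul_integral_le_greenOp (hR : 0 < R) (hf : ContinuousOn f (Ioo 0 R))
    (hb : ∀ ρ ∈ Ioo 0 R, |f ρ| ≤ F) (h0 : ∀ ρ ∈ Ioo 0 R, 0 ≤ f ρ) {r₁ r : ℝ}
    (hr₁ : r₁ ∈ Ioo 0 R) (hrR : r ≤ R) :
    radGreen N R (max r r₁) * ∫ ρ in (0 : ℝ)..r₁, ρ ^ (N - 1) * f ρ ≤ greenOp N R f r := by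
  have hsub : Ioo 0 r₁ ⊆ Ioo 0 R := Ioo_subset_Ioo_right hr₁.2.le
  have hint := integrableOn_green (N := N) hR hf hb hrR
  have hint' : IntegrableOn (fun ρ => ρ ^ (N - 1) * f ρ) (Ioo 0 r₁) := by
    rw [← intervalIntegrable_iff_integrableOn_Ioo_of_le hr₁.1.le]
    exact intervalIntegrable_pow_mul hf hb hr₁.1 hr₁.2
  rw [intervalIntegral.integral_of_le hr₁.1.le, integral_Ioc_eq_integral_Ioo, ← integral_const_mul]
  calc ∫ ρ in Ioo 0 r₁, radGreen N R (max r r₁) * (ρ ^ (N - 1) * f ρ)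
      ≤ ∫ ρ in Ioo 0 r₁, ρ ^ (N - 1) * (radGreen N R (max r ρ) * f ρ) := by
        refine setIntegral_mono_on (hint'.const_mul _) (hint.mono_set hsub) measurableSet_Ioo
          fun ρ hρ => ?_
        have h1 : radGreen N R (max r r₁) ≤ radGreen N R (max r ρ) :=
          radGreen_anti hR (hρ.1.trans_le (le_max_right _ _)) (max_le_max_left _ hρ.2.le)
        have h2 : 0 ≤ ρ ^ (N - 1) * f ρ := mul_nonneg (pow_nonneg hρ.1.le _) (h0 ρ (hsub hρ))
        calc _ ≤ radGreen N R (max r ρ) * (ρ ^ (N - 1) * f ρ) := by gcongr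
          _ = _ := by ring
    _ ≤ greenOp N R f r := by
        refine setIntegral_mono_set hint ?_ (ae_of_all _ hsub)
        filter_upwards [ae_restrict_mem measurableSet_Ioo] with ρ hρ
        exact mul_nonneg (pow_nonneg hρ.1.le _) (mul_nonneg
          (radGreen_nonneg (hρ.1.trans_le (le_max_right _ _)) (max_le hrR hρ.2.le)) (h0 ρ hρ))

theorem integral_pow_mul_pos (hf : ContinuousOn f (Ioo 0 R))
    (hb : ∀ ρ ∈ Ioo 0 R, |f ρ| ≤ F) {r₁ : ℝ} (hr₁ : r₁ ∈ Ioo 0 R)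
    (hpos : ∀ ρ ∈ Ioo 0 r₁, 0 < f ρ) : 0 < ∫ ρ in (0 : ℝ)..r₁, ρ ^ (N - 1) * f ρ :=
  intervalIntegral.intervalIntegral_pos_of_pos_on (intervalIntegrable_pow_mul hf hb hr₁.1 hr₁.2)
    (fun ρ hρ => mul_pos (pow_pos hρ.1 _) (hpos ρ hρ)) hr₁.1

theorem greenOp_pos (hR : 0 < R) (hf : ContinuousOn f (Ioo 0 R))
    (hb : ∀ ρ ∈ Ioo 0 R, |f ρ| ≤ F) (h0 : ∀ ρ ∈ Ioo 0 R, 0 < f ρ) {r : ℝ} (hrR : r < R) :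
    0 < greenOp N R f r := by
  have hr₁ : R / 2 ∈ Ioo 0 R := ⟨by linarith, by linarith⟩
  exact (mul_pos (radGreen_pos (hr₁.1.trans_le (le_max_right _ _)) (max_lt hrR hr₁.2))
    (integral_pow_mul_pos hf hb hr₁ fun ρ hρ => h0 ρ ⟨hρ.1, hρ.2.trans hr₁.2⟩)).trans_le
    (radGreen_mul_integral_le_greenOp hR hf hb (fun ρ hρ => (h0 ρ hρ).le) hr₁ hrR.le)

theorem exists_mul_greenOp_le {g : ℝ → ℝ} {F' : ℝ} (hR : 0 < R) (hf : ContinuousOn f (Ioo 0 R))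
    (hb : ∀ ρ ∈ Ioo 0 R, |f ρ| ≤ F) (hg : ContinuousOn g (Ioo 0 R))
    (hb' : ∀ ρ ∈ Ioo 0 R, |g ρ| ≤ F') (h0 : ∀ ρ ∈ Ioo 0 R, 0 ≤ g ρ) {r₁ : ℝ}
    (hr₁ : r₁ ∈ Ioo 0 R) (hpos : ∀ ρ ∈ Ioo 0 r₁, 0 < g ρ) :
    ∃ δ > 0, ∀ r ∈ Icc 0 R, δ * greenOp N R f r ≤ greenOp N R g r := by
  obtain ⟨D, hD⟩ := isCompact_Icc.exists_bound_of_continuousOn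
    (continuousOn_greenOp (N := N) hR hf hb)
  have hΓ : 0 < radGreen N R r₁ := radGreen_pos hr₁.1 hr₁.2
  have hm := integral_pow_mul_pos (N := N) hg hb' hr₁ hpos
  set m := ∫ ρ in (0 : ℝ)..r₁, ρ ^ (N - 1) * g ρ
  set K := max 1 (max (R ^ (N - 1) * F * R) (D / radGreen N R r₁)) with hK
  have hK0 : 0 < K := zero_lt_one.trans_le (le_max_left _ _)
  refine ⟨m / K, by positivity, fun r hr => ?_⟩
  have hle : greenOp N R f r ≤ radGreen N R (max r r₁) * K := by
    refine (le_abs_self _).trans ?_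
    rcases le_total r r₁ with h | h
    · rw [max_eq_right h]
      calc |greenOp N R f r| ≤ D := hD r hr
        _ = radGreen N R r₁ * (D / radGreen N R r₁) := by field_simp
        _ ≤ _ := by gcongr; exact (le_max_right _ _).trans (le_max_right _ _)
    · rw [max_eq_left h]
      have hr0 := hr₁.1.trans_le h
      refine (abs_greenOp_le hb hr0 hr.2).trans ?_
      have := radGreen_nonneg (N := N) hr0 hr.2
      gcongr
      exact (le_max_left _ _).trans (le_max_right _ _)
  calc m / K * greenOp N R f r ≤ m / K * (radGreen N R (max r r₁) * K) := by gcongr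
    _ = radGreen N R (max r r₁) * m := by field_simp
    _ ≤ _ := radGreen_mul_integral_le_greenOp hR hg hb' h0 hr₁ hr.2

end GreenComparison

namespace IsGreenSolution

variable {N : ℕ} {R p lam F M : ℝ} {h U : ℝ → ℝ}

theorem eq_sub (S : IsGreenSolution N R h p lam F U) (hR : 0 < R) (hp : 2 < p)
    (hc : ContinuousOn h (Ioo 0 R)) {D F' : ℝ} (hD : ∀ ρ ∈ Ioo 0 R, |U ρ| ≤ D)
    (hF' : ∀ ρ ∈ Ioo 0 R, |schrodingerRHS h p 0 U ρ| ≤ F') {r : ℝ} (hr : r ≤ R) :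
    U r = greenOp N R (schrodingerRHS h p 0 U) r - lam * greenOp N R U r := by
  have hcU := S.cont.mono Ioo_subset_Icc_self
  have h1 := integrableOn_green (N := N) hR (continuousOn_schrodingerRHS (lam := 0) hp hc hcU)
    hF' hr
  have h2 := integrableOn_green (N := N) hR hcU hD hr
  rw [S.eq_green]
  unfold greenOp
  rw [← integral_const_mul, ← integral_sub h1 (h2.const_mul _)]
  congr 1 with ρ
  simp only [schrodingerRHS]
  ring

theorem neg_firstEig_lt (S : IsGreenSolution N R h p lam F U) (hN : 1 ≤ N) (hR : 0 < R)
    (hp : 2 < p) (hc : ContinuousOn h (Ico 0 R)) (hh0 : 0 < h 0) (h0 : ∀ r ∈ Ioo 0 R, 0 ≤ h r)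
    (hM : ∀ r ∈ Ioo 0 R, h r ≤ M) (hU : ∀ r ∈ Ioo 0 R, 0 < U r) :
    -firstEig (Metric.ball (0 : Euc N) R) < lam := by
  have hc' := hc.mono Ioo_subset_Ico_self
  have hcU := S.cont.mono Ioo_subset_Icc_self
  obtain ⟨D, hD'⟩ := isCompact_Icc.exists_bound_of_continuousOn S.cont
  have hD : ∀ ρ ∈ Ioo 0 R, |U ρ| ≤ D := fun ρ hρ => hD' ρ (Ioo_subset_Icc_self hρ)
  have hM0 : 0 ≤ M := (h0 (R / 2) ⟨by linarith, by linarith⟩).trans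
    (hM (R / 2) ⟨by linarith, by linarith⟩)
  have hF' : ∀ ρ ∈ Ioo 0 R, |schrodingerRHS h p 0 U ρ| ≤ (M * D ^ (p - 2) + |0|) * D := by
    intro ρ hρ
    have hρD := hD ρ hρ
    have hp' : 0 ≤ p - 2 := by linarith
    have : 0 ≤ D := (abs_nonneg _).trans hρD
    refine (abs_schrodingerRHS_le (h0 ρ hρ) (hM ρ hρ)).trans ?_
    gcongr
  have hpw : ∀ ρ ∈ Ioo 0 R, 0 < |U ρ| ^ (p - 2) * U ρ := fun ρ hρ =>
    mul_pos (Real.rpow_pos_of_pos (abs_pos.2 (hU ρ hρ).ne') _) (hU ρ hρ)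
  obtain ⟨r₁, hr₁, hpos⟩ : ∃ r₁ ∈ Ioo 0 R, ∀ ρ ∈ Ioo 0 r₁, 0 < h ρ := by
    have h1 : ∀ᶠ r in 𝓝[>] 0, 0 < h r := by
      have h2 := (hc 0 ⟨le_rfl, hR⟩).mono Ioo_subset_Ico_self
      rw [ContinuousWithinAt, nhdsWithin_Ioo_eq_nhdsGT hR] at h2
      exact h2.eventually_const_lt hh0
    obtain ⟨u, hu, hu'⟩ := mem_nhdsGT_iff_exists_Ioo_subset.1 h1
    refine ⟨min u (R / 2), ⟨lt_min hu (by linarith), (min_le_right _ _).trans_lt (by linarith)⟩,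
      fun ρ hρ => hu' ⟨hρ.1, hρ.2.trans_le (min_le_left _ _)⟩⟩
  obtain ⟨δ, hδ, hle⟩ := exists_mul_greenOp_le (N := N) hR hcU hD
    (continuousOn_schrodingerRHS (lam := 0) hp hc' hcU) hF'
    (fun ρ hρ => by
      simpa [schrodingerRHS] using mul_nonneg (h0 ρ hρ) (hpw ρ hρ).le) hr₁
    (fun ρ hρ => by
      simpa only [schrodingerRHS, zero_mul, sub_zero] using
        mul_pos (hpos ρ hρ) (hpw ρ ⟨hρ.1, hρ.2.trans hr₁.2⟩))
  obtain ⟨hψ, hlap⟩ := contDiffOn_radial (U := greenOp N R U) (C := D) hN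
    (S.cont.mono Ico_subset_Icc_self) (fun r hr => hasDerivAt_greenOp hR hcU hD hr)
    fun r hr => abs_greenOp_zero_sub_le hR hcU hD hr.1 hr.2.le fun ρ hρ =>
      hD ρ ⟨hρ.1, hρ.2.trans hr.2⟩
  have hkey : δ - lam ≤ firstEig (Metric.ball (0 : Euc N) R) := by
    refine le_firstEig_ball hR hψ (fun x hx => ?_) fun x hx => ?_
    · exact greenOp_pos hR hcU hD hU (by simpa using hx)
    · have hxR : ‖x‖ < R := by simpa using hx
      rw [hlap x hx, S.eq_sub hR hp hc' hD hF' hxR.le]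
      have := hle ‖x‖ ⟨norm_nonneg x, hxR.le⟩
      linarith
  linarith

theorem isPosSolution (S : IsGreenSolution N R h p lam F U) (hN : 1 ≤ N) (hR : 0 < R)
    (hp : 2 < p) (hc : ContinuousOn h (Ico 0 R)) (h0 : ∀ r ∈ Ioo 0 R, 0 ≤ h r)
    (hM : ∀ r ∈ Ioo 0 R, h r ≤ M) (hM0 : 0 ≤ M) (hU : ∀ r ∈ Ioo 0 R, 0 < U r) :
    IsPosSolution (Metric.ball (0 : Euc N) R) (fball N h p) lam fun x => U ‖x‖ := by
  have hc' := hc.mono Ioo_subset_Ico_self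
  have hcU := S.cont.mono Ico_subset_Icc_self
  have hpos : ∀ x ∈ Metric.ball (0 : Euc N) R, 0 < U ‖x‖ := by
    intro x hx
    have hxR : ‖x‖ < R := by simpa using hx
    rcases (norm_nonneg x).eq_or_lt with h | h
    · rw [← h]
      exact S.pos_zero hR hp hc' h0 hM hM0 hU
    · exact hU _ ⟨h, hxR⟩
  obtain ⟨hu, hlap⟩ := contDiffOn_radial (C := F) hN (continuousOn_schrodingerRHS hp hc hcU)
    (fun r hr => S.hasDerivAt hR hp hc' hr) fun r hr => by
      rw [S.eq_green 0, S.eq_green r]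
      exact abs_greenOp_zero_sub_le hR (S.continuousOn_rhs hp hc') S.bound hr.1 hr.2.le
        fun ρ hρ => S.bound ρ ⟨hρ.1, hρ.2.trans hr.2⟩
  refine ⟨hu, ?_, hpos, fun x hx => ?_, fun x hx => ?_⟩
  · rw [closure_ball _ hR.ne']
    exact S.cont.comp continuous_norm.continuousOn fun x hx =>
      ⟨norm_nonneg x, by simpa using hx⟩
  · rw [frontier_ball _ hR.ne', mem_sphere_zero_iff_norm] at hx
    show U ‖x‖ = 0
    rw [hx, S.eq_green, greenOp_right]
  · have hx0 := hpos x hx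
    rw [hlap x hx, schrodingerRHS, fball, abs_of_pos hx0, ← Real.rpow_add_one hx0.ne',
      show p - 2 + 1 = p - 1 by ring]
    ring

end IsGreenSolution

theorem setIntegral_ball_radial {N : ℕ} (hN : 1 ≤ N) {R : ℝ} (f : ℝ → ℝ) :
    ∫ x in Metric.ball (0 : Euc N) R, f ‖x‖ =
      N * volume.real (Metric.ball (0 : Euc N) 1) * ∫ r in Ioo 0 R, r ^ (N - 1) * f r := by
  have : Nontrivial (Euc N) := by
    have : Nonempty (Fin N) := ⟨⟨0, hN⟩⟩
    infer_instance
  have h1 : ∀ x : Euc N, (Metric.ball 0 R).indicator (fun x => f ‖x‖) x =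
      (Iio R).indicator f ‖x‖ := fun x => by
    simp only [indicator, mem_ball_zero_iff, mem_Iio]
  rw [← integral_indicator Metric.isOpen_ball.measurableSet]
  simp only [h1]
  rw [integral_fun_norm_addHaar volume ((Iio R).indicator f), finrank_euclideanSpace_fin,
    nsmul_eq_mul, smul_eq_mul, ← mul_assoc]
  congr 1
  rw [← integral_indicator measurableSet_Ioi, ← integral_indicator measurableSet_Ioo]
  congr 1 with r
  by_cases h1 : 0 < r <;> by_cases h2 : r < R <;> simp [indicator, h1, h2]

/-- for `-Δu + λu = h(|x|)u^{p-1}` on the ball `B_R`, under (C1)-(C4) and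
`2 < p < 2 + 4/N`, every mass `c ∈ (0, ∞)` is attained by a positive solution. -/
theorem statement11 {N : ℕ} (hN : 2 ≤ N) {R : ℝ} (hR : 0 < R) {p : ℝ}
    (hpcrit : 3 ≤ N → p < 2 * N / ((N : ℝ) - 2)) (hp2 : 2 < p)
    (hp : p < 2 + 4 / (N : ℝ))
    {h : ℝ → ℝ} (hreg : ContDiffOn ℝ 1 h (Ico 0 R))
    (hC1 : (∀ r ∈ Ioo (0 : ℝ) R, 0 ≤ h r) ∧ ∃ r ∈ Ioo (0 : ℝ) R, 0 < h r)
    (hC2 : ∀ r ∈ Ioo (0 : ℝ) R,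
      2 * r ^ 2 * deriv h r / p - 2 * ((N : ℝ) - 2 - 2 / p) * r * h r ≤ 0)
    (hC3 : ∀ m ∈ Ioc (0 : ℝ) ((N : ℝ) - 2), ∃ b ∈ Icc (0 : ℝ) R,
      (∀ r ∈ Ioo (0 : ℝ) b, 0 ≤ Hfun N p h r m) ∧ ∀ r ∈ Ioo b R, Hfun N p h r m ≤ 0)
    (hC4 : h 0 = 1 ∧ ∃ M₀ : ℝ, 0 < M₀ ∧ ∀ r ∈ Ico (0 : ℝ) R, h r < M₀) :
    ∀ c : ℝ, 0 < c →
      ∃ (lam : ℝ) (u : Euc N → ℝ), - firstEig (Metric.ball (0 : Euc N) R) < lam ∧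
        IsPosSolution (Metric.ball (0 : Euc N) R) (fball N h p) lam u ∧
        (∫ x in Metric.ball (0 : Euc N) R, (u x) ^ 2) = c := by
  intro c hc
  obtain ⟨hh0, M, hM0, hM⟩ := hC4
  have hcont := hreg.continuousOn
  have hMle : ∀ r ∈ Ioo 0 R, h r ≤ M := fun r hr => (hM r (Ioo_subset_Ico_self hr)).le
  have hω : 0 < (N : ℝ) * volume.real (Metric.ball (0 : Euc N) 1) :=
    mul_pos (by exact_mod_cast (by omega : 0 < N))
      (ENNReal.toReal_pos (Metric.measure_ball_pos _ _ one_pos).ne' measure_ball_lt_top.ne)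
  have : Fact ((2 : ENNReal) ≠ ⊤) := ⟨ENNReal.ofNat_ne_top⟩
  obtain ⟨lam, F, U, S, hU, hmass⟩ := (isRadKernel_radKernel (N := N) hR).exists_pos_minimizer hN hR
    hp hp2 (hcont.mono Ioo_subset_Ico_self) hC1.1 hMle hM0.le (div_pos hc hω)
  refine ⟨lam, fun x => U ‖x‖, S.neg_firstEig_lt (by omega) hR hp2 hcont (by rw [hh0]; norm_num)
    hC1.1 hMle hU, S.isPosSolution (by omega) hR hp2 hcont hC1.1 hMle hM0.le hU, ?_⟩
  rw [setIntegral_ball_radial (by omega) fun r => U r ^ 2, hmass]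
  exact mul_div_cancel₀ c hω.ne'
end
end
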